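/- arXiv:1905.12991 — 3 statements merged into one kernel-verified Lean document; each statement's English description precedes it below -/
import Mathlib

section
/- A DB signature $\Sigma$ is a finite multi-sorted first-order signature with equality whose only other symbols are unary functions and constants (sorts are interpreted by non-empty sets); some of the sorts that are not the source of a function are designated as value sorts, all other sorts are id sorts. $\Sigma$ is acyclic if the directed graph with the sorts as nodes and an edge $S\to S'$ for every function symbol $f:S\to S'$ has no directed cycle. Let $T$ be a set of universal $\Sigma$-sentences. A DB instance is a model of $T$ with finite id sorts. Assume that every constraint (finite conjunction of literals) satisfiable in a model of $T$ is satisfiable in a DB instance, and that $T$ has a model completion $T^*$, i.e. a theory $T^*\supseteq T$ with quantifier elimination such that every model of $T$ embeds into a model of $T^*$. Fix finitely many additional artifact sorts, a finite tuple $x$ of variables of sorts of $\Sigma$, and a finite tuple $a$ of unary function variables, each with an artifact sort as source and a sort of $\Sigma$ as target. In models of $T$, of $T^*$, and in DB instances, artifact sorts are interpreted by arbitrary non-empty sets. A state formula is (up to logical equivalence) a formula $\exists e\,\phi(e,x,a)$, with $\phi$ quantifier-free and the $e$ variables of artifact sorts. It is local if it is a disjunction of formulae $$\exists e_1\cdots\exists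 e_k\Big(\delta(e_1,\dots,e_k)\wedge\bigwedge_{i=1}^k\phi_i(e_i,x,a)\Big),$$ where $\delta$ is a conjunction of equalities and inequalities between the $e$'s and each $\phi_i$ is quantifier-free and contains no quantified variable other than $e_i$. A transition formula has the form $$\exists e\Big(\gamma(e,x,a)\wedge\bigwedge_i x_i'=F_i(e,x,a)\wedge\bigwedge_j a_j'=\lambda y.\,G_j(y,e,x,a)\Big),$$ where the $e$ are variables of artifact sorts and of sorts of $\Sigma$, $\gamma$ is quantifier-free, and $F_i,G_j$ are functions defined by finitely many quantifier-free cases. Put $\mathrm{Pre}(\tau,\phi):=\exists x'\exists a'\,(\tau(x,a,x',a')\wedge\phi(x',a'))$. A transition formula $\hat\tau$ is local if, for every local formula $\phi$, $\mathrm{Pre}(\hat\tau,\phi)$ is equivalent modulo $T^*$ to a local formula. A relational artifact system over these data consists of an initial formula $\iota=\bigwedge_i x_i=c_i\wedge\bigwedge_j a_j=\lambda y.\,d_j$, with $c_i,d_j$ constants of $\Sigma$, and a finite disjunction $\tau$ of transition formulae. It is safe with respect to a state formula $\upsilon$ if in no DB instance is there a finite sequence (of length $k\ge 0$) of $\tau$-steps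 from an assignment of $(x,a)$ satisfying $\iota$ to one satisfying $\upsilon$. The backward reachability algorithm starts with $\phi:=\upsilon$, $B:=\bot$; while $\phi\wedge\neg B$ is satisfiable in a model of $T$, it returns "unsafe" if $\iota\wedge\phi$ is satisfiable in a model of $T$, and otherwise sets $B:=\phi\vee B$ and then replaces $\phi$ by the result of quantifier elimination in $T^*$ applied to $\mathrm{Pre}(\tau,\phi)$, that is, by a state formula equivalent to $\mathrm{Pre}(\tau,\phi)$ modulo $T^*$; when the loop is left, it returns "safe". Theorem. If $\Sigma$ is acyclic, $\tau$ is a disjunction of local transition formulae and $\upsilon$ is a local state formula, then the backward reachability algorithm applied to $\upsilon$ terminates, whichever equivalent state formulae the quantifier elimination steps produce (and such formulae always exist), and its answer is correct: if it returns "unsafe", the system is not safe with respect to $\upsilon$, and if it returns "safe", the system is safe with respect to $\upsilon$. -/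
namespace RelationalArtifact

/-! ## Many-sorted first-order logic over DB signatures -/

/-- A DB signature: finitely many sorts, unary function symbols and constants. The sorts without
outgoing functions (leaves) are split into value sorts and unary relations; a sort that is not a
value sort is an id sort. -/
structure DBSignature where
  Srt : Type
  Fn : Srt → Srt → Type
  Cst : Srt → Type
  finite_srt : Finite Srt
  finite_fn : Finite ((s : Srt) × (s' : Srt) × Fn s s')
  finite_cst : Finite ((s : Srt) × Cst s)
  IsValue : Srt → Prop
  value_leaf : ∀ s s', IsValue s → IsEmpty (Fn s s')

/-- The characteristic graph has an edge `s → s'` for each function symbol `f : s → s'`;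
`Σ` is acyclic if that graph has no directed cycle. -/
def DBSignature.Acyclic (Sg : DBSignature) : Prop :=
  ∀ s : Sg.Srt, ¬ Relation.TransGen (fun s₁ s₂ => Nonempty (Sg.Fn s₁ s₂)) s s

/-- `Var Γ i`: the variables of sort `i` declared in the finite context `Γ`. -/
inductive Var {ι : Type} : List ι → ι → Type
  | here {i : ι} {Γ : List ι} : Var (i :: Γ) i
  | there {i j : ι} {Γ : List ι} (v : Var Γ i) : Var (j :: Γ) i

/-- All variables of a context, each listed once. -/
def Var.all {ι : Type} : (Γ : List ι) → List ((i : ι) × Var Γ i)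
  | [] => []
  | i :: Γ => ⟨i, .here⟩ :: (Var.all Γ).map (fun p => ⟨p.1, .there p.2⟩)

/-- Assignments of elements to the variables of a context. -/
abbrev Env {ι : Type} (C : ι → Type) (Γ : List ι) : Type := ∀ i, Var Γ i → C i

def Env.nil {ι : Type} {C : ι → Type} : Env C [] := fun _ v => nomatch v

def Env.cons {ι : Type} {C : ι → Type} {Γ : List ι} {i : ι} (m : C i) (ρ : Env C Γ) :
    Env C (i :: Γ)
  | _, .here => m
  | _, .there v => ρ _ v

/-- Well-sorted `Σ`-terms whose variables of sort `s` are the elements of `V s`. -/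
inductive Term (Sg : DBSignature) (V : Sg.Srt → Type) : Sg.Srt → Type
  | var {s : Sg.Srt} (v : V s) : Term Sg V s
  | cst {s : Sg.Srt} (c : Sg.Cst s) : Term Sg V s
  | app {s s' : Sg.Srt} (f : Sg.Fn s s') (t : Term Sg V s) : Term Sg V s'

/-- Every variable occurring in the term satisfies `P`. -/
def Term.AllVars {Sg : DBSignature} {V : Sg.Srt → Type} (P : ∀ s, V s → Prop) :
    {s : Sg.Srt} → Term Sg V s → Prop
  | _, .var v => P _ v
  | _, .cst _ => True
  | _, .app _ t => t.AllVars P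

/-- `Σ`-structures; sorts are interpreted as non-empty sets. -/
structure Str (Sg : DBSignature) where
  carrier : Sg.Srt → Type
  nonempty : ∀ s, Nonempty (carrier s)
  fn : ∀ {s s' : Sg.Srt}, Sg.Fn s s' → carrier s → carrier s'
  cst : ∀ {s : Sg.Srt}, Sg.Cst s → carrier s

def Term.eval {Sg : DBSignature} {V : Sg.Srt → Type} (M : Str Sg) (ρ : ∀ s, V s → M.carrier s) :
    {s : Sg.Srt} → Term Sg V s → M.carrier s
  | _, .var v => ρ _ v
  | _, .cst c => M.cst c
  | _, .app f t => M.fn f (t.eval M ρ)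

/-- First-order `Σ`-formulae with free variables in `Γ`. -/
inductive Formula (Sg : DBSignature) : List Sg.Srt → Type
  | top {Γ : List Sg.Srt} : Formula Sg Γ
  | eq {Γ : List Sg.Srt} {s : Sg.Srt} (t u : Term Sg (Var Γ) s) : Formula Sg Γ
  | neg {Γ : List Sg.Srt} (φ : Formula Sg Γ) : Formula Sg Γ
  | and {Γ : List Sg.Srt} (φ ψ : Formula Sg Γ) : Formula Sg Γ
  | all {Γ : List Sg.Srt} (s : Sg.Srt) (φ : Formula Sg (s :: Γ)) : Formula Sg Γ

def Formula.Holds {Sg : DBSignature} (M : Str Sg) :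
    {Γ : List Sg.Srt} → Formula Sg Γ → Env M.carrier Γ → Prop
  | _, .top, _ => True
  | _, .eq t u, ρ => t.eval M ρ = u.eval M ρ
  | _, .neg φ, ρ => ¬ φ.Holds M ρ
  | _, .and φ ψ, ρ => φ.Holds M ρ ∧ ψ.Holds M ρ
  | _, .all s φ, ρ => ∀ m : M.carrier s, φ.Holds M (Env.cons m ρ)

def Formula.IsQF {Sg : DBSignature} : {Γ : List Sg.Srt} → Formula Sg Γ → Prop
  | _, .top => True
  | _, .eq _ _ => True
  | _, .neg φ => φ.IsQF
  | _, .and φ ψ => φ.IsQF ∧ ψ.IsQF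
  | _, .all _ _ => False

/-- Universal formulae: a block of universal quantifiers followed by a quantifier-free matrix. -/
inductive Formula.IsUniversal {Sg : DBSignature} : {Γ : List Sg.Srt} → Formula Sg Γ → Prop
  | qf {Γ : List Sg.Srt} {φ : Formula Sg Γ} (h : φ.IsQF) : φ.IsUniversal
  | all {Γ : List Sg.Srt} {s : Sg.Srt} {φ : Formula Sg (s :: Γ)} (h : φ.IsUniversal) :
      (Formula.all s φ).IsUniversal

/-- Constraints: finite conjunctions of literals. -/
inductive Formula.IsConstraint {Sg : DBSignature} : {Γ : List Sg.Srt} → Formula Sg Γ → Prop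
  | top {Γ : List Sg.Srt} : (Formula.top : Formula Sg Γ).IsConstraint
  | eq {Γ : List Sg.Srt} {s : Sg.Srt} (t u : Term Sg (Var Γ) s) : (Formula.eq t u).IsConstraint
  | ne {Γ : List Sg.Srt} {s : Sg.Srt} (t u : Term Sg (Var Γ) s) :
      (Formula.eq t u).neg.IsConstraint
  | and {Γ : List Sg.Srt} {φ ψ : Formula Sg Γ} (h : φ.IsConstraint) (h' : ψ.IsConstraint) :
      (φ.and ψ).IsConstraint

abbrev Theory (Sg : DBSignature) : Type := Set (Formula Sg [])

def Str.Models {Sg : DBSignature} (M : Str Sg) (T : Theory Sg) : Prop :=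
  ∀ φ ∈ T, φ.Holds M Env.nil

/-- A DB schema: a DB signature with a set of universal sentences. -/
structure DBSchema where
  sig : DBSignature
  T : Theory sig
  universal : ∀ φ ∈ T, φ.IsUniversal

/-- DB instances: models of `T` in which every id sort is finite. -/
def DBSchema.IsInstance (D : DBSchema) (M : Str D.sig) : Prop :=
  M.Models D.T ∧ ∀ s, ¬ D.sig.IsValue s → Finite (M.carrier s)

/-- Finite model property (for constraint satisfiability): every constraint that is satisfiable in
a model of `T` is satisfiable in a DB instance. -/
def DBSchema.FiniteModelProperty (D : DBSchema) : Prop :=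
  ∀ (Γ : List D.sig.Srt) (φ : Formula D.sig Γ), φ.IsConstraint →
    (∃ M : Str D.sig, M.Models D.T ∧ ∃ ρ : Env M.carrier Γ, φ.Holds M ρ) →
    ∃ M : Str D.sig, D.IsInstance M ∧ ∃ ρ : Env M.carrier Γ, φ.Holds M ρ

/-- Embeddings of `Σ`-structures. -/
structure Embedding {Sg : DBSignature} (M N : Str Sg) where
  map : ∀ s, M.carrier s → N.carrier s
  inj : ∀ s, Function.Injective (map s)
  map_fn : ∀ {s s' : Sg.Srt} (f : Sg.Fn s s') (m : M.carrier s),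
    map s' (M.fn f m) = N.fn f (map s m)
  map_cst : ∀ {s : Sg.Srt} (c : Sg.Cst s), map s (M.cst c) = N.cst c

/-- `Tstar` is the model completion of the universal theory `T`: it extends `T`, every model of `T`
embeds into a model of `Tstar`, and `Tstar` eliminates quantifiers. -/
structure IsModelCompletion {Sg : DBSignature} (T Tstar : Theory Sg) : Prop where
  extends_theory : T ⊆ Tstar
  embeds : ∀ M : Str Sg, M.Models T → ∃ N : Str Sg, N.Models Tstar ∧ Nonempty (Embedding M N)
  elim : ∀ (Γ : List Sg.Srt) (φ : Formula Sg Γ), ∃ ψ : Formula Sg Γ, ψ.IsQF ∧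
    ∀ M : Str Sg, M.Models Tstar → ∀ ρ : Env M.carrier Γ, φ.Holds M ρ ↔ ψ.Holds M ρ

/-! ## Artifact settings and their formulae -/

/-- A DB schema with an artifact extension and an artifact setting over it: `Art` are the artifact
sorts, `X s` the artifact variables of basic sort `s`, and `A E s` the artifact components with
source the artifact sort `E` and target the basic sort `s`. (Artifact variables have basic sorts
since an initial formula equates each of them with a constant of `Σ`.) -/
structure Setting where
  db : DBSchema
  Art : Type
  X : db.sig.Srt → Type
  A : Art → db.sig.Srt → Type
  finite_art : Finite Art
  finite_x : Finite ((s : db.sig.Srt) × X s)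
  finite_a : Finite ((E : Art) × (s : db.sig.Srt) × A E s)

/-- Structures over the artifact extension of `Σ`. -/
structure ExtStr (S : Setting) where
  base : Str S.db.sig
  art : S.Art → Type
  art_nonempty : ∀ E, Nonempty (art E)

/-- Assignments to the artifact setting `(x, a)` in `M`. -/
structure Assignment {S : Setting} (M : ExtStr S) where
  x : ∀ {s : S.db.sig.Srt}, S.X s → M.base.carrier s
  a : ∀ {E : S.Art} {s : S.db.sig.Srt}, S.A E s → M.art E → M.base.carrier s

/-- The basic-sorted expressions from which terms are built with the symbols of `Σ`: artifact
variables, individual variables of basic sort (declared in `Δ`) and `a[e]` for an artifact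
component `a` and an individual variable `e` of artifact sort (declared in `Γ`). -/
inductive Leaf (S : Setting) (Γ : List S.Art) (Δ : List S.db.sig.Srt) : S.db.sig.Srt → Type
  | artVar {s : S.db.sig.Srt} (x : S.X s) : Leaf S Γ Δ s
  | data {s : S.db.sig.Srt} (d : Var Δ s) : Leaf S Γ Δ s
  | read {E : S.Art} {s : S.db.sig.Srt} (a : S.A E s) (e : Var Γ E) : Leaf S Γ Δ s

def Leaf.eval {S : Setting} {Γ : List S.Art} {Δ : List S.db.sig.Srt} {M : ExtStr S}
    (α : Assignment M) (e : Env M.art Γ) (d : Env M.base.carrier Δ) :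
    ∀ s, Leaf S Γ Δ s → M.base.carrier s
  | _, .artVar x => α.x x
  | _, .data v => d _ v
  | _, .read a i => α.a a (e _ i)

/-- Terms of basic sort (a term of artifact sort is just a variable). -/
abbrev STerm (S : Setting) (Γ : List S.Art) (Δ : List S.db.sig.Srt) : S.db.sig.Srt → Type :=
  Term S.db.sig (Leaf S Γ Δ)

def STerm.eval {S : Setting} {Γ : List S.Art} {Δ : List S.db.sig.Srt} {M : ExtStr S}
    (α : Assignment M) (e : Env M.art Γ) (d : Env M.base.carrier Δ) {s : S.db.sig.Srt}
    (t : STerm S Γ Δ s) : M.base.carrier s :=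
  Term.eval M.base (Leaf.eval α e d) t

/-- Quantifier-free formulae over the artifact setting. -/
inductive QF (S : Setting) (Γ : List S.Art) (Δ : List S.db.sig.Srt) : Type
  | top : QF S Γ Δ
  | eq {s : S.db.sig.Srt} (t u : STerm S Γ Δ s) : QF S Γ Δ
  | eqArt {E : S.Art} (e e' : Var Γ E) : QF S Γ Δ
  | neg (φ : QF S Γ Δ) : QF S Γ Δ
  | and (φ ψ : QF S Γ Δ) : QF S Γ Δ

def QF.Holds {S : Setting} {Γ : List S.Art} {Δ : List S.db.sig.Srt} {M : ExtStr S}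
    (α : Assignment M) (e : Env M.art Γ) (d : Env M.base.carrier Δ) : QF S Γ Δ → Prop
  | .top => True
  | .eq t u => t.eval α e d = u.eval α e d
  | .eqArt i j => e _ i = e _ j
  | .neg φ => ¬ φ.Holds α e d
  | .and φ ψ => φ.Holds α e d ∧ ψ.Holds α e d

def QF.conj {S : Setting} {Γ : List S.Art} {Δ : List S.db.sig.Srt} : List (QF S Γ Δ) → QF S Γ Δ
  | [] => .top
  | φ :: l => φ.and (QF.conj l)

/-- The only individual variable of artifact sort occurring in the leaf, if any, is `i`. -/
def Leaf.OnlyMentions {S : Setting} {Γ : List S.Art} {Δ : List S.db.sig.Srt} {E : S.Art}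
    (i : Var Γ E) : ∀ s, Leaf S Γ Δ s → Prop
  | _, .artVar _ => True
  | _, .data _ => True
  | _, .read (E := E') _ e => (⟨E', e⟩ : (F : S.Art) × Var Γ F) = ⟨E, i⟩

/-- The only individual variable of artifact sort occurring in the formula, if any, is `i`. -/
def QF.OnlyMentions {S : Setting} {Γ : List S.Art} {Δ : List S.db.sig.Srt} {E : S.Art}
    (i : Var Γ E) : QF S Γ Δ → Prop
  | .top => True
  | .eq t u => t.AllVars (Leaf.OnlyMentions i) ∧ u.AllVars (Leaf.OnlyMentions i)
  | .eqArt (E := E') e e' => (⟨E', e⟩ : (F : S.Art) × Var Γ F) = ⟨E, i⟩ ∧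
      (⟨E', e'⟩ : (F : S.Art) × Var Γ F) = ⟨E, i⟩
  | .neg φ => φ.OnlyMentions i
  | .and φ ψ => φ.OnlyMentions i ∧ ψ.OnlyMentions i

/-- Conjunctions of equalities and inequalities between variables of artifact sort. -/
inductive QF.IsDelta {S : Setting} {Γ : List S.Art} {Δ : List S.db.sig.Srt} : QF S Γ Δ → Prop
  | top : QF.top.IsDelta
  | eq {E : S.Art} (e e' : Var Γ E) : (QF.eqArt e e').IsDelta
  | ne {E : S.Art} (e e' : Var Γ E) : (QF.eqArt e e').neg.IsDelta
  | and {φ ψ : QF S Γ Δ} (h : φ.IsDelta) (h' : ψ.IsDelta) : (φ.and ψ).IsDelta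

/-- A formula `∃ e₁ ⋯ ∃ e_k, φ(e, x, a)` with `φ` quantifier-free and the `e_i` of artifact
sorts. -/
structure Block (S : Setting) where
  ctx : List S.Art
  body : QF S ctx []

def Block.Holds {S : Setting} {M : ExtStr S} (b : Block S) (α : Assignment M) : Prop :=
  ∃ e : Env M.art b.ctx, b.body.Holds α e Env.nil

/-- The block has the form `∃ e₁ ⋯ ∃ e_k, (δ(e₁, …, e_k) ∧ ⋀ᵢ φᵢ(eᵢ, x, a))`. -/
def Block.IsLocal {S : Setting} (b : Block S) : Prop :=
  ∃ (δ : QF S b.ctx []) (φ : ∀ E, Var b.ctx E → QF S b.ctx []),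
    δ.IsDelta ∧ (∀ E (i : Var b.ctx E), (φ E i).OnlyMentions i) ∧
    b.body = δ.and (QF.conj ((Var.all b.ctx).map fun p => φ p.1 p.2))

/-- State formulae, written as finite disjunctions of existential blocks (as sorts are non-empty,
every such disjunction is logically equivalent to a single block). The empty list is `⊥` and
`++` is disjunction. -/
abbrev StateFormula (S : Setting) : Type := List (Block S)

def StateFormula.Holds {S : Setting} {M : ExtStr S} (φ : StateFormula S) (α : Assignment M) :
    Prop :=
  ∃ b ∈ φ, b.Holds α

def StateFormula.IsLocal {S : Setting} (φ : StateFormula S) : Prop := ∀ b ∈ φ, b.IsLocal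

/-- Case-defined functions: `case κ₁ : t₁; …; κₙ : tₙ; otherwise t`, where the `κᵢ` are
quantifier-free formulae and `t`, the `tᵢ` are terms. -/
inductive CaseFn (S : Setting) (Γ : List S.Art) (Δ : List S.db.sig.Srt) (s : S.db.sig.Srt) : Type
  | otherwise (t : STerm S Γ Δ s) : CaseFn S Γ Δ s
  | ifThen (κ : QF S Γ Δ) (t : STerm S Γ Δ s) (F : CaseFn S Γ Δ s) : CaseFn S Γ Δ s

open Classical in
noncomputable def CaseFn.eval {S : Setting} {Γ : List S.Art} {Δ : List S.db.sig.Srt}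
    {s : S.db.sig.Srt} {M : ExtStr S} (α : Assignment M) (e : Env M.art Γ)
    (d : Env M.base.carrier Δ) : CaseFn S Γ Δ s → M.base.carrier s
  | .otherwise t => t.eval α e d
  | .ifThen κ t F => if κ.Holds α e d then t.eval α e d else F.eval α e d

/-- Transition formulae
`∃ e d, (γ(e,d,x,a) ∧ ⋀ x'ᵢ = Fᵢ(e,d,x,a) ∧ ⋀ a'ⱼ = λ y. Gⱼ(y,e,d,x,a))`,
with `e` of artifact sorts, `d` of basic sorts; in `G` the variable `y` is the first one of the
context. -/
structure TransFormula (S : Setting) where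
  artCtx : List S.Art
  dataCtx : List S.db.sig.Srt
  guard : QF S artCtx dataCtx
  updX : ∀ {s : S.db.sig.Srt}, S.X s → CaseFn S artCtx dataCtx s
  updA : ∀ {E : S.Art} {s : S.db.sig.Srt}, S.A E s → CaseFn S (E :: artCtx) dataCtx s

def TransFormula.Holds {S : Setting} {M : ExtStr S} (τ : TransFormula S) (α α' : Assignment M) :
    Prop :=
  ∃ (e : Env M.art τ.artCtx) (d : Env M.base.carrier τ.dataCtx),
    τ.guard.Holds α e d ∧
    (∀ {s : S.db.sig.Srt} (x : S.X s), α'.x x = (τ.updX x).eval α e d) ∧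
    (∀ {E : S.Art} {s : S.db.sig.Srt} (a : S.A E s) (y : M.art E),
      α'.a a y = (τ.updA a).eval α (Env.cons y e) d)

/-- The preimage `∃ x' a', (R(x,a,x',a') ∧ φ(x',a'))`, as a set of assignments. -/
def Pre {S : Setting} {M : ExtStr S} (R : Assignment M → Assignment M → Prop)
    (φ : StateFormula S) (α : Assignment M) : Prop :=
  ∃ α' : Assignment M, R α α' ∧ φ.Holds α'

/-- The transition formula is local: the preimage of every local formula is, modulo the axioms of
`Tstar`, again a local formula. -/
def TransFormula.IsLocal {S : Setting} (Tstar : Theory S.db.sig) (τ : TransFormula S) : Prop :=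
  ∀ φ : StateFormula S, φ.IsLocal → ∃ ψ : StateFormula S, ψ.IsLocal ∧
    ∀ M : ExtStr S, M.base.Models Tstar → ∀ α : Assignment M,
      Pre τ.Holds φ α ↔ ψ.Holds α

/-! ## Relational artifact systems, safety and backward reachability -/

/-- A relational artifact system. The initial formula is `⋀ xᵢ = cᵢ ∧ ⋀ aⱼ = λ y. dⱼ`; the
transition relation is the disjunction of the transition formulae in `trans`. -/
structure RAS extends Setting where
  initX : ∀ {s : db.sig.Srt}, X s → db.sig.Cst s
  initA : ∀ {E : Art} {s : db.sig.Srt}, A E s → db.sig.Cst s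
  trans : List (TransFormula toSetting)

/-- The initial formula `ι`. -/
def RAS.Init (R : RAS) {M : ExtStr R.toSetting} (α : Assignment M) : Prop :=
  (∀ {s : R.db.sig.Srt} (x : R.X s), α.x x = M.base.cst (R.initX x)) ∧
  (∀ {E : R.Art} {s : R.db.sig.Srt} (a : R.A E s) (y : M.art E),
    α.a a y = M.base.cst (R.initA a))

/-- The transition relation `τ`. -/
def RAS.Trans (R : RAS) {M : ExtStr R.toSetting} (α α' : Assignment M) : Prop :=
  ∃ τ ∈ R.trans, τ.Holds α α'

/-- Safety: no DB instance (over the artifact extension) has a finite run from `ι` to `υ`. -/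
def RAS.Safe (R : RAS) (υ : StateFormula R.toSetting) : Prop :=
  ¬ ∃ M : ExtStr R.toSetting, R.db.IsInstance M.base ∧
    ∃ (k : ℕ) (α : ℕ → Assignment M),
      R.Init (α 0) ∧ (∀ i < k, R.Trans (α i) (α (i + 1))) ∧ υ.Holds (α k)

/-- `φ ∧ ¬B` is `T`-satisfiable. -/
def RAS.SatDiff (R : RAS) (φ B : StateFormula R.toSetting) : Prop :=
  ∃ M : ExtStr R.toSetting, M.base.Models R.db.T ∧
    ∃ α : Assignment M, φ.Holds α ∧ ¬ B.Holds α

/-- `ι ∧ φ` is `T`-satisfiable. -/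
def RAS.SatInit (R : RAS) (φ : StateFormula R.toSetting) : Prop :=
  ∃ M : ExtStr R.toSetting, M.base.Models R.db.T ∧
    ∃ α : Assignment M, R.Init α ∧ φ.Holds α

/-- `φ'` is a possible output of quantifier elimination in `Tstar` applied to `Pre(τ, φ)`: a state
formula that is equivalent to `Pre(τ, φ)` modulo `Tstar`. -/
def RAS.IsQEPre (R : RAS) (Tstar : Theory R.db.sig) (φ φ' : StateFormula R.toSetting) : Prop :=
  ∀ M : ExtStr R.toSetting, M.base.Models Tstar → ∀ α : Assignment M,
    φ'.Holds α ↔ Pre R.Trans φ α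

/-- Control states of the backward reachability procedure: the head of the while loop with the
current values of `φ` and `B`, or one of the two `return` statements. -/
inductive BRState (R : RAS) : Type
  | loop (φ B : StateFormula R.toSetting) : BRState R
  | returnUnsafe : BRState R
  | returnSafe (B : StateFormula R.toSetting) : BRState R

/-- The procedure starts with `φ := υ` and `B := ⊥`. -/
def BRState.start {R : RAS} (υ : StateFormula R.toSetting) : BRState R := .loop υ []

/-- One step of the procedure: leave the loop if `φ ∧ ¬B` is `T`-unsatisfiable; otherwise return
`unsafe` if `ι ∧ φ` is `T`-satisfiable, and else execute
`B := φ ∨ B; φ := Pre(τ, φ); φ := QE(T*, φ)`. -/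
inductive RAS.BRStep (R : RAS) (Tstar : Theory R.db.sig) : BRState R → BRState R → Prop
  | fixpoint {φ B : StateFormula R.toSetting} (h : ¬ R.SatDiff φ B) :
      R.BRStep Tstar (.loop φ B) (.returnSafe B)
  | found {φ B : StateFormula R.toSetting} (h : R.SatDiff φ B) (hι : R.SatInit φ) :
      R.BRStep Tstar (.loop φ B) .returnUnsafe
  | iterate {φ B φ' : StateFormula R.toSetting} (h : R.SatDiff φ B) (hι : ¬ R.SatInit φ)
      (hφ' : R.IsQEPre Tstar φ φ') :
      R.BRStep Tstar (.loop φ B) (.loop φ' (φ ++ B))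

/-- `c` occurs in some execution of the procedure on input `υ`. -/
def RAS.BRReach (R : RAS) (Tstar : Theory R.db.sig) (υ : StateFormula R.toSetting)
    (c : BRState R) : Prop :=
  Relation.ReflTransGen (R.BRStep Tstar) (BRState.start υ) c

/-- Termination on input `υ`, whichever outputs quantifier elimination produces: no execution is
infinite, and no execution gets stuck before a `return` statement. -/
def RAS.BRTerminates (R : RAS) (Tstar : Theory R.db.sig) (υ : StateFormula R.toSetting) : Prop :=
  (¬ ∃ c : ℕ → BRState R, c 0 = BRState.start υ ∧ ∀ n, R.BRStep Tstar (c n) (c (n + 1))) ∧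
  ∀ φ B : StateFormula R.toSetting, R.BRReach Tstar υ (.loop φ B) →
    ∃ c, R.BRStep Tstar (.loop φ B) c

/-- Every answer returned on input `υ` is the correct answer to the safety problem. -/
def RAS.BRCorrect (R : RAS) (Tstar : Theory R.db.sig) (υ : StateFormula R.toSetting) : Prop :=
  (R.BRReach Tstar υ .returnUnsafe → ¬ R.Safe υ) ∧
  ∀ B : StateFormula R.toSetting, R.BRReach Tstar υ (.returnSafe B) → R.Safe υ

end RelationalArtifact

namespace RelationalArtifact

/-! ## Finiteness of the set of terms -/

theorem Term.finite_of_acyclic {Sg : DBSignature} (hac : Sg.Acyclic) {V : Sg.Srt → Type}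
    (hV : ∀ s, Finite (V s)) (s : Sg.Srt) : Finite (Term Sg V s) := by
  have := Sg.finite_srt
  have := Sg.finite_fn
  have := Sg.finite_cst
  let r : Sg.Srt → Sg.Srt → Prop := Relation.TransGen fun s₁ s₂ => Nonempty (Sg.Fn s₁ s₂)
  have : Std.Irrefl r := ⟨hac⟩
  have wf : WellFounded r := Finite.wellFounded_of_trans_of_irrefl r
  induction s using wf.induction with
  | _ s' ih =>
    have hc : Finite (Sg.Cst s') :=
      Finite.of_injective (fun c => (⟨s', c⟩ : (s : Sg.Srt) × Sg.Cst s))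
        fun a b h => eq_of_heq (Sigma.mk.inj h).2
    have hf : ∀ s, Finite (Sg.Fn s s') := fun s =>
      Finite.of_injective (fun f => (⟨s, s', f⟩ : (s : Sg.Srt) × (s' : Sg.Srt) × Sg.Fn s s'))
        fun a b h => by simpa using h
    have ht : ∀ s, Finite (Sg.Fn s s' × Term Sg V s) := fun s => by
      by_cases h : Nonempty (Sg.Fn s s')
      · have := ih s (.single h)
        infer_instance
      · have := not_nonempty_iff.mp h
        infer_instance
    let g : V s' ⊕ Sg.Cst s' ⊕ ((s : Sg.Srt) × (Sg.Fn s s' × Term Sg V s)) → Term Sg V s'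
      | .inl v => .var v
      | .inr (.inl c) => .cst c
      | .inr (.inr ⟨_, f, t⟩) => .app f t
    refine Finite.of_surjective g fun t => ?_
    cases t with
    | var v => exact ⟨.inl v, rfl⟩
    | cst c => exact ⟨.inr (.inl c), rfl⟩
    | app f t => exact ⟨.inr (.inr ⟨_, f, t⟩), rfl⟩

/-! ## Embeddings -/

theorem Term.eval_map {Sg : DBSignature} {V : Sg.Srt → Type} {M N : Str Sg} (i : Embedding M N)
    (ρ : ∀ s, V s → M.carrier s) {s : Sg.Srt} (t : Term Sg V s) :
    t.eval N (fun s v => i.map s (ρ s v)) = i.map s (t.eval M ρ) := by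
  induction t with
  | var v => rfl
  | cst c => exact (i.map_cst c).symm
  | app f t ih => simp only [Term.eval, ih, i.map_fn]

theorem Env.map_cons {ι : Type} {C D : ι → Type} (f : ∀ i, C i → D i) {Γ : List ι} {j : ι}
    (m : C j) (ρ : Env C Γ) :
    (fun i v => f i (Env.cons m ρ i v)) = Env.cons (f j m) fun i v => f i (ρ i v) := by
  funext i v
  cases v <;> rfl

theorem Env.eq_nil {ι : Type} {C : ι → Type} (ρ : Env C []) : ρ = Env.nil := by
  funext i v
  cases v

theorem Formula.IsQF.holds_map {Sg : DBSignature} {M N : Str Sg} (i : Embedding M N)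
    {Γ : List Sg.Srt} {φ : Formula Sg Γ} (hφ : φ.IsQF) (ρ : Env M.carrier Γ) :
    φ.Holds N (fun s v => i.map s (ρ s v)) ↔ φ.Holds M ρ := by
  induction φ with
  | top => rfl
  | eq t u => simp only [Formula.Holds, Term.eval_map, (i.inj _).eq_iff]
  | neg φ ih => simp only [Formula.Holds, ih hφ]
  | and φ ψ ih₁ ih₂ => simp only [Formula.Holds, ih₁ hφ.1, ih₂ hφ.2]
  | all s φ => exact hφ.elim

theorem Formula.IsUniversal.holds_of_embedding {Sg : DBSignature} {M N : Str Sg}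
    (i : Embedding M N) {Γ : List Sg.Srt} {φ : Formula Sg Γ} (hφ : φ.IsUniversal)
    (ρ : Env M.carrier Γ) (h : φ.Holds N (fun s v => i.map s (ρ s v))) : φ.Holds M ρ := by
  induction hφ with
  | qf hq => exact (hq.holds_map i ρ).mp h
  | all _ ih =>
    intro m
    refine ih _ ?_
    rw [Env.map_cons]
    exact h _

theorem DBSchema.models_of_embedding (D : DBSchema) {M N : Str D.sig} (i : Embedding M N)
    (hN : N.Models D.T) : M.Models D.T := fun φ hφ => by
  refine (D.universal φ hφ).holds_of_embedding i _ ?_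
  rw [Env.eq_nil fun s v => i.map s (Env.nil s v)]
  exact hN φ hφ

theorem Str.Models.mono {Sg : DBSignature} {M : Str Sg} {T T' : Theory Sg} (h : M.Models T')
    (hT : T ⊆ T') : M.Models T := fun φ hφ => h φ (hT hφ)

/-- Replace the base structure, keeping the artifact sorts. -/
abbrev ExtStr.withBase {S : Setting} (M : ExtStr S) (N : Str S.db.sig) : ExtStr S :=
  ⟨N, M.art, M.art_nonempty⟩

/-- The image of an assignment under an embedding of the base structure. -/
def Assignment.map {S : Setting} {M : ExtStr S} {N : Str S.db.sig} (i : Embedding M.base N)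
    (α : Assignment M) : Assignment (M.withBase N) where
  x v := i.map _ (α.x v)
  a c y := i.map _ (α.a c y)

theorem Assignment.ext' {S : Setting} {M : ExtStr S} {α β : Assignment M}
    (hx : ∀ (s : S.db.sig.Srt) (v : S.X s), α.x v = β.x v)
    (ha : ∀ (E : S.Art) (s : S.db.sig.Srt) (c : S.A E s) (y : M.art E), α.a c y = β.a c y) :
    α = β := by
  obtain ⟨x, a⟩ := α
  obtain ⟨x', a'⟩ := β
  congr
  · funext s v
    exact hx s v
  · funext E s c y
    exact ha E s c y

section Map

variable {S : Setting} {M : ExtStr S} {N : Str S.db.sig} (i : Embedding M.base N)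
  (α : Assignment M) {Γ : List S.Art} {Δ : List S.db.sig.Srt} (e : Env M.art Γ)
  (d : Env M.base.carrier Δ)

theorem STerm.eval_map {s : S.db.sig.Srt} (t : STerm S Γ Δ s) :
    STerm.eval (α.map i) e (fun s v => i.map s (d s v)) t = i.map s (STerm.eval α e d t) := by
  unfold STerm.eval
  rw [← Term.eval_map i]
  congr 1
  funext s l
  cases l <;> rfl

theorem QF.holds_map (φ : QF S Γ Δ) :
    φ.Holds (α.map i) e (fun s v => i.map s (d s v)) ↔ φ.Holds α e d := by
  induction φ with
  | top => rfl
  | eq t u => simp only [QF.Holds, STerm.eval_map, (i.inj _).eq_iff]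
  | eqArt => rfl
  | neg φ ih => simp only [QF.Holds, ih]
  | and φ ψ ih₁ ih₂ => simp only [QF.Holds, ih₁, ih₂]

theorem CaseFn.eval_map {s : S.db.sig.Srt} (F : CaseFn S Γ Δ s) :
    F.eval (α.map i) e (fun s v => i.map s (d s v)) = i.map s (F.eval α e d) := by
  induction F with
  | otherwise t => exact STerm.eval_map i α e d t
  | ifThen κ t F ih =>
    simp only [CaseFn.eval, ih, STerm.eval_map]
    by_cases h : κ.Holds α e d
    · rw [if_pos h, if_pos ((QF.holds_map i α e d κ).mpr h)]
    · rw [if_neg h, if_neg (mt (QF.holds_map i α e d κ).mp h)]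

theorem Block.holds_map (b : Block S) : b.Holds (α.map i) ↔ b.Holds α := by
  refine exists_congr fun e => ?_
  rw [← QF.holds_map i α e Env.nil, Env.eq_nil fun s v => i.map s (Env.nil s v)]

theorem StateFormula.holds_map (φ : StateFormula S) : φ.Holds (α.map i) ↔ φ.Holds α :=
  exists_congr fun b => and_congr_right fun _ => Block.holds_map i α b

end Map

/-- `β` results from `α` by the transition `τ` with witnesses `e`, `d`. -/
def TransFormula.HoldsWith {S : Setting} {M : ExtStr S} (τ : TransFormula S) (α β : Assignment M)
    (e : Env M.art τ.artCtx) (d : Env M.base.carrier τ.dataCtx) : Prop :=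
  τ.guard.Holds α e d ∧
    (∀ {s : S.db.sig.Srt} (x : S.X s), β.x x = (τ.updX x).eval α e d) ∧
    (∀ {E : S.Art} {s : S.db.sig.Srt} (a : S.A E s) (y : M.art E),
      β.a a y = (τ.updA a).eval α (Env.cons y e) d)

theorem TransFormula.holdsWith_map {S : Setting} {M : ExtStr S} {N : Str S.db.sig}
    (i : Embedding M.base N) (τ : TransFormula S) (α β : Assignment M)
    (e : Env M.art τ.artCtx) (d : Env M.base.carrier τ.dataCtx) :
    τ.HoldsWith (α.map i) (β.map i) e (fun s v => i.map s (d s v)) ↔ τ.HoldsWith α β e d := by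
  refine and_congr (QF.holds_map i α e d _) (and_congr ?_ ?_)
  · refine forall_congr' fun s => forall_congr' fun x => ?_
    rw [CaseFn.eval_map i α e d]
    exact (i.inj _).eq_iff
  · refine forall_congr' fun E => forall_congr' fun s => forall_congr' fun a =>
      forall_congr' fun y => ?_
    rw [CaseFn.eval_map i α (Env.cons y e) d]
    exact (i.inj _).eq_iff

theorem RAS.Trans.map {R : RAS} {M : ExtStr R.toSetting} {N : Str R.db.sig}
    (i : Embedding M.base N) {α β : Assignment M} (h : R.Trans α β) :
    R.Trans (α.map i) (β.map i) := by
  obtain ⟨τ, hτ, e, d, h⟩ := h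
  exact ⟨τ, hτ, e, _, (τ.holdsWith_map i α β e d).mpr h⟩

theorem RAS.init_map (R : RAS) {M : ExtStr R.toSetting} {N : Str R.db.sig}
    (i : Embedding M.base N) (α : Assignment M) : R.Init (α.map i) ↔ R.Init α := by
  refine and_congr ?_ ?_
  · refine forall_congr' fun s => forall_congr' fun x => ?_
    change i.map _ _ = N.cst _ ↔ _
    rw [← i.map_cst, (i.inj _).eq_iff]
  · refine forall_congr' fun E => forall_congr' fun s => forall_congr' fun a =>
      forall_congr' fun y => ?_
    change i.map _ _ = N.cst _ ↔ _
    rw [← i.map_cst, (i.inj _).eq_iff]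

/-! ## Preservation of local formulae under type-preserving injections -/

/-- Pairs of terms over the artifact variables and one individual variable of sort `E`. -/
abbrev Atom (S : Setting) (E : S.Art) : Type :=
  (s : S.db.sig.Srt) × (STerm S [E] [] s × STerm S [E] [] s)

theorem Var.finite {ι : Type} (Γ : List ι) (i : ι) : Finite (Var Γ i) := by
  induction Γ with
  | nil => exact @Finite.of_subsingleton _ ⟨fun v => nomatch v⟩
  | cons j Γ ih =>
    let g : PLift (j = i) ⊕ Var Γ i → Var (j :: Γ) i
      | .inl h => h.down ▸ .here
      | .inr v => .there v
    refine Finite.of_surjective g fun v => ?_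
    cases v with
    | here => exact ⟨.inl ⟨rfl⟩, rfl⟩
    | there v => exact ⟨.inr v, rfl⟩

theorem Leaf.finite (S : Setting) (Γ : List S.Art) (Δ : List S.db.sig.Srt) (s : S.db.sig.Srt) :
    Finite (Leaf S Γ Δ s) := by
  have := S.finite_art
  have := S.finite_x
  have := S.finite_a
  have := Var.finite Δ s
  have := fun E => Var.finite Γ E
  have hx : Finite (S.X s) :=
    Finite.of_injective (fun c => (⟨s, c⟩ : (s : S.db.sig.Srt) × S.X s))
      fun a b h => eq_of_heq (Sigma.mk.inj h).2
  have ha : ∀ E, Finite (S.A E s) := fun E =>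
    Finite.of_injective (fun f => (⟨E, s, f⟩ : (E : S.Art) × (s : S.db.sig.Srt) × S.A E s))
      fun a b h => by simpa using h
  let g : S.X s ⊕ Var Δ s ⊕ ((E : S.Art) × (S.A E s × Var Γ E)) → Leaf S Γ Δ s
    | .inl v => .artVar v
    | .inr (.inl c) => .data c
    | .inr (.inr ⟨_, f, t⟩) => .read f t
  refine Finite.of_surjective g fun t => ?_
  cases t with
  | artVar v => exact ⟨.inl v, rfl⟩
  | data c => exact ⟨.inr (.inl c), rfl⟩
  | read f t => exact ⟨.inr (.inr ⟨_, f, t⟩), rfl⟩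

theorem Atom.finite {S : Setting} (hac : S.db.sig.Acyclic) (E : S.Art) : Finite (Atom S E) := by
  have := S.db.sig.finite_srt
  have := fun s => Term.finite_of_acyclic hac (Leaf.finite S [E] []) s
  infer_instance

/-- The quantifier-free type over `x` of an element of artifact sort. -/
def Assignment.typeOf {S : Setting} {M : ExtStr S} (α : Assignment M) {E : S.Art} (m : M.art E) :
    Set (Atom S E) :=
  {p | STerm.eval α (Env.cons m Env.nil) Env.nil p.2.1 =
    STerm.eval α (Env.cons m Env.nil) Env.nil p.2.2}

theorem Term.AllVars.exists_eval_eq {S : Setting} {Γ : List S.Art} {E : S.Art} (i : Var Γ E)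
    {s : S.db.sig.Srt} (t : STerm S Γ [] s) (ht : t.AllVars (Leaf.OnlyMentions i)) :
    ∃ t' : STerm S [E] [] s, ∀ (M : ExtStr S) (α : Assignment M) (e : Env M.art Γ),
      t.eval α e Env.nil = t'.eval α (Env.cons (e E i) Env.nil) Env.nil := by
  induction t with
  | var l =>
    cases l with
    | artVar x => exact ⟨.var (.artVar x), fun _ _ _ => rfl⟩
    | data d => cases d
    | read a e =>
      cases (ht : (⟨_, e⟩ : (F : S.Art) × Var Γ F) = ⟨E, i⟩)
      exact ⟨.var (.read a .here), fun _ _ _ => rfl⟩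
  | cst c => exact ⟨.cst c, fun _ _ _ => rfl⟩
  | app f t ih =>
    obtain ⟨t', h⟩ := ih ht
    exact ⟨.app f t', fun M α e => congrArg (M.base.fn f) (h M α e)⟩

section Transfer

variable {S : Setting} {M M' : ExtStr S} {α : Assignment M} {α' : Assignment M'}

theorem QF.OnlyMentions.holds_iff {Γ : List S.Art} {E : S.Art} {i : Var Γ E} {φ : QF S Γ []}
    (hφ : φ.OnlyMentions i) {e : Env M.art Γ} {e' : Env M'.art Γ}
    (h : α.typeOf (e E i) = α'.typeOf (e' E i)) :
    φ.Holds α e Env.nil ↔ φ.Holds α' e' Env.nil := by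
  induction φ with
  | top => rfl
  | eq t u =>
    obtain ⟨t', ht⟩ := Term.AllVars.exists_eval_eq i t hφ.1
    obtain ⟨u', hu⟩ := Term.AllVars.exists_eval_eq i u hφ.2
    simp only [QF.Holds, ht, hu]
    exact Set.ext_iff.mp h ⟨_, t', u'⟩
  | eqArt j j' =>
    obtain ⟨h₁, h₂⟩ := hφ
    cases h₁
    cases h₂
    simp [QF.Holds]
  | neg φ ih => simp only [QF.Holds, ih hφ]
  | and φ ψ ih₁ ih₂ => simp only [QF.Holds, ih₁ hφ.1, ih₂ hφ.2]

theorem QF.IsDelta.holds_iff {Γ : List S.Art} {δ : QF S Γ []} (hδ : δ.IsDelta)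
    (j : ∀ E, M.art E → M'.art E) (hj : ∀ E, Function.Injective (j E)) (e : Env M.art Γ) :
    δ.Holds α e Env.nil ↔ δ.Holds α' (fun E v => j E (e E v)) Env.nil := by
  induction hδ with
  | top => rfl
  | eq => exact (hj _).eq_iff.symm
  | ne => exact not_congr (hj _).eq_iff.symm
  | and _ _ ih₁ ih₂ => exact and_congr ih₁ ih₂

theorem QF.holds_conj {Γ : List S.Art} {Δ : List S.db.sig.Srt} (l : List (QF S Γ Δ))
    (e : Env M.art Γ) (d : Env M.base.carrier Δ) :
    (QF.conj l).Holds α e d ↔ ∀ φ ∈ l, φ.Holds α e d := by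
  induction l with
  | nil => simp [QF.conj, QF.Holds]
  | cons φ l ih => simp [QF.conj, QF.Holds, ih]

theorem Block.IsLocal.holds_of_injective {b : Block S} (hb : b.IsLocal)
    (j : ∀ E, M.art E → M'.art E) (hj : ∀ E, Function.Injective (j E))
    (ht : ∀ E m, α.typeOf m = α'.typeOf (j E m)) (h : b.Holds α) : b.Holds α' := by
  obtain ⟨δ, φ, hδ, hφ, hbody⟩ := hb
  obtain ⟨e, he⟩ := h
  refine ⟨fun E v => j E (e E v), ?_⟩
  rw [hbody] at he ⊢
  refine ⟨(hδ.holds_iff j hj e).mp he.1, (QF.holds_conj _ _ _).mpr ?_⟩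
  have h₂ := (QF.holds_conj _ _ _).mp he.2
  intro ψ hψ
  obtain ⟨p, hp, rfl⟩ := List.mem_map.mp hψ
  exact ((hφ p.1 p.2).holds_iff (ht _ _)).mp (h₂ _ hψ)

end Transfer

/-- How many elements of artifact sort realize each type. -/
noncomputable def Assignment.count {S : Setting} {M : ExtStr S} (α : Assignment M)
    (θ : (E : S.Art) × Set (Atom S E)) : Cardinal.{0} :=
  Cardinal.mk {m : M.art θ.1 // α.typeOf m = θ.2}

theorem Assignment.exists_injective_of_count_le {S : Setting} {M M' : ExtStr S}
    {α : Assignment M} {α' : Assignment M'} (h : α.count ≤ α'.count) :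
    ∃ j : ∀ E, M.art E → M'.art E, (∀ E, Function.Injective (j E)) ∧
      ∀ E m, α.typeOf m = α'.typeOf (j E m) := by
  have h' : ∀ θ : (E : S.Art) × Set (Atom S E), Nonempty
      ({m : M.art θ.1 // α.typeOf m = θ.2} ↪ {m : M'.art θ.1 // α'.typeOf m = θ.2}) :=
    fun θ => h θ
  let f := fun θ => (h' θ).some
  have key : ∀ E m, α.typeOf m = α'.typeOf (f ⟨E, α.typeOf m⟩ ⟨m, rfl⟩).1 :=
    fun E m => (f ⟨E, α.typeOf m⟩ ⟨m, rfl⟩).2.symm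
  refine ⟨fun E m => (f ⟨E, α.typeOf m⟩ ⟨m, rfl⟩).1, fun E m m' hm => ?_, key⟩
  have ht : α.typeOf m = α.typeOf m' := by
    rw [key E m, key E m']
    exact congrArg _ hm
  have aux : ∀ θ (hθ : α.typeOf m = θ) (hθ' : α.typeOf m' = θ),
      (f ⟨E, θ⟩ ⟨m, hθ⟩).1 = (f ⟨E, θ⟩ ⟨m', hθ'⟩).1 → m = m' := fun θ hθ hθ' hh =>
    congrArg Subtype.val ((f ⟨E, θ⟩).injective (Subtype.ext hh))
  have aux' : ∀ θ (hθ : α.typeOf m = θ),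
      (f ⟨E, θ⟩ ⟨m, hθ⟩).1 = (f ⟨E, α.typeOf m⟩ ⟨m, rfl⟩).1 := by
    rintro _ rfl
    rfl
  exact aux _ ht rfl ((aux' _ ht).trans hm)

theorem StateFormula.IsLocal.holds_of_count_le {S : Setting} {M M' : ExtStr S}
    {α : Assignment M} {α' : Assignment M'} {φ : StateFormula S} (hφ : φ.IsLocal)
    (h : α.count ≤ α'.count) (hα : φ.Holds α) : φ.Holds α' := by
  obtain ⟨j, hj, ht⟩ := Assignment.exists_injective_of_count_le h
  obtain ⟨b, hb, hbα⟩ := hα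
  exact ⟨b, hb, (hφ b hb).holds_of_injective j hj ht hbα⟩

/-- Among the satisfying assignments of infinitely many local formulae, two are comparable. -/
theorem StateFormula.exists_lt_holds {S : Setting} (hac : S.db.sig.Acyclic)
    (ψ : ℕ → StateFormula S) (hψ : ∀ n, (ψ n).IsLocal) (M : ℕ → ExtStr S)
    (α : ∀ n, Assignment (M n)) (h : ∀ n, (ψ n).Holds (α n)) :
    ∃ m n, m < n ∧ (ψ m).Holds (α n) := by
  have := S.finite_art
  have := fun E => Atom.finite hac E
  obtain ⟨m, n, hmn, hle⟩ := wellQuasiOrdered_le fun n => (α n).count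
  exact ⟨m, n, hmn, (hψ m).holds_of_count_le hle (h m)⟩

/-! ## Termination -/

theorem StateFormula.holds_append {S : Setting} {M : ExtStr S} {φ ψ : StateFormula S}
    {α : Assignment M} : StateFormula.Holds (φ ++ ψ) α ↔ φ.Holds α ∨ ψ.Holds α := by
  simp only [StateFormula.Holds, List.mem_append, or_and_right, exists_or]

/-- The state formula is equivalent to a local one modulo `Tstar`. -/
def StateFormula.IsLocalMod {S : Setting} (Tstar : Theory S.db.sig) (φ : StateFormula S) : Prop :=
  ∃ ψ : StateFormula S, ψ.IsLocal ∧ ∀ M : ExtStr S, M.base.Models Tstar →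
    ∀ α : Assignment M, φ.Holds α ↔ ψ.Holds α

theorem exists_local_pre {S : Setting} {Tstar : Theory S.db.sig} (L : List (TransFormula S))
    (hL : ∀ τ ∈ L, τ.IsLocal Tstar) {φ : StateFormula S} (hφ : φ.IsLocal) :
    ∃ ψ : StateFormula S, ψ.IsLocal ∧ ∀ M : ExtStr S, M.base.Models Tstar →
      ∀ α : Assignment M, ψ.Holds α ↔ ∃ τ ∈ L, Pre τ.Holds φ α := by
  induction L with
  | nil => exact ⟨[], by simp [StateFormula.IsLocal], by simp [StateFormula.Holds]⟩
  | cons τ L ih =>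
    obtain ⟨ψ, hψ, h⟩ := ih fun τ hτ => hL τ (List.mem_cons_of_mem _ hτ)
    obtain ⟨ψ', hψ', h'⟩ := hL τ List.mem_cons_self φ hφ
    refine ⟨ψ' ++ ψ, fun b hb => (List.mem_append.mp hb).elim (hψ' b) (hψ b), fun M hM α => ?_⟩
    simp only [StateFormula.holds_append, h M hM, ← h' M hM, List.mem_cons, or_and_right,
      exists_or, exists_eq_left]

section Procedure

variable {R : RAS} {Tstar : Theory R.db.sig}

theorem RAS.exists_local_isQEPre (hlocal : ∀ τ ∈ R.trans, τ.IsLocal Tstar)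
    {φ : StateFormula R.toSetting} (hφ : φ.IsLocalMod Tstar) :
    ∃ ψ : StateFormula R.toSetting, ψ.IsLocal ∧ R.IsQEPre Tstar φ ψ := by
  obtain ⟨φ₀, hφ₀, heq⟩ := hφ
  obtain ⟨ψ, hψ, h⟩ := exists_local_pre R.trans hlocal hφ₀
  refine ⟨ψ, hψ, fun M hM α => (h M hM α).trans ?_⟩
  constructor
  · rintro ⟨τ, hτ, β, hβ, hφβ⟩
    exact ⟨β, ⟨τ, hτ, hβ⟩, (heq M hM β).mpr hφβ⟩
  · rintro ⟨β, ⟨τ, hτ, hβ⟩, hφβ⟩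
    exact ⟨τ, hτ, β, hβ, (heq M hM β).mp hφβ⟩

theorem RAS.IsQEPre.isLocalMod (hlocal : ∀ τ ∈ R.trans, τ.IsLocal Tstar)
    {φ φ' : StateFormula R.toSetting} (h : R.IsQEPre Tstar φ φ') (hφ : φ.IsLocalMod Tstar) :
    φ'.IsLocalMod Tstar := by
  obtain ⟨ψ, hψ, h'⟩ := R.exists_local_isQEPre hlocal hφ
  exact ⟨ψ, hψ, fun M hM α => (h M hM α).trans (h' M hM α).symm⟩

theorem RAS.isLocalMod_of_reach (hlocal : ∀ τ ∈ R.trans, τ.IsLocal Tstar)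
    {υ : StateFormula R.toSetting} (hυ : υ.IsLocal) {c : BRState R}
    (h : R.BRReach Tstar υ c) : ∀ φ B, c = .loop φ B → φ.IsLocalMod Tstar := by
  induction h with
  | refl =>
    rintro φ B ⟨⟩
    exact ⟨υ, hυ, fun _ _ _ => Iff.rfl⟩
  | tail _ hstep ih =>
    rintro φ B rfl
    cases hstep with
    | iterate _ _ hφ' => exact hφ'.isLocalMod hlocal (ih _ _ rfl)

/-- Satisfiability of `φ ∧ ¬B` in a model of `T` carries over to a model of `Tstar`. -/
theorem RAS.SatDiff.exists_models (hT : IsModelCompletion R.db.T Tstar)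
    {φ B : StateFormula R.toSetting} (h : R.SatDiff φ B) :
    ∃ M : ExtStr R.toSetting, M.base.Models Tstar ∧
      ∃ α : Assignment M, φ.Holds α ∧ ¬ B.Holds α := by
  obtain ⟨M, hM, α, hφ, hB⟩ := h
  obtain ⟨N, hN, ⟨i⟩⟩ := hT.embeds M.base hM
  exact ⟨M.withBase N, hN, α.map i, (φ.holds_map i α).mpr hφ, mt (B.holds_map i α).mp hB⟩

theorem RAS.brTerminates (hT : IsModelCompletion R.db.T Tstar) (hac : R.db.sig.Acyclic)
    (hlocal : ∀ τ ∈ R.trans, τ.IsLocal Tstar) {υ : StateFormula R.toSetting} (hυ : υ.IsLocal) :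
    R.BRTerminates Tstar υ := by
  refine ⟨?_, fun φ B hreach => ?_⟩
  · rintro ⟨c, h0, hstep⟩
    have hreach : ∀ n, R.BRReach Tstar υ (c n) := fun n => by
      induction n with
      | zero => rw [h0]; exact .refl
      | succ n ih => exact ih.tail (hstep n)
    have hloop : ∀ n, ∃ φ B, c n = .loop φ B := fun n => by
      have h := hstep n
      generalize c n = c₁ at h
      generalize c (n + 1) = c₂ at h
      cases h <;> exact ⟨_, _, rfl⟩
    choose φ B hc using hloop
    have hit : ∀ n, R.SatDiff (φ n) (B n) ∧ B (n + 1) = φ n ++ B n := fun n => by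
      have h := hstep n
      rw [hc n, hc (n + 1)] at h
      generalize hB : B (n + 1) = B' at h ⊢
      cases h with
      | iterate h _ _ => exact ⟨h, rfl⟩
    have hmono : ∀ m n, m < n → ∀ b ∈ φ m, b ∈ B n := fun m n hmn => by
      induction n, hmn using Nat.le_induction with
      | base => intro b hb; rw [(hit m).2]; exact List.mem_append_left _ hb
      | succ n _ ih => intro b hb; rw [(hit n).2]; exact List.mem_append_right _ (ih b hb)
    choose ψ hψ heq using fun n => R.isLocalMod_of_reach hlocal hυ (hreach n) _ _ (hc n)
    choose M hM α hα hα' using fun n => (hit n).1.exists_models hT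
    obtain ⟨m, n, hmn, h⟩ := StateFormula.exists_lt_holds hac ψ hψ M α
      fun n => (heq n _ (hM n) _).mp (hα n)
    obtain ⟨b, hb, hbα⟩ := (heq m _ (hM n) _).mpr h
    exact hα' n ⟨b, hmono m n hmn b hb, hbα⟩
  · by_cases h : R.SatDiff φ B
    · by_cases hι : R.SatInit φ
      · exact ⟨_, .found h hι⟩
      · obtain ⟨φ', _, hφ'⟩ :=
          R.exists_local_isQEPre hlocal (R.isLocalMod_of_reach hlocal hυ hreach _ _ rfl)
        exact ⟨_, .iterate h hι hφ'⟩
    · exact ⟨_, .fixpoint h⟩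

/-! ## Correctness of the positive answer -/

/-- The loop invariant behind the positive answer. -/
structure RAS.LoopInvariant (R : RAS) (Tstar : Theory R.db.sig)
    (υ φ B : StateFormula R.toSetting) : Prop where
  target : ∀ M : ExtStr R.toSetting, M.base.Models Tstar → ∀ α : Assignment M,
    υ.Holds α → φ.Holds α ∨ B.Holds α
  pre : ∀ M : ExtStr R.toSetting, M.base.Models Tstar → ∀ α : Assignment M,
    Pre R.Trans B α → φ.Holds α ∨ B.Holds α
  not_satInit : ¬ R.SatInit B

theorem RAS.loopInvariant_of_reach {υ : StateFormula R.toSetting} {c : BRState R}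
    (h : R.BRReach Tstar υ c) : ∀ φ B, c = .loop φ B → R.LoopInvariant Tstar υ φ B := by
  induction h with
  | refl =>
    rintro φ B ⟨⟩
    refine ⟨fun _ _ _ h => .inl h, ?_, ?_⟩
    · rintro _ _ _ ⟨_, _, b, hb, _⟩
      cases hb
    · rintro ⟨_, _, _, _, b, hb, _⟩
      cases hb
  | tail _ hstep ih =>
    rintro φ B rfl
    cases hstep with
    | @iterate φ B φ' _ hι hφ' =>
      have hinv := ih _ _ rfl
      refine ⟨fun M hM α hα => ?_, ?_, ?_⟩
      · exact .inr (StateFormula.holds_append.mpr (hinv.target M hM α hα))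
      · rintro M hM α ⟨β, hβ, hφβ⟩
        rcases StateFormula.holds_append.mp hφβ with h | h
        · exact .inl ((hφ' M hM α).mpr ⟨β, hβ, h⟩)
        · exact .inr (StateFormula.holds_append.mpr (hinv.pre M hM α ⟨β, hβ, h⟩))
      · rintro ⟨M, hM, α, hα, h⟩
        rcases StateFormula.holds_append.mp h with h | h
        · exact hι ⟨M, hM, α, hα, h⟩
        · exact hinv.not_satInit ⟨M, hM, α, hα, h⟩

theorem RAS.safe_of_reach (hT : IsModelCompletion R.db.T Tstar) {υ B : StateFormula R.toSetting}
    (h : R.BRReach Tstar υ (.returnSafe B)) : R.Safe υ := by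
  rcases Relation.ReflTransGen.cases_tail h with h | ⟨c, hc, hstep⟩
  · cases h
  cases hstep with
  | @fixpoint φ _ hfix =>
    have hinv := R.loopInvariant_of_reach hc _ _ rfl
    rintro ⟨M, hM, k, α, hinit, hrun, hυ⟩
    obtain ⟨N, hN, ⟨i⟩⟩ := hT.embeds M.base hM.1
    have hNT : N.Models R.db.T := hN.mono hT.extends_theory
    have hB : ∀ β : Assignment (M.withBase N), φ.Holds β ∨ B.Holds β → B.Holds β := by
      rintro β (h | h)
      · by_contra hb
        exact hfix ⟨_, hNT, β, h, hb⟩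
      · exact h
    have hback : ∀ j ≤ k, B.Holds ((α (k - j)).map i) := fun j => by
      induction j with
      | zero => exact fun _ => hB _ (hinv.target _ hN _ ((υ.holds_map i _).mpr hυ))
      | succ j ih =>
        intro hj
        refine hB _ (hinv.pre _ hN _ ⟨_, ?_, ih (by omega)⟩)
        have := (hrun (k - (j + 1)) (by omega)).map i
        rwa [show k - (j + 1) + 1 = k - j by omega] at this
    have h0 := hback k le_rfl
    rw [Nat.sub_self] at h0
    exact hinv.not_satInit ⟨_, hNT, _, (R.init_map i _).mpr hinit, h0⟩

/-! ## Correctness of the negative answer -/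

theorem RAS.exists_run_of_reach {υ : StateFormula R.toSetting} {c : BRState R}
    (h : R.BRReach Tstar υ c) : ∀ φ B, c = .loop φ B → ∀ M : ExtStr R.toSetting,
      M.base.Models Tstar → ∀ α : Assignment M, φ.Holds α →
      ∃ (k : ℕ) (β : ℕ → Assignment M), β 0 = α ∧ (∀ i < k, R.Trans (β i) (β (i + 1))) ∧
        υ.Holds (β k) := by
  induction h with
  | refl =>
    rintro φ B ⟨⟩ M _ α hα
    exact ⟨0, fun _ => α, rfl, by simp, hα⟩
  | tail _ hstep ih =>
    rintro φ B rfl M hM α hα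
    cases hstep with
    | iterate _ _ hφ' =>
      obtain ⟨α', hstep, hα'⟩ := (hφ' M hM α).mp hα
      obtain ⟨k, β, h0, hrun, hυ⟩ := ih _ _ rfl M hM α' hα'
      refine ⟨k + 1, fun | 0 => α | n + 1 => β n, rfl, fun i hi => ?_, hυ⟩
      cases i with
      | zero => simpa only [h0] using hstep
      | succ i => exact hrun i (by omega)

end Procedure

/-- The substructure generated by a family of sets. -/
def Str.generated {Sg : DBSignature} (N : Str Sg) (G : ∀ s, Set (N.carrier s))
    (hG : ∀ s, (G s).Nonempty) : Str Sg where
  carrier s := Set.range (Term.eval N (V := fun s => G s) (fun _ v => v.1) (s := s))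
  nonempty s := ⟨⟨_, .var ⟨_, (hG s).some_mem⟩, rfl⟩⟩
  fn f m := ⟨N.fn f m.1, m.2.elim fun t ht => ⟨.app f t, congrArg (N.fn f) ht⟩⟩
  cst c := ⟨N.cst c, .cst c, rfl⟩

/-- The inclusion of a generated substructure. -/
def Str.generatedEmbedding {Sg : DBSignature} (N : Str Sg) (G : ∀ s, Set (N.carrier s))
    (hG : ∀ s, (G s).Nonempty) : Embedding (N.generated G hG) N where
  map _ m := m.1
  inj _ := Subtype.val_injective
  map_fn _ _ := rfl
  map_cst _ := rfl

theorem Str.finite_generated {Sg : DBSignature} (hac : Sg.Acyclic) (N : Str Sg)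
    (G : ∀ s, Set (N.carrier s)) (hG : ∀ s, (G s).Nonempty) (hfin : ∀ s, (G s).Finite)
    (s : Sg.Srt) : Finite ((N.generated G hG).carrier s) := by
  have := Term.finite_of_acyclic hac (V := fun s => G s) (fun s => (hfin s).to_subtype) s
  exact Finite.of_surjective _ Set.rangeFactorization_surjective

/-- A successor of an assignment in a substructure lies in the substructure if the data witnesses
do. -/
theorem TransFormula.HoldsWith.exists_map_eq {S : Setting} {M : ExtStr S} {N : Str S.db.sig}
    (i : Embedding M.base N) {τ : TransFormula S} {α : Assignment M}
    {β : Assignment (M.withBase N)} {e : Env M.art τ.artCtx} {d : Env M.base.carrier τ.dataCtx}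
    (h : τ.HoldsWith (α.map i) β e (fun s v => i.map s (d s v))) :
    ∃ β' : Assignment M, β'.map i = β := by
  refine ⟨⟨fun x => (τ.updX x).eval α e d, fun a y => (τ.updA a).eval α (Env.cons y e) d⟩,
    Assignment.ext' (fun s x => ?_) fun E s a y => ?_⟩
  · rw [h.2.1 x, CaseFn.eval_map i α e d]
    rfl
  · rw [h.2.2 a y]
    exact (CaseFn.eval_map i α (Env.cons y e) d _).symm

theorem RAS.exists_instance_run (R : RAS) (hac : R.db.sig.Acyclic) {N : ExtStr R.toSetting}
    (hN : N.base.Models R.db.T) {k : ℕ} {α : ℕ → Assignment N} (hinit : R.Init (α 0))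
    (hrun : ∀ i < k, R.Trans (α i) (α (i + 1))) {υ : StateFormula R.toSetting}
    (hυ : υ.Holds (α k)) : ¬ R.Safe υ := by
  have hw : ∀ j : Fin k, ∃ τ ∈ R.trans, ∃ (e : Env N.art τ.artCtx)
      (d : Env N.base.carrier τ.dataCtx), τ.HoldsWith (α j) (α (j + 1)) e d :=
    fun j => hrun j j.2
  choose τ hτ e d hed using hw
  let p : ∀ s, N.base.carrier s := fun s => (N.base.nonempty s).some
  let G : ∀ s, Set (N.base.carrier s) := fun s =>
    insert (p s) (⋃ j : Fin k, Set.range (d j s))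
  have hG : ∀ s, (G s).Nonempty := fun s => ⟨p s, Set.mem_insert _ _⟩
  have hfin : ∀ s, (G s).Finite := fun s =>
    (Set.finite_iUnion fun j =>
      have := Var.finite (τ j).dataCtx s
      Set.finite_range _).insert _
  let K := N.withBase (N.base.generated G hG)
  let i : Embedding K.base N.base := N.base.generatedEmbedding G hG
  let d' : ∀ j : Fin k, Env K.base.carrier (τ j).dataCtx := fun j s v =>
    ⟨d j s v, .var ⟨d j s v, .inr (Set.mem_iUnion.mpr ⟨j, v, rfl⟩)⟩, rfl⟩
  have hlift : ∀ n ≤ k, ∃ β : Assignment K, β.map i = α n := fun n => by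
    induction n with
    | zero =>
      refine fun _ => ⟨⟨fun x => K.base.cst (R.initX x), fun a _ => K.base.cst (R.initA a)⟩,
        Assignment.ext' (fun s x => (hinit.1 x).symm) fun E s a y => (hinit.2 a y).symm⟩
    | succ n ih =>
      intro hn
      obtain ⟨β, hβ⟩ := ih (by omega)
      have h := hed ⟨n, hn⟩
      simp only [← hβ] at h
      exact TransFormula.HoldsWith.exists_map_eq i (d := d' ⟨n, hn⟩) h
  have hlift' : ∀ n, ∃ β : Assignment K, n ≤ k → β.map i = α n := fun n => by
    by_cases hn : n ≤ k
    · exact (hlift n hn).imp fun _ h _ => h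
    · exact (hlift 0 (Nat.zero_le k)).imp fun _ _ h => absurd h hn
  choose β hβ using hlift'
  refine fun hsafe => hsafe ⟨K, ⟨R.db.models_of_embedding i hN,
    fun s _ => N.base.finite_generated hac G hG hfin s⟩, k, β, ?_, fun j hj => ?_, ?_⟩
  · rw [← R.init_map i, hβ 0 (Nat.zero_le k)]
    exact hinit
  · refine ⟨τ ⟨j, hj⟩, hτ _, e ⟨j, hj⟩, d' ⟨j, hj⟩, ?_⟩
    refine ((τ ⟨j, hj⟩).holdsWith_map i (β j) (β (j + 1)) (e ⟨j, hj⟩) (d' ⟨j, hj⟩)).mp ?_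
    rw [hβ j hj.le, hβ (j + 1) hj]
    exact hed ⟨j, hj⟩
  · rw [← υ.holds_map i, hβ k le_rfl]
    exact hυ

theorem RAS.not_safe_of_reach {R : RAS} {Tstar : Theory R.db.sig}
    (hT : IsModelCompletion R.db.T Tstar) (hac : R.db.sig.Acyclic)
    {υ : StateFormula R.toSetting} (h : R.BRReach Tstar υ .returnUnsafe) : ¬ R.Safe υ := by
  rcases Relation.ReflTransGen.cases_tail h with h | ⟨c, hc, hstep⟩
  · cases h
  cases hstep with
  | found _ hι =>
    obtain ⟨M, hM, α, hinit, hα⟩ := hι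
    obtain ⟨N, hN, ⟨i⟩⟩ := hT.embeds M.base hM
    obtain ⟨k, β, h0, hrun, hυ⟩ := R.exists_run_of_reach hc _ _ rfl (M.withBase N) hN (α.map i)
      ((StateFormula.holds_map i α _).mpr hα)
    refine R.exists_instance_run hac (hN.mono hT.extends_theory) ?_ hrun hυ
    rw [h0]
    exact (R.init_map i α).mpr hinit

end RelationalArtifact

theorem backward_reachability_terminates_local
    (R : RelationalArtifact.RAS)
    (Tstar : RelationalArtifact.Theory R.db.sig)
    (hfmp : R.db.FiniteModelProperty)
    (hTstar : RelationalArtifact.IsModelCompletion R.db.T Tstar)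
    (hacyclic : R.db.sig.Acyclic)
    (hlocal : ∀ τ ∈ R.trans, τ.IsLocal Tstar)
    (υ : RelationalArtifact.StateFormula R.toSetting)
    (hυ : υ.IsLocal) :
    R.BRTerminates Tstar υ ∧ R.BRCorrect Tstar υ := by
  exact ⟨RelationalArtifact.RAS.brTerminates hTstar hacyclic hlocal hυ,
    RelationalArtifact.RAS.not_safe_of_reach hTstar hacyclic,
    fun _ => RelationalArtifact.RAS.safe_of_reach hTstar⟩
end

section
/- Let $\Sigma$ be a finite many-sorted signature whose only symbols are equality, unary functions and constants, with a distinguished constant $\mathtt{undef}_S$ in every sort $S$. Let $T$ be a set of universal $\Sigma$-sentences that admits a model completion $T^*$, i.e. a $\Sigma$-theory $T^*$ that is stronger than $T$, in which every quantifier-free formula satisfiable in a model of $T$ is still satisfiable in some model, and that has quantifier elimination. Extend $\Sigma$ by new sorts, called artifact sorts (the sorts of $\Sigma$ are called basic), and fix an artifact setting $(\underline x,\underline a)$: a finite set $\underline x$ of individual variables of basic sorts (artifact variables) and a finite set $\underline a$ of unary function variables, each with an artifact sort as source and a basic sort as target (artifact components; we write $a[e]$ for application). A formula over $(\underline x,\underline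 a)$ is *strongly local* if it is a finite disjunction of formulae $$\exists e_1\cdots\exists e_k\Bigl(\delta(e_1,\dots,e_k)\wedge\psi(\underline x)\wedge\bigwedge_{l=1}^k\phi_l(e_l,\underline a)\Bigr),$$ where the $e_l$ are variables of artifact sorts, $\delta$ is a conjunction of equalities and inequalities among the $e_l$, and $\psi$ and the $\phi_l$ are quantifier-free, $\phi_l$ having $e_l$ as its only individual variable. The preimage of $\varphi(\underline x,\underline a)$ along $\hat\tau(\underline x,\underline a,\underline x',\underline a')$ is $\mathit{Pre}(\hat\tau,\varphi):=\exists\underline x'\,\exists\underline a'\,(\hat\tau(\underline x,\underline a,\underline x',\underline a')\wedge\varphi(\underline x',\underline a'))$. The formula $\hat\tau$ is *strongly local* if for every strongly local $\varphi$ there is a strongly local $\chi$ that is equivalent to $\mathit{Pre}(\hat\tau,\varphi)$ modulo $T^*$, i.e. under every assignment to $(\underline x,\underline a)$ in every structure for the extended sorts whose reduct to $\Sigma$ is a model of $T^*$. Let $P\neq R$ be artifact sorts. Let $\underline r=(r_1,\dots,r_m)$ be the components with source $R$ (the updated repository relation), $\underline s$ those with source different from $P$ and $R$ (the other repository relations),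 and let the components with source $P$ (the case variables) be divided into $\underline x_1=(x_{1,1},\dots,x_{1,m})$, pairwise distinct, where $x_{1,j}$ has the same target sort as $r_j$, and the remaining ones $\underline x_2$. Let $\pi(\underline x_1,\underline x_2)$ and $\psi(\underline y_1,\underline y_2)$ be quantifier-free $\Sigma$-formulae, in variables of the sorts of the components $\underline x_1,\underline x_2$. Then the delete&set transition $$\exists \underline y_1\,\exists \underline y_2\,\exists i\,\exists e\,\Bigl(\pi(\underline x_1[i],\underline x_2[i])\wedge \underline r[e]=\underline y_1\wedge\psi(\underline y_1,\underline y_2)\wedge\bigwedge_{j} r_j[e]\neq\mathtt{undef}\wedge \underline x_1'[i]:=\underline r[e]\wedge \underline x_2'[i]:=\underline y_2\wedge \underline s':=\underline s\wedge \underline r':=\lambda j.(\text{if } j=e\text{ then }\mathtt{undef}\text{ else }\underline r[j])\Bigr),$$ with $i$ of sort $P$ and $e$ of sort $R$, is strongly local: the preimage along it of any strongly local formula is equivalent modulo $T^*$ to a strongly local formula. Here $a'[i]:=u$ means $a'=\lambda j.(\text{if } j=i\text{ then }u\text{ else }a[j])$, and the artifact variables $\underline x$ are left unchanged ($\underline x':=\underline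 x$). -/
universe u

/-! ## Many-sorted first-order logic with unary functions and constants -/

/-- A many-sorted signature whose only symbols are equality, unary function symbols (sorted by
source and target) and constants (sorted by their sort). -/
structure Signature where
  Srt : Type
  Fn : Srt → Srt → Type
  Cst : Srt → Type

/-- Terms whose individual variables come from `V`, the variable `v` having sort `vs v`. -/
inductive Term (L : Signature) {V : Type} (vs : V → L.Srt) : L.Srt → Type
  | var (v : V) : Term L vs (vs v)
  | cst {s : L.Srt} (c : L.Cst s) : Term L vs s
  | app {s t : L.Srt} (f : L.Fn s t) (a : Term L vs s) : Term L vs t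

/-- First-order formulae with free variables in `V`. The quantifier `ex B bs φ` binds a finite
tuple of variables at once: one variable of sort `bs b` for each `b` in the finite type `B`. -/
inductive Formula (L : Signature) : {V : Type} → (V → L.Srt) → Type 1
  | falsum {V : Type} {vs : V → L.Srt} : Formula L vs
  | eq {V : Type} {vs : V → L.Srt} {s : L.Srt} (a b : Term L vs s) : Formula L vs
  | not {V : Type} {vs : V → L.Srt} (φ : Formula L vs) : Formula L vs
  | and {V : Type} {vs : V → L.Srt} (φ χ : Formula L vs) : Formula L vs
  | ex {V : Type} {vs : V → L.Srt} (B : Type) [Finite B] (bs : B → L.Srt)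
      (φ : Formula L (Sum.elim vs bs)) : Formula L vs

namespace Formula

variable {L : Signature} {V : Type} {vs : V → L.Srt}

def or (φ χ : Formula L vs) : Formula L vs := .not (.and (.not φ) (.not χ))

def all (B : Type) [Finite B] (bs : B → L.Srt) (φ : Formula L (Sum.elim vs bs)) :
    Formula L vs := .not (.ex B bs (.not φ))

def conj (l : List (Formula L vs)) : Formula L vs := l.foldr .and (.not .falsum)

def disj (l : List (Formula L vs)) : Formula L vs := l.foldr .or .falsum

/-- The conjunction of a family of formulae indexed by a finite type. -/
noncomputable def iConj {ι : Type} [Finite ι] (f : ι → Formula L vs) : Formula L vs :=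
  conj ((@Finset.univ ι (Fintype.ofFinite ι)).toList.map f)

/-- Quantifier-free formulae. -/
inductive IsQF : {V : Type} → {vs : V → L.Srt} → Formula L vs → Prop
  | falsum {V : Type} {vs : V → L.Srt} : IsQF (.falsum : Formula L vs)
  | eq {V : Type} {vs : V → L.Srt} {s : L.Srt} (a b : Term L vs s) : IsQF (.eq a b)
  | not {V : Type} {vs : V → L.Srt} {φ : Formula L vs} : IsQF φ → IsQF (.not φ)
  | and {V : Type} {vs : V → L.Srt} {φ χ : Formula L vs} : IsQF φ → IsQF χ → IsQF (.and φ χ)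

/-- Universal formulae `∀ x, φ(x)` with `φ` quantifier-free. -/
def IsUniversal (φ : Formula L vs) : Prop :=
  ∃ (B : Type) (_ : Finite B) (bs : B → L.Srt) (χ : Formula L (Sum.elim vs bs)),
    χ.IsQF ∧ φ = .all B bs χ

end Formula

/-- Structures: a carrier for each sort, interpretations of functions and constants. -/
structure Str (L : Signature) where
  carrier : L.Srt → Type u
  fn : {s t : L.Srt} → L.Fn s t → carrier s → carrier t
  cst : {s : L.Srt} → L.Cst s → carrier s

def Term.eval {L : Signature} (M : Str.{u} L) {V : Type} {vs : V → L.Srt}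
    (v : ∀ x, M.carrier (vs x)) : {s : L.Srt} → Term L vs s → M.carrier s
  | _, .var x => v x
  | _, .cst c => M.cst c
  | _, .app f a => M.fn f (a.eval M v)

/-- Extend an assignment to the free variables by values for a tuple of bound variables. -/
def extend {L : Signature} {M : Str.{u} L} {V B : Type} {vs : V → L.Srt} {bs : B → L.Srt}
    (v : ∀ x, M.carrier (vs x)) (w : ∀ b, M.carrier (bs b)) :
    ∀ z : V ⊕ B, M.carrier (Sum.elim vs bs z)
  | .inl x => v x
  | .inr b => w b

/-- Truth of a formula in a structure under an assignment. -/
def Formula.Realize {L : Signature} (M : Str.{u} L) : {V : Type} → {vs : V → L.Srt} →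
    Formula L vs → (∀ x, M.carrier (vs x)) → Prop
  | _, _, .falsum, _ => False
  | _, _, .eq a b, v => a.eval M v = b.eval M v
  | _, _, .not φ, v => ¬ φ.Realize M v
  | _, _, .and φ χ, v => φ.Realize M v ∧ χ.Realize M v
  | _, _, @Formula.ex _ _ _ _ _ bs φ, v => ∃ w : ∀ b, M.carrier (bs b), φ.Realize M (extend v w)

/-- Sentences: formulae without free variables. -/
abbrev Sentence (L : Signature) := Formula L (V := Empty) (fun x => x.elim)

abbrev Theory (L : Signature) := Set (Sentence L)

def Str.IsModel {L : Signature} (M : Str.{u} L) (T : Theory L) : Prop :=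
  ∀ φ ∈ T, φ.Realize M (fun x => x.elim)

/-- `Tstar` is a model completion of the universal theory `T`: it is stronger than `T`, every
constraint (quantifier-free formula) satisfiable in a model of `T` is satisfiable in a model of
`Tstar`, and `Tstar` has quantifier elimination. -/
structure IsModelCompletion {L : Signature} (T Tstar : Theory L) : Prop where
  stronger : ∀ M : Str.{u} L, M.IsModel Tstar → M.IsModel T
  conservative : ∀ (V : Type) [Finite V] (vs : V → L.Srt) (φ : Formula L vs), φ.IsQF →
    (∃ M : Str.{u} L, M.IsModel T ∧ ∃ v, φ.Realize M v) →
    ∃ M : Str.{u} L, M.IsModel Tstar ∧ ∃ v, φ.Realize M v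
  quantifierElimination : ∀ (V : Type) [Finite V] (vs : V → L.Srt) (φ : Formula L vs),
    ∃ χ : Formula L vs, χ.IsQF ∧
      ∀ M : Str.{u} L, M.IsModel Tstar → ∀ v, (φ.Realize M v ↔ χ.Realize M v)

/-! ## Translating formulae along signature morphisms, with substitution -/

structure SigHom (L L' : Signature) where
  srt : L.Srt → L'.Srt
  fn : {s t : L.Srt} → L.Fn s t → L'.Fn (srt s) (srt t)
  cst : {s : L.Srt} → L.Cst s → L'.Cst (srt s)

abbrev SigHom.id (L : Signature) : SigHom L L where
  srt s := s
  fn f := f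
  cst c := c

/-- Translate the symbols along `F` and substitute the term `σ v` for each variable `v`. -/
def Term.map {L L' : Signature} (F : SigHom L L') {V W : Type} {vs : V → L.Srt}
    {ws : W → L'.Srt} (σ : ∀ v, Term L' ws (F.srt (vs v))) :
    {s : L.Srt} → Term L vs s → Term L' ws (F.srt s)
  | _, .var v => σ v
  | _, .cst c => .cst (F.cst c)
  | _, .app f a => .app (F.fn f) (a.map F σ)

/-- The substitution `σ` under a quantifier: bound variables are kept. -/
def liftSubst {L L' : Signature} (F : SigHom L L') {V W B : Type} {vs : V → L.Srt}
    {ws : W → L'.Srt} (bs : B → L.Srt) (σ : ∀ v, Term L' ws (F.srt (vs v))) :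
    ∀ z : V ⊕ B, Term L' (Sum.elim ws (fun b => F.srt (bs b))) (F.srt (Sum.elim vs bs z))
  | .inl v => (σ v).map (SigHom.id L') (fun w => Term.var (vs := Sum.elim ws _) (Sum.inl w))
  | .inr b => Term.var (vs := Sum.elim ws (fun b => F.srt (bs b))) (Sum.inr b)

def Formula.map {L L' : Signature} (F : SigHom L L') : {V W : Type} → {vs : V → L.Srt} →
    {ws : W → L'.Srt} → (σ : ∀ v, Term L' ws (F.srt (vs v))) → Formula L vs → Formula L' ws
  | _, _, _, _, _, .falsum => .falsum
  | _, _, _, _, σ, .eq a b => .eq (a.map F σ) (b.map F σ)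
  | _, _, _, _, σ, .not φ => .not (φ.map F σ)
  | _, _, _, _, σ, .and φ χ => .and (φ.map F σ) (χ.map F σ)
  | _, _, _, _, σ, @Formula.ex _ _ _ B _ bs φ =>
      .ex B (fun b => F.srt (bs b)) (φ.map F (liftSubst F bs σ))

/-! ## DB schemas and artifact settings -/

/-- A DB signature: a finite signature with a distinguished constant `undef` in every sort. -/
structure DBSignature extends Signature where
  finite_srt : Finite Srt
  finite_fn : Finite (Σ s t, Fn s t)
  finite_cst : Finite (Σ s, Cst s)
  undef : (s : Srt) → Cst s

/-- A DB schema: a DB signature and a set of universal sentences. -/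
structure DBSchema where
  sig : DBSignature
  theory : Theory sig.toSignature
  universal : ∀ φ ∈ theory, φ.IsUniversal

/-- An artifact extension (extra sorts `Art`) with an artifact setting over it: a finite set `Var`
of artifact variables of basic sorts and a finite set of artifact components, `Comp E S` being
those with source the artifact sort `E` and target the basic sort `S`. -/
structure ArtifactSetting (L : Signature) where
  Art : Type
  Var : Type
  varSort : Var → L.Srt
  Comp : Art → L.Srt → Type
  finite_var : Finite Var
  finite_comp : Finite (Σ E S, Comp E S)

/-- Function symbols between the sorts of an artifact extension. -/
def extFn (L : Signature) (Art : Type) (Comp : Art → L.Srt → Type) :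
    L.Srt ⊕ Art → L.Srt ⊕ Art → Type
  | .inl s, .inl t => L.Fn s t
  | .inr E, .inl t => Comp E t
  | .inl _, .inr _ => Empty
  | .inr _, .inr _ => Empty

/-- The signature `L` with the extra sorts `Art` and with the function variables `Comp`. -/
abbrev extSig (L : Signature) (Art : Type) (Comp : Art → L.Srt → Type) : Signature where
  Srt := L.Srt ⊕ Art
  Fn := extFn L Art Comp
  Cst := Sum.elim L.Cst (fun _ => Empty)

/-- The inclusion of the basic signature. -/
abbrev extIncl (L : Signature) (Art : Type) (Comp : Art → L.Srt → Type) :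
    SigHom L (extSig L Art Comp) where
  srt := Sum.inl
  fn f := f
  cst c := c

/-- The read `a[t]` of an artifact component. -/
def Term.read {L : Signature} {Art : Type} {Comp : Art → L.Srt → Type} {V : Type}
    {vs : V → L.Srt ⊕ Art} {E : Art} {S : L.Srt} (a : Comp E S)
    (t : Term (extSig L Art Comp) vs (Sum.inr E)) : Term (extSig L Art Comp) vs (Sum.inl S) :=
  Term.app (L := extSig L Art Comp) (s := Sum.inr E) (t := Sum.inl S) a t

namespace ArtifactSetting

variable {L : Signature} (A : ArtifactSetting L)

/-- The signature of formulae over `(x, a)`. -/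
abbrev sig : Signature := extSig L A.Art A.Comp

/-- Sorts of the artifact variables. -/
abbrev varSrt : A.Var → L.Srt ⊕ A.Art := fun v => Sum.inl (A.varSort v)

/-- Formulae `φ(x, a)`. -/
abbrev StateFormula := Formula A.sig A.varSrt

/-- Two copies of the artifact components: `inl a` is `a`, and `inr a` is `a'`. -/
abbrev Comp₂ : A.Art → L.Srt → Type := fun E S => A.Comp E S ⊕ A.Comp E S

/-- The signature of formulae over `(x, a, x', a')`. -/
abbrev sig₂ : Signature := extSig L A.Art A.Comp₂

/-- Two copies of the artifact variables: `inl v` is `v`, and `inr v` is `v'`. -/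
abbrev varSrt₂ : A.Var ⊕ A.Var → L.Srt ⊕ A.Art := Sum.elim A.varSrt A.varSrt

/-- Formulae `τ(x, a, x', a')`. -/
abbrev TransitionFormula := Formula A.sig₂ A.varSrt₂

/-- A structure for the artifact extension. -/
structure ExtStr where
  base : Str.{u} L
  art : A.Art → Type u

variable {A}

/-- An assignment to the artifact setting. -/
structure State (M : A.ExtStr) where
  var : ∀ v, M.base.carrier (A.varSort v)
  comp : ∀ {E S}, A.Comp E S → M.art E → M.base.carrier S

end ArtifactSetting

/-- Interpretation of the function symbols of an artifact extension. -/
def extInterp {L : Signature} {Art : Type} {Comp : Art → L.Srt → Type} (M : Str.{u} L)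
    (art : Art → Type u) (arr : ∀ {E S}, Comp E S → art E → M.carrier S) :
    (s t : L.Srt ⊕ Art) → extFn L Art Comp s t →
      Sum.elim M.carrier art s → Sum.elim M.carrier art t
  | .inl _, .inl _, f => fun m => M.fn f m
  | .inr _, .inl _, a => fun e => arr a e
  | .inl _, .inr _, f => nomatch f
  | .inr _, .inr _, f => nomatch f

def extInterpCst {L : Signature} {Art : Type} (M : Str.{u} L) (art : Art → Type u) :
    (s : L.Srt ⊕ Art) → Sum.elim L.Cst (fun _ => Empty) s → Sum.elim M.carrier art s
  | .inl _, c => M.cst c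
  | .inr _, c => nomatch c

/-- The structure given by `M`, the carriers `art` and the interpretation `arr` of `Comp`. -/
abbrev extStr {L : Signature} {Art : Type} {Comp : Art → L.Srt → Type} (M : Str.{u} L)
    (art : Art → Type u) (arr : ∀ {E S}, Comp E S → art E → M.carrier S) :
    Str.{u} (extSig L Art Comp) where
  carrier := Sum.elim M.carrier art
  fn {s t} f := extInterp M art arr s t f
  cst {s} c := extInterpCst M art s c

namespace ArtifactSetting

variable {L : Signature} {A : ArtifactSetting L}

/-- Truth of `φ(x, a)` under an assignment to `(x, a)`. -/
def StateFormula.Holds (φ : A.StateFormula) (M : A.ExtStr) (α : State M) : Prop :=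
  Formula.Realize (extStr M.base M.art α.comp) φ (fun v => α.var v)

/-- Truth of `τ(x, a, x', a')` under assignments `α` to `(x, a)` and `α'` to `(x', a')`. -/
def TransitionFormula.Holds (τ : A.TransitionFormula) (M : A.ExtStr) (α α' : State M) : Prop :=
  Formula.Realize (extStr (Comp := A.Comp₂) M.base M.art (fun a => Sum.elim α.comp α'.comp a)) τ
    (extend (M := extStr (Comp := A.Comp₂) M.base M.art (fun a => Sum.elim α.comp α'.comp a))
      (vs := A.varSrt) (bs := A.varSrt) (fun v => α.var v) (fun v => α'.var v))

/-- The truth condition of the preimage `∃ x' ∃ a' (τ(x, a, x', a') ∧ φ(x', a'))`. -/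
def Pre (τ : A.TransitionFormula) (φ : A.StateFormula) (M : A.ExtStr.{u}) (α : State M) : Prop :=
  ∃ α' : State M, τ.Holds M α α' ∧ StateFormula.Holds φ M α'

/-! ## Strong locality -/

/-- The term is a variable. -/
inductive IsVar {L : Signature} {V : Type} {vs : V → L.Srt} : {s : L.Srt} → Term L vs s → Prop
  | var (v : V) : IsVar (.var v)

/-- Equalities and inequalities between two variables of the same artifact sort. -/
inductive IsArtLiteral {V : Type} {vs : V → L.Srt ⊕ A.Art} : Formula A.sig vs → Prop
  | eq {E : A.Art} {a b : Term A.sig vs (Sum.inr E)} : IsVar a → IsVar b → IsArtLiteral (.eq a b)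
  | ne {E : A.Art} {a b : Term A.sig vs (Sum.inr E)} :
      IsVar a → IsVar b → IsArtLiteral (.not (.eq a b))

variable (A) in
/-- Sorts of the variables in the scope of `∃ e₁ … e_k`: the artifact variables `x` (`inl`), and
the tuple `e` (`inr`), indexed by `B`, where `e_b` has the artifact sort `E b`. -/
abbrev scope {B : Type} (E : B → A.Art) : A.Var ⊕ B → L.Srt ⊕ A.Art :=
  Sum.elim A.varSrt (fun b => Sum.inr (E b))

/-- The formulae `∃ e (δ(e) ∧ ψ(x) ∧ ⋀_b φ_b(e_b, a))`. The artifact variables have basic sorts,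
so the literals in `δ` compare variables among the `e`. -/
def IsStronglyLocalDisjunct (χ : A.StateFormula) : Prop :=
  ∃ (B : Type) (_ : Finite B) (E : B → A.Art)
    (δ : List (Formula A.sig (A.scope E)))
    (ψ : Formula L A.varSort)
    (φ : ∀ b, Formula A.sig (V := Unit) (fun _ => Sum.inr (E b))),
    (∀ l ∈ δ, IsArtLiteral l) ∧ ψ.IsQF ∧ (∀ b, (φ b).IsQF) ∧
    χ = .ex B (fun b => Sum.inr (E b))
      (.and (.conj δ) (.and
        (ψ.map (extIncl L A.Art A.Comp)
          (fun v => Term.var (L := A.sig) (vs := A.scope E) (Sum.inl v)))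
        (.iConj fun b => (φ b).map (SigHom.id A.sig)
          (fun _ => Term.var (L := A.sig) (vs := A.scope E) (Sum.inr b)))))

/-- Strongly local state formulae. -/
def IsStronglyLocal (φ : A.StateFormula) : Prop :=
  ∃ l : List A.StateFormula, (∀ χ ∈ l, IsStronglyLocalDisjunct χ) ∧ φ = .disj l

/-- `τ` is strongly local: the preimage along `τ` of each strongly local formula is equivalent to
a strongly local formula in all models of `Tstar` (structures for the artifact extension whose
reduct to the basic signature is a model of `Tstar`). -/
def IsStronglyLocalTransition (Tstar : Theory L) (τ : A.TransitionFormula) : Prop :=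
  ∀ φ : A.StateFormula, IsStronglyLocal φ →
    ∃ χ : A.StateFormula, IsStronglyLocal χ ∧
      ∀ M : A.ExtStr.{u}, M.base.IsModel Tstar →
        ∀ α : State M, (Pre τ φ M α ↔ StateFormula.Holds χ M α)

end ArtifactSetting

/-! ## Delete&set transitions -/

/-- The data of a delete&set transition: the artifact sort `PI` of the process instances, whose
components are the case variables; the artifact sort `R` of a repository relation; for each
component `r_j` of `R` the case variable `x₁ r_j` to which its value is transferred; the
precondition `π` on the case variables; the post-condition `ψ(y₁, y₂)`. -/
structure DeleteSet (Sg : DBSignature) (A : ArtifactSetting Sg.toSignature) where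
  PI : A.Art
  R : A.Art
  ne : R ≠ PI
  x₁ : {S : Sg.Srt} → A.Comp R S → A.Comp PI S
  x₁_injective : ∀ {S : Sg.Srt}, Function.Injective (x₁ (S := S))
  π : Formula Sg.toSignature (V := Σ S, A.Comp PI S) (fun c => c.1)
  π_qf : π.IsQF
  ψ : Formula Sg.toSignature
    (V := (Σ S, A.Comp R S) ⊕ {c : Σ S, A.Comp PI S // c.2 ∉ Set.range (x₁ (S := c.1))})
    (Sum.elim (fun j => j.1) (fun c => c.1.1))
  ψ_qf : ψ.IsQF

namespace DeleteSet

variable {Sg : DBSignature} {A : ArtifactSetting Sg.toSignature} (d : DeleteSet Sg A)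

/-- The components `r` of the repository relation `R`. -/
abbrev RComp := Σ S, A.Comp d.R S

/-- The case variables. -/
abbrev CaseVar := Σ S, A.Comp d.PI S

/-- The case variables `x₂`: those not among the `x₁`. -/
abbrev CaseVar₂ := {c : d.CaseVar // c.2 ∉ Set.range (d.x₁ (S := c.1))}

/-- The components `s` of the other repository relations. -/
abbrev OtherComp := {c : Σ E S, A.Comp E S // c.1 ≠ d.PI ∧ c.1 ≠ d.R}

/-- The variables `y₁, y₂, i, e` quantified in the transition formula. -/
inductive BVar
  | y₁ (j : d.RComp)
  | y₂ (c : d.CaseVar₂)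
  | i
  | e

def bsort : d.BVar → Sg.Srt ⊕ A.Art
  | .y₁ j => Sum.inl j.1
  | .y₂ c => Sum.inl c.1.1
  | .i => Sum.inr d.PI
  | .e => Sum.inr d.R

instance finite_comp (E : A.Art) : Finite (Σ S, A.Comp E S) :=
  haveI := A.finite_comp
  Finite.of_injective (fun c => (⟨E, c⟩ : Σ E S, A.Comp E S)) (fun a b h => by simpa using h)

instance : Finite d.OtherComp :=
  haveI := A.finite_comp
  Subtype.finite

instance : Finite A.Var := A.finite_var

instance : Finite d.BVar :=
  Finite.of_surjective
    (fun z : (d.RComp ⊕ d.CaseVar₂) ⊕ Bool => match z with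
      | .inl (.inl j) => BVar.y₁ j
      | .inl (.inr c) => BVar.y₂ c
      | .inr true => BVar.i
      | .inr false => BVar.e)
    (fun b => match b with
      | .y₁ j => ⟨.inl (.inl j), rfl⟩
      | .y₂ c => ⟨.inl (.inr c), rfl⟩
      | .i => ⟨.inr true, rfl⟩
      | .e => ⟨.inr false, rfl⟩)

/-- Sorts of the variables in the scope of `∃ y₁ y₂ i e`. -/
abbrev scope : (A.Var ⊕ A.Var) ⊕ d.BVar → Sg.Srt ⊕ A.Art := Sum.elim A.varSrt₂ d.bsort

/-- Terms in the scope of `∃ y₁ y₂ i e`. -/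
abbrev Tm (s : Sg.Srt ⊕ A.Art) := Term A.sig₂ d.scope s

def ty₁ (j : d.RComp) : d.Tm (Sum.inl j.1) :=
  Term.var (L := A.sig₂) (vs := d.scope) (Sum.inr (BVar.y₁ j))

def ty₂ (c : d.CaseVar₂) : d.Tm (Sum.inl c.1.1) :=
  Term.var (L := A.sig₂) (vs := d.scope) (Sum.inr (BVar.y₂ c))

def ti : d.Tm (Sum.inr d.PI) := Term.var (L := A.sig₂) (vs := d.scope) (Sum.inr BVar.i)

def te : d.Tm (Sum.inr d.R) := Term.var (L := A.sig₂) (vs := d.scope) (Sum.inr BVar.e)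

/-- The read `a[t]` of an artifact component. -/
def cur {V : Type} {vs : V → Sg.Srt ⊕ A.Art} {E : A.Art} {S : Sg.Srt} (a : A.Comp E S)
    (t : Term A.sig₂ vs (Sum.inr E)) : Term A.sig₂ vs (Sum.inl S) :=
  Term.read (Comp := A.Comp₂) (.inl a) t

/-- The read `a'[t]` of an updated artifact component. -/
def nxt {V : Type} {vs : V → Sg.Srt ⊕ A.Art} {E : A.Art} {S : Sg.Srt} (a : A.Comp E S)
    (t : Term A.sig₂ vs (Sum.inr E)) : Term A.sig₂ vs (Sum.inl S) :=
  Term.read (Comp := A.Comp₂) (.inr a) t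

def undef {V : Type} (vs : V → Sg.Srt ⊕ A.Art) (S : Sg.Srt) : Term A.sig₂ vs (Sum.inl S) :=
  Term.cst (L := A.sig₂) (s := Sum.inl S) (Sg.undef S)

/-- Sorts of the variables in scope after one more variable of artifact sort `E` is bound. -/
abbrev scopeJ (E : A.Art) : ((A.Var ⊕ A.Var) ⊕ d.BVar) ⊕ Unit → Sg.Srt ⊕ A.Art :=
  Sum.elim d.scope (fun _ => Sum.inr E)

/-- The most recently bound variable `j`. -/
def tj (E : A.Art) : Term A.sig₂ (d.scopeJ E) (Sum.inr E) :=
  Term.var (L := A.sig₂) (vs := d.scopeJ E) (Sum.inr ())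

/-- Put a term under the quantifier that binds `j`. -/
def weaken (E : A.Art) {s : Sg.Srt ⊕ A.Art} (t : d.Tm s) : Term A.sig₂ (d.scopeJ E) s :=
  t.map (SigHom.id A.sig₂) (fun z => Term.var (L := A.sig₂) (vs := d.scopeJ E) (Sum.inl z))

/-- `a' := λ j. if j = t then u else a[j]`, that is,
`∀ j ((j = t ∧ a'[j] = u) ∨ (j ≠ t ∧ a'[j] = a[j]))`. -/
def update {E : A.Art} {S : Sg.Srt} (a : A.Comp E S) (t : d.Tm (Sum.inr E))
    (u : d.Tm (Sum.inl S)) : Formula A.sig₂ d.scope :=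
  .all Unit (fun _ => Sum.inr E)
    (.or (.and (.eq (d.tj E) (d.weaken E t)) (.eq (nxt a (d.tj E)) (d.weaken E u)))
      (.and (.not (.eq (d.tj E) (d.weaken E t))) (.eq (nxt a (d.tj E)) (cur a (d.tj E)))))

/-- `a' := a`, that is, `∀ j, a'[j] = a[j]`. -/
def keep {E : A.Art} {S : Sg.Srt} (a : A.Comp E S) : Formula A.sig₂ d.scope :=
  .all Unit (fun _ => Sum.inr E) (.eq (nxt a (d.tj E)) (cur a (d.tj E)))

/-- The delete&set transition formula
`∃ y₁ y₂ i e (π(x₁[i], x₂[i]) ∧ r[e] = y₁ ∧ ψ(y₁, y₂) ∧ ⋀_j r_j[e] ≠ undef ∧ x₁'[i] := r[e] ∧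
x₂'[i] := y₂ ∧ s' := s ∧ r' := λ j. if j = e then undef else r[j])`.
Here `x'[i] := u` updates the array `x` at the index `i` only. The artifact variables that the
setting may contain besides the artifact components are left unchanged. -/
noncomputable def formula : A.TransitionFormula :=
  .ex d.BVar d.bsort <| .conj
    [ d.π.map (extIncl Sg.toSignature A.Art A.Comp₂) (fun c => cur c.2 d.ti),
      .iConj fun j : d.RComp => .eq (cur j.2 d.te) (d.ty₁ j),
      d.ψ.map (extIncl Sg.toSignature A.Art A.Comp₂)
        (fun y => match y with
          | .inl j => d.ty₁ j
          | .inr c => d.ty₂ c),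
      .iConj fun j : d.RComp => .not (.eq (cur j.2 d.te) (undef d.scope j.1)),
      .iConj fun j : d.RComp => d.update (d.x₁ j.2) d.ti (cur j.2 d.te),
      .iConj fun c : d.CaseVar₂ => d.update c.1.2 d.ti (d.ty₂ c),
      .iConj fun c : d.OtherComp => d.keep c.1.2.2,
      .iConj fun j : d.RComp => d.update j.2 d.te (undef d.scope j.1),
      .iConj fun v : A.Var => .eq (s := Sum.inl (A.varSort v))
        (Term.var (L := A.sig₂) (vs := d.scope) (Sum.inl (Sum.inr v)))
        (Term.var (L := A.sig₂) (vs := d.scope) (Sum.inl (Sum.inl v))) ]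

end DeleteSet

/-! ## Semantics of the connectives and of translations -/

namespace Formula

variable {L : Signature} {V : Type} {vs : V → L.Srt} {M : Str.{u} L} {v : ∀ x, M.carrier (vs x)}

theorem realize_or {φ χ : Formula L vs} :
    (φ.or χ).Realize M v ↔ φ.Realize M v ∨ χ.Realize M v := by
  simp only [Formula.or, Realize]; tauto

theorem realize_all {B : Type} [Finite B] {bs : B → L.Srt} {φ : Formula L (Sum.elim vs bs)} :
    (Formula.all B bs φ).Realize M v ↔
      ∀ w : ∀ b, M.carrier (bs b), φ.Realize M (extend v w) := by
  simp only [Formula.all, Realize, not_exists, not_not]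

theorem realize_conj {l : List (Formula L vs)} :
    (conj l).Realize M v ↔ ∀ φ ∈ l, φ.Realize M v := by
  induction l with
  | nil => simp [conj, Realize]
  | cons φ l ih =>
    rw [List.forall_mem_cons, ← ih]
    rfl

theorem realize_disj {l : List (Formula L vs)} :
    (disj l).Realize M v ↔ ∃ φ ∈ l, φ.Realize M v := by
  induction l with
  | nil => simp [disj, Realize]
  | cons φ l ih =>
    simp only [List.mem_cons, exists_eq_or_imp, ← ih]
    exact realize_or

theorem realize_iConj {ι : Type} [Finite ι] {f : ι → Formula L vs} :
    (iConj f).Realize M v ↔ ∀ i, (f i).Realize M v := by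
  simp [iConj, realize_conj]

end Formula

/-- The reduct of a structure along a signature morphism. -/
abbrev Str.reduct {L L' : Signature} (F : SigHom L L') (M : Str.{u} L') : Str.{u} L where
  carrier s := M.carrier (F.srt s)
  fn f := M.fn (F.fn f)
  cst c := M.cst (F.cst c)

theorem Term.eval_map {L L' : Signature} (F : SigHom L L') (M : Str.{u} L') {V W : Type}
    {vs : V → L.Srt} {ws : W → L'.Srt} (σ : ∀ v, Term L' ws (F.srt (vs v)))
    (w : ∀ x, M.carrier (ws x)) {s : L.Srt} (t : Term L vs s) :
    (t.map F σ).eval M w = t.eval (M.reduct F) (fun v => (σ v).eval M w) := by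
  induction t with
  | var v => rfl
  | cst c => rfl
  | app f a ih => exact congrArg (M.fn (F.fn f)) ih

theorem Formula.IsQF.realize_map {L L' : Signature} (F : SigHom L L') (M : Str.{u} L')
    {V W : Type} {vs : V → L.Srt} {ws : W → L'.Srt} {φ : Formula L vs} (hφ : φ.IsQF)
    (σ : ∀ v, Term L' ws (F.srt (vs v))) (w : ∀ x, M.carrier (ws x)) :
    (φ.map F σ).Realize M w ↔ φ.Realize (M.reduct F) (fun v => (σ v).eval M w) := by
  induction hφ with
  | falsum => exact Iff.rfl
  | eq a b => simp only [Formula.map, Formula.Realize, Term.eval_map]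
  | not _ ih => exact not_congr ih
  | and _ _ ih₁ ih₂ => exact and_congr ih₁ ih₂

theorem Formula.IsQF.map {L L' : Signature} (F : SigHom L L')
    {V W : Type} {vs : V → L.Srt} {ws : W → L'.Srt} {φ : Formula L vs} (hφ : φ.IsQF)
    (σ : ∀ v, Term L' ws (F.srt (vs v))) : (φ.map F σ).IsQF := by
  induction hφ with
  | falsum => exact .falsum
  | eq a b => exact .eq _ _
  | not _ ih => exact .not ih
  | and _ _ ih₁ ih₂ => exact .and ih₁ ih₂

/-! ## Quantifier-free formulae in one variable of artifact sort -/

section OneVariable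

variable {L : Signature} {A : ArtifactSetting L}

/-- What a term in one variable of artifact sort `E` becomes when the reads of that variable are
turned into variables: a basic term, or nothing for the variable itself. -/
def ReadTerm (A : ArtifactSetting L) (E : A.Art) : L.Srt ⊕ A.Art → Type
  | .inl S => Term L (V := Σ S, A.Comp E S) (fun c => c.1) S
  | .inr E' => PLift (E' = E)

/-- The value of a translated term when the variable has the value `k`. -/
def ReadTerm.eval {E : A.Art} (M : A.ExtStr) (α : ArtifactSetting.State M) (k : M.art E) :
    (s : L.Srt ⊕ A.Art) → ReadTerm A E s → Sum.elim M.base.carrier M.art s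
  | .inl _, t => Term.eval M.base (fun c => α.comp c.2 k) t
  | .inr _, ⟨h⟩ => h ▸ k

theorem Term.exists_readTerm {E : A.Art} {s : A.sig.Srt}
    (t : Term A.sig (V := Unit) (fun _ => Sum.inr E) s) :
    ∃ t' : ReadTerm A E s, ∀ (M : A.ExtStr.{u}) (α : ArtifactSetting.State M) (k : M.art E),
      t.eval (vs := fun _ : Unit => Sum.inr E) (extStr M.base M.art α.comp) (fun _ => k) =
        ReadTerm.eval M α k s t' := by
  induction t with
  | var x => exact ⟨⟨rfl⟩, fun M α k => rfl⟩
  | @cst s c =>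
    match s, c with
    | .inl S, c => exact ⟨Term.cst (L := L) c, fun M α k => rfl⟩
    | .inr _, c => exact nomatch c
  | @app s t f a ih =>
    match s, t, f, a, ih with
    | .inl S, .inl S', f, a, ⟨a', ha⟩ =>
      exact ⟨Term.app (L := L) f a', fun M α k => congrArg (M.base.fn f) (ha M α k)⟩
    | .inr E', .inl S', f, a, ⟨⟨h⟩, ha⟩ =>
      subst h
      exact ⟨Term.var (L := L) (vs := fun c : Σ S, A.Comp E' S => c.1) ⟨S', f⟩,
          fun M α k => congrArg (α.comp f) (ha M α k)⟩
    | .inl _, .inr _, f, _, _ => exact nomatch f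
    | .inr _, .inr _, f, _, _ => exact nomatch f

namespace ArtifactSetting

/-- Truth of a formula `φ(e, a)` in one variable of artifact sort when `e` has the value `k`. -/
def State.HoldsAt {M : A.ExtStr.{u}} (α : State M) {E : A.Art}
    (φ : Formula A.sig (V := Unit) (fun _ => Sum.inr E)) (k : M.art E) : Prop :=
  φ.Realize (vs := fun _ : Unit => Sum.inr E) (extStr M.base M.art α.comp) (fun _ => k)

/-- A quantifier-free formula in one variable `e` of artifact sort is a quantifier-free basic
formula in the reads `a[e]`. -/
theorem exists_reads {E : A.Art} {φ : Formula A.sig (V := Unit) (fun _ => Sum.inr E)}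
    (hφ : φ.IsQF) :
    ∃ χ : Formula L (V := Σ S, A.Comp E S) (fun c => c.1), χ.IsQF ∧
      ∀ (M : A.ExtStr.{u}) (α : State M) (k : M.art E),
        α.HoldsAt φ k ↔ χ.Realize M.base (fun c => α.comp c.2 k) := by
  induction hφ with
  | falsum => exact ⟨.falsum, .falsum, fun M α k => Iff.rfl⟩
  | @eq s a b =>
    obtain ⟨a', ha⟩ := Term.exists_readTerm.{u} a
    obtain ⟨b', hb⟩ := Term.exists_readTerm.{u} b
    match s, a, b, a', b', ha, hb with
    | .inl S, a, b, a', b', ha, hb =>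
      exact ⟨.eq a' b', .eq _ _, fun M α k => Eq.congr (ha M α k) (hb M α k)⟩
    | .inr E', a, b, a', b', ha, hb =>
      exact ⟨.not .falsum, .not .falsum,
        fun M α k => iff_of_true ((ha M α k).trans (hb M α k).symm) id⟩
  | not _ ih =>
    obtain ⟨χ, hχ, h⟩ := ih
    exact ⟨.not χ, .not hχ, fun M α k => not_congr (h M α k)⟩
  | and _ _ ih₁ ih₂ =>
    obtain ⟨χ₁, hχ₁, h₁⟩ := ih₁
    obtain ⟨χ₂, hχ₂, h₂⟩ := ih₂
    exact ⟨.and χ₁ χ₂, .and hχ₁ hχ₂, fun M α k => and_congr (h₁ M α k) (h₂ M α k)⟩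

/-- The formula `χ(a[e])` in the variable `e`, for a basic formula `χ`. -/
def ofReads {E : A.Art} (χ : Formula L (V := Σ S, A.Comp E S) (fun c => c.1)) :
    Formula A.sig (V := Unit) (fun _ => Sum.inr E) :=
  χ.map (extIncl L A.Art A.Comp)
    (fun c => Term.read c.2 (Term.var (L := A.sig) (vs := fun _ : Unit => Sum.inr E) ()))

theorem holdsAt_ofReads {E : A.Art} {χ : Formula L (V := Σ S, A.Comp E S) (fun c => c.1)}
    (hχ : χ.IsQF) {M : A.ExtStr.{u}} (α : State M) (k : M.art E) :
    α.HoldsAt (ofReads χ) k ↔ χ.Realize M.base (fun c => α.comp c.2 k) :=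
  hχ.realize_map (extIncl L A.Art A.Comp) (extStr M.base M.art α.comp) _ _

end ArtifactSetting

end OneVariable

/-! ## Semantics of strongly local formulae -/

namespace ArtifactSetting

variable {L : Signature} {A : ArtifactSetting L}

/-- Truth of a formula in the scope of `∃ e` when `e` has the value `w`. -/
def State.HoldsOn {M : A.ExtStr.{u}} (α : State M) {B : Type} {E : B → A.Art}
    (φ : Formula A.sig (A.scope E)) (w : ∀ b, M.art (E b)) : Prop :=
  φ.Realize (extStr M.base M.art α.comp)
    (extend (M := extStr M.base M.art α.comp) (vs := A.varSrt) (bs := fun b => Sum.inr (E b))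
      (fun v => α.var v) w)

theorem IsArtLiteral.isQF {V : Type} {vs : V → L.Srt ⊕ A.Art} {l : Formula A.sig vs}
    (hl : IsArtLiteral l) : l.IsQF := by
  cases hl with
  | eq _ _ => exact .eq _ _
  | ne _ _ => exact .not (.eq _ _)

theorem IsVar.eval_eq {M : A.ExtStr.{u}} (α α' : State M) {B : Type} {E : B → A.Art}
    (w : ∀ b, M.art (E b)) {s : A.sig.Srt} {t : Term A.sig (A.scope E) s} (ht : IsVar t)
    {F : A.Art} (hs : s = Sum.inr F) :
    t.eval (extStr M.base M.art α.comp)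
      (extend (M := extStr M.base M.art α.comp) (vs := A.varSrt) (bs := fun b => Sum.inr (E b))
        (fun v => α.var v) w) =
    t.eval (extStr M.base M.art α'.comp)
      (extend (M := extStr M.base M.art α'.comp) (vs := A.varSrt) (bs := fun b => Sum.inr (E b))
        (fun v => α'.var v) w) := by
  cases ht with
  | var v =>
    cases v with
    | inl x => exact nomatch hs
    | inr b => rfl

/-- The truth of artifact literals does not depend on the artifact setting. -/
theorem IsArtLiteral.holdsOn_iff {M : A.ExtStr.{u}} (α α' : State M) {B : Type} {E : B → A.Art}
    {l : Formula A.sig (A.scope E)} (hl : IsArtLiteral l) (w : ∀ b, M.art (E b)) :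
    α.HoldsOn l w ↔ α'.HoldsOn l w := by
  cases hl with
  | eq ha hb => exact Eq.congr (ha.eval_eq α α' w rfl) (hb.eval_eq α α' w rfl)
  | ne ha hb => exact not_congr (Eq.congr (ha.eval_eq α α' w rfl) (hb.eval_eq α α' w rfl))

/-- Rename the variables in the scope of `∃ e` along `f`. -/
def reindex {B B' : Type} (E' : B' → A.Art) (f : B → B')
    (φ : Formula A.sig (A.scope (fun b => E' (f b)))) : Formula A.sig (A.scope E') :=
  φ.map (SigHom.id A.sig) (fun z => match z with
    | .inl v => Term.var (L := A.sig) (vs := A.scope E') (Sum.inl v)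
    | .inr b => Term.var (L := A.sig) (vs := A.scope E') (Sum.inr (f b)))

theorem holdsOn_reindex {B B' : Type} {E' : B' → A.Art} (f : B → B')
    {φ : Formula A.sig (A.scope (fun b => E' (f b)))} (hφ : φ.IsQF)
    {M : A.ExtStr.{u}} (α : State M) (w : ∀ b, M.art (E' b)) :
    α.HoldsOn (reindex E' f φ) w ↔ α.HoldsOn φ (fun b => w (f b)) := by
  refine (hφ.realize_map (SigHom.id A.sig) (extStr M.base M.art α.comp) _ _).trans ?_
  refine iff_of_eq (congrArg (Formula.Realize (extStr M.base M.art α.comp) φ) ?_)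
  funext z
  cases z <;> rfl

theorem IsVar.map {V W : Type} {vs : V → A.sig.Srt} {ws : W → A.sig.Srt}
    {σ : ∀ v, Term A.sig ws (vs v)} (hσ : ∀ v, IsVar (σ v)) {s : A.sig.Srt}
    {t : Term A.sig vs s} (ht : IsVar t) : IsVar (t.map (SigHom.id A.sig) σ) := by
  cases ht with
  | var v => exact hσ v

theorem IsArtLiteral.reindex {B B' : Type} {E' : B' → A.Art} (f : B → B')
    {l : Formula A.sig (A.scope (fun b => E' (f b)))} (hl : IsArtLiteral l) :
    IsArtLiteral (reindex E' f l) := by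
  cases hl with
  | eq ha hb => exact .eq (ha.map (by rintro (_ | _) <;> constructor))
                  (hb.map (by rintro (_ | _) <;> constructor))
  | ne ha hb => exact .ne (ha.map (by rintro (_ | _) <;> constructor))
                  (hb.map (by rintro (_ | _) <;> constructor))

/-- For all `b`, `b'` and each truth value `p` there is an artifact literal which says that the
statement `e_b = e_b'` has the truth value `p`; variables of different sorts count as unequal. -/
theorem exists_artLiteral {B : Type} (E : B → A.Art) (b b' : B) (p : Prop) :
    ∃ l : Formula A.sig (A.scope E), IsArtLiteral l ∧
      ∀ (M : A.ExtStr.{u}) (α : State M) (w : ∀ b, M.art (E b)),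
        α.HoldsOn l w ↔ ((⟨E b, w b⟩ : Σ F, M.art F) = ⟨E b', w b'⟩ ↔ p) := by
  have key : ∀ F : A.Art, F = E b → ∃ t : Term A.sig (A.scope E) (Sum.inr F), IsVar t ∧
      ∀ (M : A.ExtStr.{u}) (α : State M) (w : ∀ b, M.art (E b)),
        (⟨F, t.eval (extStr M.base M.art α.comp)
          (extend (M := extStr M.base M.art α.comp) (vs := A.varSrt)
            (bs := fun b => Sum.inr (E b)) (fun v => α.var v) w)⟩ : Σ F, M.art F) =
          ⟨E b, w b⟩ := by
    rintro F rfl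
    exact ⟨Term.var (L := A.sig) (vs := A.scope E) (Sum.inr b), .var _, fun M α w => rfl⟩
  by_cases h : E b' = E b
  · obtain ⟨t, ht, hw⟩ := key _ h
    let t' : Term A.sig (A.scope E) (Sum.inr (E b')) :=
      Term.var (L := A.sig) (vs := A.scope E) (Sum.inr b')
    have heq : ∀ (M : A.ExtStr.{u}) (α : State M) (w : ∀ b, M.art (E b)),
        α.HoldsOn (.eq t t') w ↔ (⟨E b, w b⟩ : Σ F, M.art F) = ⟨E b', w b'⟩ := by
      intro M α w
      rw [← hw M α w]
      exact ⟨fun h => congrArg (Sigma.mk (E b')) h, fun h => eq_of_heq (Sigma.mk.inj h).2⟩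
    by_cases hp : p
    · exact ⟨.eq t t', .eq ht (.var _), fun M α w => by rw [heq M α w]; tauto⟩
    · refine ⟨.not (.eq t t'), .ne ht (.var _), fun M α w => ?_⟩
      exact (not_congr (heq M α w)).trans (by tauto)
  · let t : Term A.sig (A.scope E) (Sum.inr (E b)) :=
      Term.var (L := A.sig) (vs := A.scope E) (Sum.inr b)
    have hne : ∀ (M : A.ExtStr.{u}) (w : ∀ b, M.art (E b)),
        (⟨E b, w b⟩ : Σ F, M.art F) ≠ ⟨E b', w b'⟩ :=
      fun M w hw => h (Sigma.mk.inj hw).1.symm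
    by_cases hp : p
    · refine ⟨.not (.eq t t), .ne (.var _) (.var _), fun M α w => ?_⟩
      exact iff_of_false (fun h => h rfl) (fun h => hne M w (h.2 hp))
    · refine ⟨.eq t t, .eq (.var _) (.var _), fun M α w => ?_⟩
      exact iff_of_true rfl (iff_of_false (hne M w) hp)

/-- The formula `∃ e (δ(e) ∧ ψ(x) ∧ ⋀_b φ_b(e_b, a))`. -/
noncomputable def localDisjunct {B : Type} [Finite B] (E : B → A.Art)
    (δ : List (Formula A.sig (A.scope E))) (ψ : Formula L A.varSort)
    (φ : ∀ b, Formula A.sig (V := Unit) (fun _ => Sum.inr (E b))) : A.StateFormula :=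
  .ex B (fun b => Sum.inr (E b))
    (.and (.conj δ) (.and
      (ψ.map (extIncl L A.Art A.Comp)
        (fun v => Term.var (L := A.sig) (vs := A.scope E) (Sum.inl v)))
      (.iConj fun b => (φ b).map (SigHom.id A.sig)
        (fun _ => Term.var (L := A.sig) (vs := A.scope E) (Sum.inr b)))))

theorem holds_localDisjunct {B : Type} [Finite B] {E : B → A.Art}
    {δ : List (Formula A.sig (A.scope E))} {ψ : Formula L A.varSort}
    {φ : ∀ b, Formula A.sig (V := Unit) (fun _ => Sum.inr (E b))}
    (hψ : ψ.IsQF) (hφ : ∀ b, (φ b).IsQF) (M : A.ExtStr.{u}) (α : State M) :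
    StateFormula.Holds (localDisjunct E δ ψ φ) M α ↔
      ∃ w : ∀ b, M.art (E b), (∀ l ∈ δ, α.HoldsOn l w) ∧
        ψ.Realize M.base (fun v => α.var v) ∧ ∀ b, α.HoldsAt (φ b) (w b) := by
  refine exists_congr fun w => and_congr Formula.realize_conj (and_congr ?_ ?_)
  · exact hψ.realize_map (extIncl L A.Art A.Comp) (extStr M.base M.art α.comp) _ _
  · refine Formula.realize_iConj.trans (forall_congr' fun b => ?_)
    exact (hφ b).realize_map (SigHom.id A.sig) (extStr M.base M.art α.comp) _ _

theorem holds_disj {l : List A.StateFormula} {M : A.ExtStr.{u}} {α : State M} :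
    StateFormula.Holds (.disj l) M α ↔ ∃ φ ∈ l, StateFormula.Holds φ M α :=
  Formula.realize_disj

theorem IsStronglyLocal.disj_map {ι : Type} [Finite ι] {χ : ι → A.StateFormula}
    (hχ : ∀ i, IsStronglyLocalDisjunct (χ i)) :
    ∃ φ : A.StateFormula, IsStronglyLocal φ ∧
      ∀ (M : A.ExtStr.{u}) (α : State M),
        StateFormula.Holds φ M α ↔ ∃ i, StateFormula.Holds (χ i) M α := by
  have := Fintype.ofFinite ι
  refine ⟨.disj (Finset.univ.toList.map χ), ⟨_, by simpa using hχ, rfl⟩, fun M α => ?_⟩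
  rw [holds_disj]
  simp

/-- A transition is strongly local as soon as the preimages of single disjuncts are equivalent to
strongly local formulae. -/
theorem isStronglyLocalTransition_of_disjuncts {Tstar : Theory L} {τ : A.TransitionFormula}
    (h : ∀ φ : A.StateFormula, IsStronglyLocalDisjunct φ →
      ∃ χ : A.StateFormula, IsStronglyLocal χ ∧
        ∀ M : A.ExtStr.{u}, M.base.IsModel Tstar →
          ∀ α : State M, (Pre τ φ M α ↔ StateFormula.Holds χ M α)) :
    IsStronglyLocalTransition.{u} Tstar τ := by
  rintro _ ⟨l, hl, rfl⟩
  induction l with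
  | nil =>
    refine ⟨.disj [], ⟨[], by simp, rfl⟩, fun M _ α => ?_⟩
    exact iff_of_false (fun ⟨_, _, h⟩ => h) id
  | cons φ l ih =>
    rw [List.forall_mem_cons] at hl
    obtain ⟨_, ⟨l₁, hl₁, rfl⟩, h₁⟩ := h φ hl.1
    obtain ⟨_, ⟨l₂, hl₂, rfl⟩, h₂⟩ := ih hl.2
    refine ⟨.disj (l₁ ++ l₂), ⟨_, ?_, rfl⟩, fun M hM α => ?_⟩
    · simp only [List.mem_append]
      rintro χ (hχ | hχ)
      exacts [hl₁ χ hχ, hl₂ χ hχ]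
    · have hsplit : Pre τ (.disj (φ :: l)) M α ↔ Pre τ φ M α ∨ Pre τ (.disj l) M α := by
        simp only [Pre, ← exists_or, ← and_or_left]
        exact exists_congr fun α' => and_congr_right fun _ => Formula.realize_or
      rw [hsplit, h₁ M hM α, h₂ M hM α, holds_disj, holds_disj, holds_disj]
      simp only [List.mem_append, or_and_right, exists_or]

end ArtifactSetting

/-! ## Semantics of delete&set transitions -/

namespace DeleteSet

open ArtifactSetting

variable {Sg : DBSignature} {A : ArtifactSetting Sg.toSignature} (d : DeleteSet Sg A)

/-- The state `α'` results from `α` by the updates of the transition at `i` and `e`, with the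
values `y` for the case variables `x₂`. -/
structure IsSuccessor {M : A.ExtStr.{u}} (i : M.art d.PI) (e : M.art d.R)
    (y : ∀ c : d.CaseVar₂, M.base.carrier c.1.1) (α α' : State M) : Prop where
  set₁ : ∀ (j : d.RComp) (k : M.art d.PI),
    (k = i ∧ α'.comp (d.x₁ j.2) k = α.comp j.2 e) ∨
      (k ≠ i ∧ α'.comp (d.x₁ j.2) k = α.comp (d.x₁ j.2) k)
  set₂ : ∀ (c : d.CaseVar₂) (k : M.art d.PI),
    (k = i ∧ α'.comp c.1.2 k = y c) ∨ (k ≠ i ∧ α'.comp c.1.2 k = α.comp c.1.2 k)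
  other : ∀ (c : d.OtherComp) (k : M.art c.1.1), α'.comp c.1.2.2 k = α.comp c.1.2.2 k
  delete : ∀ (j : d.RComp) (k : M.art d.R),
    (k = e ∧ α'.comp j.2 k = M.base.cst (Sg.undef j.1)) ∨ (k ≠ e ∧ α'.comp j.2 k = α.comp j.2 k)
  var : ∀ v, α'.var v = α.var v

/-- The values of `y₁ = r[e]` and `y₂`. -/
def postVal {M : A.ExtStr.{u}} (α : State M) (e : M.art d.R)
    (y : ∀ c : d.CaseVar₂, M.base.carrier c.1.1) :
    ∀ z : d.RComp ⊕ d.CaseVar₂,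
      M.base.carrier (Sum.elim (fun j : d.RComp => j.1) (fun c : d.CaseVar₂ => c.1.1) z) :=
  extend (M := M.base) (fun j => α.comp j.2 e) y

/-- The structure in which transition formulae are evaluated. -/
abbrev pairStr {M : A.ExtStr.{u}} (α α' : State M) : Str.{u} A.sig₂ :=
  extStr (Comp := A.Comp₂) M.base M.art (fun a => Sum.elim α.comp α'.comp a)

theorem realize_update {M : A.ExtStr.{u}} {α α' : State M}
    {v : ∀ z, (pairStr α α').carrier (d.scope z)} {E : A.Art} {S : Sg.Srt} {a : A.Comp E S}
    {t : d.Tm (Sum.inr E)} {u : d.Tm (Sum.inl S)} {k₀ : M.art E} {x : M.base.carrier S}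
    (ht : t.eval (pairStr α α') v = k₀) (hu : u.eval (pairStr α α') v = x) :
    (d.update a t u).Realize (pairStr α α') v ↔
      ∀ k : M.art E, (k = k₀ ∧ α'.comp a k = x) ∨ (k ≠ k₀ ∧ α'.comp a k = α.comp a k) := by
  have hw : ∀ {s} (t : d.Tm s) (k : Unit → M.art E),
      (d.weaken E t).eval (pairStr α α')
        (extend (M := pairStr α α') (bs := fun _ : Unit => Sum.inr E) v k) =
        t.eval (pairStr α α') v :=
    fun t k => Term.eval_map (SigHom.id A.sig₂) (pairStr α α') _ _ t
  subst ht hu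
  refine Formula.realize_all.trans ((forall_congr' (q := fun k : Unit → M.art E =>
    (k () = t.eval (pairStr α α') v ∧ α'.comp a (k ()) = u.eval (pairStr α α') v) ∨
      (k () ≠ t.eval (pairStr α α') v ∧ α'.comp a (k ()) = α.comp a (k ()))) fun k => ?_).trans
    ⟨fun h k => h fun _ => k, fun h k => h (k ())⟩)
  exact Formula.realize_or.trans
    (or_congr (and_congr (Eq.congr rfl (hw t k)) (Eq.congr rfl (hw u k)))
      (and_congr (not_congr (Eq.congr rfl (hw t k))) Iff.rfl))

theorem realize_keep {M : A.ExtStr.{u}} {α α' : State M}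
    {v : ∀ z, (pairStr α α').carrier (d.scope z)} {E : A.Art} {S : Sg.Srt} {a : A.Comp E S} :
    (d.keep a).Realize (pairStr α α') v ↔ ∀ k : M.art E, α'.comp a k = α.comp a k :=
  Formula.realize_all.trans ⟨fun h k => h fun _ => k, fun h k => h (k ())⟩

/-- The values of the variables bound in the transition formula. -/
def boundVal {M : A.ExtStr.{u}} (y₁ : ∀ j : d.RComp, M.base.carrier j.1)
    (y₂ : ∀ c : d.CaseVar₂, M.base.carrier c.1.1) (i : M.art d.PI) (e : M.art d.R) :
    ∀ b, Sum.elim M.base.carrier M.art (d.bsort b)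
  | .y₁ j => y₁ j
  | .y₂ c => y₂ c
  | .i => i
  | .e => e

theorem exists_boundVal {M : A.ExtStr.{u}}
    {P : (∀ b, Sum.elim M.base.carrier M.art (d.bsort b)) → Prop} :
    (∃ w, P w) ↔ ∃ y₁ y₂ i e, P (d.boundVal y₁ y₂ i e) := by
  constructor
  · rintro ⟨w, hw⟩
    refine ⟨fun j => w (.y₁ j), fun c => w (.y₂ c), w .i, w .e, ?_⟩
    convert hw using 1
    funext b
    cases b <;> rfl
  · rintro ⟨y₁, y₂, i, e, h⟩
    exact ⟨_, h⟩

theorem holds_formula {M : A.ExtStr.{u}} (α α' : State M) :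
    TransitionFormula.Holds d.formula M α α' ↔ ∃ y i e,
      d.π.Realize M.base (fun c => α.comp c.2 i) ∧
      d.ψ.Realize M.base (d.postVal α e y) ∧
      (∀ j : d.RComp, α.comp j.2 e ≠ M.base.cst (Sg.undef j.1)) ∧
      d.IsSuccessor i e y α α' := by
  refine d.exists_boundVal.trans ?_
  have hpost : ∀ y i e, Formula.Realize (pairStr α α')
      (d.ψ.map (extIncl Sg.toSignature A.Art A.Comp₂)
        (fun y => match y with
          | .inl j => d.ty₁ j
          | .inr c => d.ty₂ c))
      (extend (M := pairStr α α') (vs := A.varSrt₂) (bs := d.bsort)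
        (extend (M := pairStr α α') (vs := A.varSrt) (bs := A.varSrt)
          (fun v => α.var v) (fun v => α'.var v))
        (d.boundVal (fun j => α.comp j.2 e) y i e)) ↔
      d.ψ.Realize M.base (d.postVal α e y) := by
    intro y i e
    refine (d.ψ_qf.realize_map (extIncl Sg.toSignature A.Art A.Comp₂) (pairStr α α') _ _).trans
      (iff_of_eq (congrArg (Formula.Realize M.base d.ψ) ?_))
    funext z
    cases z <;> rfl
  constructor
  · rintro ⟨y₁, y, i, e, h⟩
    have h := Formula.realize_conj.1 h
    simp only [List.forall_mem_cons] at h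
    obtain ⟨hπ, hr, hψ, hu, h₁, h₂, hk, hd, hv, -⟩ := h
    obtain rfl : (fun j => α.comp j.2 e) = y₁ :=
      funext fun j => Formula.realize_iConj.1 hr j
    refine ⟨y, i, e, ?_, (hpost y i e).1 hψ, fun j => Formula.realize_iConj.1 hu j, ?_⟩
    · exact (d.π_qf.realize_map (extIncl Sg.toSignature A.Art A.Comp₂) (pairStr α α') _ _).1 hπ
    · exact {
        set₁ := fun j => (d.realize_update rfl rfl).1 (Formula.realize_iConj.1 h₁ j)
        set₂ := fun c => (d.realize_update rfl rfl).1 (Formula.realize_iConj.1 h₂ c)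
        other := fun c => d.realize_keep.1 (Formula.realize_iConj.1 hk c)
        delete := fun j => (d.realize_update rfl rfl).1 (Formula.realize_iConj.1 hd j)
        var := fun v => Formula.realize_iConj.1 hv v }
  · rintro ⟨y, i, e, hπ, hψ, hu, hs⟩
    refine ⟨fun j => α.comp j.2 e, y, i, e, Formula.realize_conj.2 ?_⟩
    simp only [List.forall_mem_cons]
    refine ⟨?_, Formula.realize_iConj.2 fun j => rfl, (hpost y i e).2 hψ,
      Formula.realize_iConj.2 hu,
      Formula.realize_iConj.2 fun j => (d.realize_update rfl rfl).2 (hs.set₁ j),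
      Formula.realize_iConj.2 fun c => (d.realize_update rfl rfl).2 (hs.set₂ c),
      Formula.realize_iConj.2 fun c => d.realize_keep.2 (hs.other c),
      Formula.realize_iConj.2 fun j => (d.realize_update rfl rfl).2 (hs.delete j),
      Formula.realize_iConj.2 hs.var, by simp⟩
    exact (d.π_qf.realize_map (extIncl Sg.toSignature A.Art A.Comp₂) (pairStr α α') _ _).2 hπ

theorem exists_isSuccessor {M : A.ExtStr.{u}} (i : M.art d.PI) (e : M.art d.R)
    (y : ∀ c : d.CaseVar₂, M.base.carrier c.1.1) (α : State M) :
    ∃ α', d.IsSuccessor i e y α α' := by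
  classical
  let caseVal : ∀ {S}, A.Comp d.PI S → M.art d.PI → M.base.carrier S := fun {S} a k =>
    if k = i then
      if h : a ∈ Set.range (d.x₁ (S := S)) then α.comp h.choose e else y ⟨⟨S, a⟩, h⟩
    else α.comp a k
  let repVal : ∀ {S}, A.Comp d.R S → M.art d.R → M.base.carrier S := fun {S} a k =>
    if k = e then M.base.cst (Sg.undef S) else α.comp a k
  let α' : State M := {
    var := α.var
    comp := fun {E S} a k =>
      if h : E = d.PI then caseVal (h ▸ a) (h ▸ k)
      else if h : E = d.R then repVal (h ▸ a) (h ▸ k)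
      else α.comp a k }
  have hcase : ∀ {S} (a : A.Comp d.PI S) (k : M.art d.PI), α'.comp a k = caseVal a k :=
    fun a k => dif_pos rfl
  have hrep : ∀ {S} (a : A.Comp d.R S) (k : M.art d.R), α'.comp a k = repVal a k :=
    fun a k => (dif_neg d.ne).trans (dif_pos rfl)
  refine ⟨α', ⟨fun j k => ?_, fun c k => ?_, fun c k => ?_, fun j k => ?_, fun v => rfl⟩⟩
  · by_cases hk : k = i
    · have hj : d.x₁ j.2 ∈ Set.range (d.x₁ (S := j.1)) := ⟨_, rfl⟩
      refine .inl ⟨hk, (hcase _ _).trans ((if_pos hk).trans ((dif_pos hj).trans ?_))⟩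
      rw [d.x₁_injective hj.choose_spec]
    · exact .inr ⟨hk, (hcase _ _).trans (if_neg hk)⟩
  · by_cases hk : k = i
    · exact .inl ⟨hk, (hcase _ _).trans ((if_pos hk).trans (dif_neg c.2))⟩
    · exact .inr ⟨hk, (hcase _ _).trans (if_neg hk)⟩
  · exact (dif_neg c.2.1).trans (dif_neg c.2.2)
  · by_cases hk : k = e
    · exact .inl ⟨hk, (hrep _ _).trans (if_pos hk)⟩
    · exact .inr ⟨hk, (hrep _ _).trans (if_neg hk)⟩

end DeleteSet

/-! ## Preimages along delete&set transitions -/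

namespace DeleteSet

open ArtifactSetting

variable {Sg : DBSignature} {A : ArtifactSetting Sg.toSignature} (d : DeleteSet Sg A)

/-- Sorts of the variables `y₁`, `y₂`. -/
abbrev postSrt : d.RComp ⊕ d.CaseVar₂ → Sg.Srt :=
  Sum.elim (fun j => j.1) (fun c => c.1.1)

variable {d}

/-- Away from `i` and `e` the components are unchanged. -/
theorem IsSuccessor.comp_eq {M : A.ExtStr.{u}} {i : M.art d.PI} {e : M.art d.R}
    {y : ∀ c : d.CaseVar₂, M.base.carrier c.1.1} {α α' : State M}
    (hs : d.IsSuccessor i e y α α') {E : A.Art} {k : M.art E}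
    (hi : (⟨E, k⟩ : Σ F, M.art F) ≠ ⟨d.PI, i⟩) (he : (⟨E, k⟩ : Σ F, M.art F) ≠ ⟨d.R, e⟩)
    {S : Sg.Srt} (a : A.Comp E S) : α'.comp a k = α.comp a k := by
  by_cases hE : E = d.PI
  · subst hE
    have hk : k ≠ i := fun h => hi (h ▸ rfl)
    by_cases ha : a ∈ Set.range (d.x₁ (S := S))
    · obtain ⟨r, rfl⟩ := ha
      exact ((hs.set₁ ⟨S, r⟩ k).resolve_left fun h => hk h.1).2
    · exact ((hs.set₂ ⟨⟨S, a⟩, ha⟩ k).resolve_left fun h => hk h.1).2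
  · by_cases hR : E = d.R
    · subst hR
      have hk : k ≠ e := fun h => he (h ▸ rfl)
      exact ((hs.delete ⟨S, a⟩ k).resolve_left fun h => hk h.1).2
    · exact hs.other ⟨⟨E, S, a⟩, hE, hR⟩ k

theorem IsSuccessor.holdsAt_iff {M : A.ExtStr.{u}} {i : M.art d.PI} {e : M.art d.R}
    {y : ∀ c : d.CaseVar₂, M.base.carrier c.1.1} {α α' : State M}
    (hs : d.IsSuccessor i e y α α') {E : A.Art} {k : M.art E}
    (hi : (⟨E, k⟩ : Σ F, M.art F) ≠ ⟨d.PI, i⟩) (he : (⟨E, k⟩ : Σ F, M.art F) ≠ ⟨d.R, e⟩)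
    {φ : Formula A.sig (V := Unit) (fun _ => Sum.inr E)} (hφ : φ.IsQF) :
    α'.HoldsAt φ k ↔ α.HoldsAt φ k := by
  obtain ⟨χ, -, hχ⟩ := exists_reads.{u} hφ
  rw [hχ, hχ]
  exact iff_of_eq (congrArg (Formula.Realize M.base χ) (funext fun c => hs.comp_eq hi he c.2))

variable (d)

/-- At the updated indices `i` and `e`, a quantifier-free formula about the new state is a
basic formula in `r[e]` and `y₂`. -/
theorem exists_formula_at_update {E : A.Art}
    {φ : Formula A.sig (V := Unit) (fun _ => Sum.inr E)} (hφ : φ.IsQF) :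
    ∃ θ : Formula Sg.toSignature d.postSrt,
      ∀ (M : A.ExtStr.{u}) (i : M.art d.PI) (e : M.art d.R)
        (y : ∀ c : d.CaseVar₂, M.base.carrier c.1.1) (α α' : State M),
        d.IsSuccessor i e y α α' → ∀ k : M.art E,
        ((⟨E, k⟩ : Σ F, M.art F) = ⟨d.PI, i⟩ ∨ (⟨E, k⟩ : Σ F, M.art F) = ⟨d.R, e⟩) →
          (α'.HoldsAt φ k ↔ θ.Realize M.base (d.postVal α e y)) := by
  obtain ⟨χ, hχ, h⟩ := exists_reads.{u} hφ
  by_cases hE : E = d.PI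
  · subst hE
    have key : ∀ c : d.CaseVar, ∃ t : Term Sg.toSignature d.postSrt c.1,
        ∀ (M : A.ExtStr.{u}) (i : M.art d.PI) (e : M.art d.R)
          (y : ∀ c : d.CaseVar₂, M.base.carrier c.1.1) (α α' : State M),
          d.IsSuccessor i e y α α' → α'.comp c.2 i = t.eval M.base (d.postVal α e y) := by
      rintro ⟨S, a⟩
      by_cases ha : a ∈ Set.range (d.x₁ (S := S))
      · obtain ⟨r, rfl⟩ := ha
        exact ⟨Term.var (L := Sg.toSignature) (vs := d.postSrt) (.inl ⟨S, r⟩),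
          fun M i e y α α' hs => ((hs.set₁ ⟨S, r⟩ i).resolve_right fun h => h.1 rfl).2⟩
      · exact ⟨Term.var (L := Sg.toSignature) (vs := d.postSrt) (.inr ⟨⟨S, a⟩, ha⟩),
          fun M i e y α α' hs => ((hs.set₂ ⟨⟨S, a⟩, ha⟩ i).resolve_right fun h => h.1 rfl).2⟩
    choose σ hσ using key
    refine ⟨χ.map (SigHom.id _) σ, fun M i e y α α' hs k hk => ?_⟩
    have hk : k = i := by
      rcases hk with hk | hk
      · exact eq_of_heq (Sigma.mk.inj hk).2
      · exact absurd (Sigma.mk.inj hk).1.symm d.ne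
    subst hk
    rw [h]
    refine (iff_of_eq (congrArg (Formula.Realize M.base χ) ?_)).trans
      (hχ.realize_map (SigHom.id _) M.base σ _).symm
    exact funext fun c => hσ c M k e y α α' hs
  · by_cases hR : E = d.R
    · subst hR
      refine ⟨χ.map (SigHom.id _) (fun c => Term.cst (Sg.undef c.1)),
        fun M i e y α α' hs k hk => ?_⟩
      have hk : k = e := by
        rcases hk with hk | hk
        · exact absurd (Sigma.mk.inj hk).1 d.ne
        · exact eq_of_heq (Sigma.mk.inj hk).2
      subst hk
      rw [h]
      refine (iff_of_eq (congrArg (Formula.Realize M.base χ) ?_)).trans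
        (hχ.realize_map (SigHom.id _) M.base _ _).symm
      exact funext fun c => ((hs.delete c k).resolve_right fun h => h.1 rfl).2
    · refine ⟨.falsum, fun M i e y α α' hs k hk => ?_⟩
      rcases hk with hk | hk
      · exact absurd (Sigma.mk.inj hk).1 hE
      · exact absurd (Sigma.mk.inj hk).1 hR

/-- Extend a tuple of artifact sorts by the sorts of `i` (`true`) and `e` (`false`). -/
abbrev extSorts {B : Type} (E : B → A.Art) : B ⊕ Bool → A.Art :=
  Sum.elim E (fun c => bif c then d.PI else d.R)

/-- Extend a tuple by values of `i` and `e`. -/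
def extTuple {B : Type} {E : B → A.Art} {M : A.ExtStr.{u}} (w : ∀ b, M.art (E b))
    (i : M.art d.PI) (e : M.art d.R) : ∀ b, M.art (d.extSorts E b)
  | .inl b => w b
  | .inr true => i
  | .inr false => e

theorem exists_extTuple {B : Type} {E : B → A.Art} {M : A.ExtStr.{u}}
    {P : (∀ b, M.art (d.extSorts E b)) → Prop} :
    (∃ w, P w) ↔ ∃ (w : ∀ b, M.art (E b)) (i : M.art d.PI) (e : M.art d.R),
      P (d.extTuple w i e) := by
  constructor
  · rintro ⟨w, hw⟩
    refine ⟨fun b => w (.inl b), w (.inr true), w (.inr false), ?_⟩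
    convert hw using 1
    funext b
    rcases b with b | _ | _ <;> rfl
  · rintro ⟨w, i, e, h⟩
    exact ⟨_, h⟩

/-- The pattern of those `b` for which `e_b` is the updated index `i`, or `e`. -/
def IsPattern {B : Type} {E : B → A.Art} {M : A.ExtStr.{u}} (K : B × Bool → Prop)
    (w : ∀ b, M.art (E b)) (i : M.art d.PI) (e : M.art d.R) : Prop :=
  ∀ b, ((⟨E b, w b⟩ : Σ F, M.art F) = ⟨d.PI, i⟩ ↔ K (b, true)) ∧
    ((⟨E b, w b⟩ : Σ F, M.art F) = ⟨d.R, e⟩ ↔ K (b, false))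

/-- The contribution to the preimage of one pattern of equalities with `i` and `e`. The values
`y₂` are eliminated by quantifier elimination. -/
theorem exists_disjunct_of_pattern {T Tstar : Theory Sg.toSignature}
    (hT : IsModelCompletion.{u} T Tstar) {B : Type} [Finite B] {E : B → A.Art}
    {δ : List (Formula A.sig (A.scope E))} (hδ : ∀ l ∈ δ, IsArtLiteral l)
    {ψ : Formula Sg.toSignature A.varSort} (hψ : ψ.IsQF)
    {φ : ∀ b, Formula A.sig (V := Unit) (fun _ => Sum.inr (E b))} (hφ : ∀ b, (φ b).IsQF)
    (θ : B → Formula Sg.toSignature d.postSrt) (K : B × Bool → Prop) :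
    ∃ χ : A.StateFormula, IsStronglyLocalDisjunct χ ∧
      ∀ M : A.ExtStr.{u}, M.base.IsModel Tstar → ∀ α : State M,
        StateFormula.Holds χ M α ↔ ∃ (w : ∀ b, M.art (E b)) (i : M.art d.PI) (e : M.art d.R),
          (∀ l ∈ δ, α.HoldsOn l w) ∧ d.IsPattern K w i e ∧
          ψ.Realize M.base (fun v => α.var v) ∧
          d.π.Realize M.base (fun c => α.comp c.2 i) ∧
          (∃ y, d.ψ.Realize M.base (d.postVal α e y) ∧
            (∀ j : d.RComp, α.comp j.2 e ≠ M.base.cst (Sg.undef j.1)) ∧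
            ∀ b, K (b, true) ∨ K (b, false) → (θ b).Realize M.base (d.postVal α e y)) ∧
          ∀ b, ¬ (K (b, true) ∨ K (b, false)) → α.HoldsAt (φ b) (w b) := by
  classical
  have := Fintype.ofFinite B
  choose lit hlit hlit' using fun p : B × Bool =>
    exists_artLiteral.{u} (d.extSorts E) (.inl p.1) (.inr p.2) (K p)
  obtain ⟨ρ, hρ, hρ'⟩ := hT.quantifierElimination d.RComp (fun j => j.1)
    (.ex d.CaseVar₂ (fun c => c.1.1) (.and d.ψ (.and
      (.iConj fun j : d.RComp => .not (.eq
        (Term.var (L := Sg.toSignature) (vs := d.postSrt) (.inl j)) (.cst (Sg.undef j.1))))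
      (.iConj fun b => if K (b, true) ∨ K (b, false) then θ b else .not .falsum))))
  let φ₀ : ∀ b, Formula A.sig (V := Unit) (fun _ => Sum.inr (E b)) := fun b =>
    if K (b, true) ∨ K (b, false) then .not .falsum else φ b
  have hφ₀ : ∀ b, (φ₀ b).IsQF := fun b => by
    simp only [φ₀]
    split_ifs
    exacts [.not .falsum, hφ b]
  let φ' : ∀ b, Formula A.sig (V := Unit) (fun _ => Sum.inr (d.extSorts E b)) := fun b =>
    match b with
    | .inl b => φ₀ b
    | .inr true => ofReads d.π
    | .inr false => ofReads ρ
  have hφ' : ∀ b, (φ' b).IsQF := by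
    rintro (b | _ | _)
    · exact hφ₀ b
    · exact hρ.map _ _
    · exact d.π_qf.map _ _
  let δ' : List (Formula A.sig (A.scope (d.extSorts E))) :=
    δ.map (reindex (d.extSorts E) .inl) ++ Finset.univ.toList.map lit
  refine ⟨localDisjunct (d.extSorts E) δ' ψ φ', ⟨_, inferInstance, d.extSorts E, δ', ψ, φ', ?_,
    hψ, hφ', rfl⟩, fun M hM α => ?_⟩
  · intro l hl
    rcases List.mem_append.1 hl with hl | hl
    · obtain ⟨l₀, hl₀, rfl⟩ := List.mem_map.1 hl
      exact (hδ l₀ hl₀).reindex (E' := d.extSorts E) Sum.inl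
    · obtain ⟨p, -, rfl⟩ := List.mem_map.1 hl
      exact hlit p
  rw [holds_localDisjunct hψ hφ', exists_extTuple]
  refine exists_congr fun w => exists_congr fun i => exists_congr fun e => ?_
  have hδ' : (∀ l ∈ δ', α.HoldsOn l (d.extTuple w i e)) ↔
      (∀ l ∈ δ, α.HoldsOn l w) ∧ d.IsPattern K w i e := by
    refine List.forall_mem_append.trans (and_congr
      (List.forall_mem_map.trans (forall₂_congr fun l hl => ?_))
      (List.forall_mem_map.trans ?_))
    · exact holdsOn_reindex (E' := d.extSorts E) Sum.inl (hδ l hl).isQF α _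
    · simp only [Finset.mem_toList, Finset.mem_univ, true_imp_iff]
      refine (forall_congr' fun p => hlit' p M α (d.extTuple w i e)).trans ?_
      rw [Prod.forall]
      refine forall_congr' fun b => ?_
      rw [Bool.forall_bool]
      exact and_comm
  have hρ'' : ρ.Realize M.base (fun j : d.RComp => α.comp j.2 e) ↔
      ∃ y, d.ψ.Realize M.base (d.postVal α e y) ∧
        (∀ j : d.RComp, α.comp j.2 e ≠ M.base.cst (Sg.undef j.1)) ∧
        ∀ b, K (b, true) ∨ K (b, false) → (θ b).Realize M.base (d.postVal α e y) := by
    refine (hρ' M.base hM _).symm.trans (exists_congr fun y => and_congr Iff.rfl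
      (and_congr Formula.realize_iConj (Formula.realize_iConj.trans (forall_congr' fun b => ?_))))
    split_ifs with hb
    · exact ⟨fun h _ => h, fun h => h hb⟩
    · exact iff_of_true id fun h => absurd h hb
  have hall : (∀ b, α.HoldsAt (φ' b) (d.extTuple w i e b)) ↔
      d.π.Realize M.base (fun c => α.comp c.2 i) ∧
        ρ.Realize M.base (fun j : d.RComp => α.comp j.2 e) ∧
        ∀ b, ¬ (K (b, true) ∨ K (b, false)) → α.HoldsAt (φ b) (w b) := by
    rw [Sum.forall, Bool.forall_bool]
    have h₁ : α.HoldsAt (φ' (.inr true)) (d.extTuple w i e (.inr true)) ↔ _ :=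
      holdsAt_ofReads d.π_qf α i
    have h₂ : α.HoldsAt (φ' (.inr false)) (d.extTuple w i e (.inr false)) ↔ _ :=
      holdsAt_ofReads hρ α e
    have h₃ : ∀ b, α.HoldsAt (φ' (.inl b)) (d.extTuple w i e (.inl b)) ↔
        (¬ (K (b, true) ∨ K (b, false)) → α.HoldsAt (φ b) (w b)) := by
      intro b
      change α.HoldsAt (φ₀ b) (w b) ↔ _
      by_cases hb : K (b, true) ∨ K (b, false)
      · rw [show φ₀ b = .not .falsum from if_pos hb]
        exact iff_of_true id fun h => absurd hb h
      · rw [show φ₀ b = φ b from if_neg hb]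
        exact ⟨fun h _ => h, fun h => h hb⟩
    rw [h₁, h₂, forall_congr' h₃]
    tauto
  rw [hδ', hall, hρ'']
  tauto

/-- The preimage of a disjunct, expressed through the patterns of equalities with `i` and `e`. -/
theorem pre_localDisjunct {B : Type} [Finite B] {E : B → A.Art}
    {δ : List (Formula A.sig (A.scope E))} (hδ : ∀ l ∈ δ, IsArtLiteral l)
    {ψ : Formula Sg.toSignature A.varSort} (hψ : ψ.IsQF)
    {φ : ∀ b, Formula A.sig (V := Unit) (fun _ => Sum.inr (E b))} (hφ : ∀ b, (φ b).IsQF)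
    {θ : B → Formula Sg.toSignature d.postSrt}
    (hθ : ∀ (b : B) (M : A.ExtStr.{u}) (i : M.art d.PI) (e : M.art d.R)
        (y : ∀ c : d.CaseVar₂, M.base.carrier c.1.1) (α α' : State M),
        d.IsSuccessor i e y α α' → ∀ k : M.art (E b),
        ((⟨E b, k⟩ : Σ F, M.art F) = ⟨d.PI, i⟩ ∨ (⟨E b, k⟩ : Σ F, M.art F) = ⟨d.R, e⟩) →
          (α'.HoldsAt (φ b) k ↔ (θ b).Realize M.base (d.postVal α e y)))
    (M : A.ExtStr.{u}) (α : State M) :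
    Pre d.formula (localDisjunct E δ ψ φ) M α ↔
      ∃ (K : B × Bool → Prop) (w : ∀ b, M.art (E b)) (i : M.art d.PI) (e : M.art d.R),
        (∀ l ∈ δ, α.HoldsOn l w) ∧ d.IsPattern K w i e ∧
        ψ.Realize M.base (fun v => α.var v) ∧
        d.π.Realize M.base (fun c => α.comp c.2 i) ∧
        (∃ y, d.ψ.Realize M.base (d.postVal α e y) ∧
          (∀ j : d.RComp, α.comp j.2 e ≠ M.base.cst (Sg.undef j.1)) ∧
          ∀ b, K (b, true) ∨ K (b, false) → (θ b).Realize M.base (d.postVal α e y)) ∧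
        ∀ b, ¬ (K (b, true) ∨ K (b, false)) → α.HoldsAt (φ b) (w b) := by
  have hat : ∀ {y i e α'}, d.IsSuccessor i e y α α' → ∀ {K} {w : ∀ b, M.art (E b)},
      d.IsPattern K w i e → ∀ b,
      (K (b, true) ∨ K (b, false) →
        (α'.HoldsAt (φ b) (w b) ↔ (θ b).Realize M.base (d.postVal α e y))) ∧
      (¬ (K (b, true) ∨ K (b, false)) → (α'.HoldsAt (φ b) (w b) ↔ α.HoldsAt (φ b) (w b))) := by
    intro y i e α' hs K w hK b
    rw [← (hK b).1, ← (hK b).2]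
    exact ⟨hθ b M i e y α α' hs (w b), fun h => hs.holdsAt_iff (fun h' => h (.inl h'))
      (fun h' => h (.inr h')) (hφ b)⟩
  have hvar : ∀ {y i e α'}, d.IsSuccessor i e y α α' →
      (fun v => α'.var v) = fun v => α.var v := fun hs => funext hs.var
  constructor
  · rintro ⟨α', hτ, hα'⟩
    obtain ⟨y, i, e, hπ, hpost, hu, hs⟩ := (d.holds_formula α α').1 hτ
    obtain ⟨w, hwδ, hwψ, hwφ⟩ := (holds_localDisjunct hψ hφ M α').1 hα'
    let K : B × Bool → Prop := fun p => (⟨E p.1, w p.1⟩ : Σ F, M.art F) =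
      bif p.2 then ⟨d.PI, i⟩ else ⟨d.R, e⟩
    have hK : d.IsPattern K w i e := fun b => ⟨Iff.rfl, Iff.rfl⟩
    refine ⟨K, w, i, e, fun l hl => ((hδ l hl).holdsOn_iff α α' w).2 (hwδ l hl), hK,
      hvar hs ▸ hwψ, hπ, ⟨y, hpost, hu, fun b hb => ?_⟩, fun b hb => ?_⟩
    · exact ((hat hs hK b).1 hb).1 (hwφ b)
    · exact ((hat hs hK b).2 hb).1 (hwφ b)
  · rintro ⟨K, w, i, e, hwδ, hK, hwψ, hπ, ⟨y, hpost, hu, hhit⟩, hmiss⟩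
    obtain ⟨α', hs⟩ := d.exists_isSuccessor i e y α
    refine ⟨α', (d.holds_formula α α').2 ⟨y, i, e, hπ, hpost, hu, hs⟩,
      (holds_localDisjunct hψ hφ M α').2
        ⟨w, fun l hl => ((hδ l hl).holdsOn_iff α α' w).1 (hwδ l hl), (hvar hs).symm ▸ hwψ,
          fun b => ?_⟩⟩
    by_cases hb : K (b, true) ∨ K (b, false)
    · exact ((hat hs hK b).1 hb).2 (hhit b hb)
    · exact ((hat hs hK b).2 hb).2 (hmiss b hb)

end DeleteSet

theorem deleteSet_transition_strongly_local
    (D : DBSchema) (Tstar : Theory D.sig.toSignature)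
    (hT : IsModelCompletion.{u} D.theory Tstar)
    (A : ArtifactSetting D.sig.toSignature) (d : DeleteSet D.sig A) :
    ArtifactSetting.IsStronglyLocalTransition.{u} Tstar d.formula := by
  refine ArtifactSetting.isStronglyLocalTransition_of_disjuncts ?_
  rintro _ ⟨B, _, E, δ, ψ, φ, hδ, hψ, hφ, rfl⟩
  choose θ hθ using fun b => d.exists_formula_at_update.{u} (hφ b)
  choose χ hχ hχ' using fun K => d.exists_disjunct_of_pattern hT hδ hψ hφ θ K
  obtain ⟨χ', hχ'', h⟩ := ArtifactSetting.IsStronglyLocal.disj_map.{u} hχ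
  refine ⟨χ', hχ'', fun M hM α => ?_⟩
  rw [h]
  exact (d.pre_localDisjunct hδ hψ hφ hθ M α).trans
    (exists_congr fun K => (hχ' K M hM α).symm)
end

section
/- Let $\Sigma$ be a finite multi-sorted signature whose only symbols are equality, unary functions and constants, let $T$ be a set of universal $\Sigma$-sentences, and let $T^*$ be a model completion of $T$, that is, a $\Sigma$-theory that is stronger than $T$, in which every conjunction of literals satisfiable in a model of $T$ is still satisfiable, and that eliminates quantifiers. Add to $\Sigma$ finitely many new sorts (artifact sorts) and fix an artifact setting $(x,a)$: a finite tuple $x$ of individual variables of sorts of $\Sigma$ (artifact variables) and a finite tuple $a$ of unary function variables (artifact components), each from an artifact sort to a sort of $\Sigma$. A formula in $(x,a)$ is *strongly local* if it is a finite disjunction of formulae $\exists e_1\cdots\exists e_k\,\bigl(\delta(e_1,\dots,e_k)\wedge\psi(x)\wedge\bigwedge_{i=1}^k\varphi_i(e_i,a)\bigr)$, where the $e_i$ are variables of artifact sorts, $\delta$ is a conjunction of equalities and inequalities between the variables $e_1,\dots,e_k$, and $\psi$ and the $\varphi_i$ are quantifier-free. For a transition formula $\hat\tau(x,a,x',a')$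 put $\mathrm{Pre}(\hat\tau,\varphi):=\exists x'\,\exists a'\,(\hat\tau(x,a,x',a')\wedge\varphi(x',a'))$. The formula $\hat\tau$ is *strongly local* if for every strongly local $\varphi$ there is a strongly local formula that is equivalent to $\mathrm{Pre}(\hat\tau,\varphi)$ modulo $T^*$, i.e. in all structures for the extended signature whose reduct to $\Sigma$ is a model of $T^*$, under all assignments to $(x,a)$. Fix an artifact sort $R$ (an updated repository relation); let $r$ be the tuple of all artifact components with source $R$ and $s$ the tuple of the other ones. Let $\bar x$ be a subtuple of $x$ (the variables that are set), $y$ a tuple of fresh variables of the same sorts as $\bar x$, $x_1$ a tuple of artifact variables, possibly with repetitions, whose sorts are the target sorts of $r$, and $\pi(x,y)$ a quantifier-free formula (which therefore mentions no artifact component). For a quantifier-free constraint $\chi(r[e])$, with $e$ a variable of sort $R$, the *insert&set transition* is $$\exists y\,\exists e\,\bigl(\pi(x,y)\wedge\chi(r[e])\wedge \bar x':=y\wedge s':=s\wedge r':=\lambda j.\,(\text{if } j=e \text{ then } x_1 \text{ else } r[j])\bigr),$$ where the artifact variables outside $\bar x$ keep their values. Then every insert&set transition is strongly local. In particular, if $\Sigma$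 has a constant $\mathtt{undef}$ of every sort, this holds when $\chi(r[e])$ is $r[e]=\mathtt{undef}$, that is, the conjunction of $r_j[e]=\mathtt{undef}$ over all components $r_j$ of $r$. -/
universe u

namespace RAS

/-! ### Multi-sorted first-order logic -/

/-- A finite multi-sorted signature whose only symbols are equality, unary functions
(`f : dom f ⟶ cod f`) and constants. -/
structure Sig where
  Srt : Type
  Fn : Type
  Cst : Type
  dom : Fn → Srt
  cod : Fn → Srt
  sortOf : Cst → Srt
  finSrt : Finite Srt
  finFn : Finite Fn
  finCst : Finite Cst

/-- A finite tuple of sorted individual variables. -/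
structure Ctx (S : Sig) where
  V : Type
  sort : V → S.Srt
  fin : Finite V

namespace Ctx

variable {S : Sig}

/-- The empty tuple of variables. -/
abbrev empty : Ctx S := ⟨Empty, Empty.elim, inferInstance⟩

/-- A single variable of sort `s`. -/
abbrev single (s : S.Srt) : Ctx S := ⟨Unit, fun _ => s, inferInstance⟩

/-- Concatenation of two tuples of distinct variables. -/
abbrev append (G D : Ctx S) : Ctx S :=
  ⟨G.V ⊕ D.V,
    fun
      | Sum.inl v => G.sort v
      | Sum.inr v => D.sort v,
    haveI := G.fin
    haveI := D.fin
    inferInstance⟩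

end Ctx

/-- Well-sorted terms of a given sort, with free variables among `G`. -/
inductive Term (S : Sig) (G : Ctx S) : S.Srt → Type
  | var (v : G.V) : Term S G (G.sort v)
  | cst (c : S.Cst) : Term S G (S.sortOf c)
  | app (f : S.Fn) (t : Term S G (S.dom f)) : Term S G (S.cod f)

/-- Quantifier-free formulae with free variables among `G`. -/
inductive QF (S : Sig) (G : Ctx S) : Type
  | tru : QF S G
  | eq {s : S.Srt} (t t' : Term S G s) : QF S G
  | neg (p : QF S G) : QF S G
  | and (p q : QF S G) : QF S G
  | or (p q : QF S G) : QF S G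

/-- First-order formulae with free variables among `G`; quantifiers bind finite tuples of
variables. -/
inductive Formula (S : Sig) : Ctx S → Type 1
  | qf {G : Ctx S} (p : QF S G) : Formula S G
  | neg {G : Ctx S} (p : Formula S G) : Formula S G
  | and {G : Ctx S} (p q : Formula S G) : Formula S G
  | or {G : Ctx S} (p q : Formula S G) : Formula S G
  | all {G : Ctx S} (D : Ctx S) (p : Formula S (G.append D)) : Formula S G
  | ex {G : Ctx S} (D : Ctx S) (p : Formula S (G.append D)) : Formula S G

namespace Term

variable {S : Sig} {G D : Ctx S}

/-- The term is a variable. -/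
def IsVar : {s : S.Srt} → Term S G s → Prop
  | _, var _ => True
  | _, cst _ => False
  | _, app _ _ => False

/-- Transport of a term along an equality of sorts. -/
def cast {s s' : S.Srt} (h : s = s') (t : Term S G s) : Term S G s' := h ▸ t

/-- Substitution of terms for the variables. -/
def subst (σ : ∀ v : G.V, Term S D (G.sort v)) : {s : S.Srt} → Term S G s → Term S D s
  | _, var v => σ v
  | _, cst c => cst c
  | _, app f t => app f (t.subst σ)

/-- The variables of `G`, as terms over `G, D`. -/
def left (D : Ctx S) (v : G.V) : Term S (G.append D) (G.sort v) :=
  Term.var (G := G.append D) (Sum.inl v)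

/-- The variables of `D`, as terms over `G, D`. -/
def right (G : Ctx S) (v : D.V) : Term S (G.append D) (D.sort v) :=
  Term.var (G := G.append D) (Sum.inr v)

end Term

namespace QF

variable {S : Sig} {G D : Ctx S}

/-- Substitution of terms for the variables. -/
def subst (σ : ∀ v : G.V, Term S D (G.sort v)) : QF S G → QF S D
  | tru => tru
  | eq t t' => eq (t.subst σ) (t'.subst σ)
  | neg p => neg (p.subst σ)
  | and p q => and (p.subst σ) (q.subst σ)
  | or p q => or (p.subst σ) (q.subst σ)

/-- Conjunction of a finite family. -/
noncomputable def bigAnd {ι : Type} [Finite ι] (p : ι → QF S G) : QF S G :=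
  (List.ofFn fun i => p ((Finite.equivFin ι).symm i)).foldr and tru

/-- Atoms and negated atoms. -/
def IsLiteral : QF S G → Prop
  | eq _ _ => True
  | neg (eq _ _) => True
  | _ => False

/-- Constraints: conjunctions of literals. -/
def IsConstraint : QF S G → Prop
  | tru => True
  | and p q => p.IsConstraint ∧ q.IsConstraint
  | p => p.IsLiteral

/-- Equalities and inequalities between variables. -/
def IsVarLiteral : QF S G → Prop
  | eq t t' => t.IsVar ∧ t'.IsVar
  | neg (eq t t') => t.IsVar ∧ t'.IsVar
  | _ => False

/-- Conjunctions of equalities and inequalities between variables. -/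
def IsVarConj : QF S G → Prop
  | tru => True
  | and p q => p.IsVarConj ∧ q.IsVarConj
  | p => p.IsVarLiteral

end QF

/-- Finite disjunction of formulae (the empty one is false). -/
def Formula.disj {S : Sig} {G : Ctx S} (l : List (Formula S G)) : Formula S G :=
  l.foldr Formula.or (Formula.qf (QF.neg QF.tru))

/-- Structures: every sort is interpreted by a non-empty set. -/
structure Str (S : Sig) where
  carrier : S.Srt → Type u
  fn : ∀ f : S.Fn, carrier (S.dom f) → carrier (S.cod f)
  cst : ∀ c : S.Cst, carrier (S.sortOf c)
  nonempty : ∀ s, Nonempty (carrier s)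

/-- Values for the variables in `G`. -/
abbrev Val {S : Sig} (M : Str.{u} S) (G : Ctx S) : Type u := ∀ v : G.V, M.carrier (G.sort v)

/-- The valuation of the empty tuple of variables. -/
def Val.empty {S : Sig} (M : Str.{u} S) : Val M Ctx.empty := fun v => v.elim

/-- The valuation of a single variable. -/
def Val.single {S : Sig} {M : Str.{u} S} {s : S.Srt} (m : M.carrier s) : Val M (Ctx.single s) :=
  fun _ => m

/-- Concatenation of valuations. -/
def Val.append {S : Sig} {M : Str.{u} S} {G D : Ctx S} (ρ : Val M G) (η : Val M D) :
    Val M (G.append D)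
  | Sum.inl v => ρ v
  | Sum.inr v => η v

def Term.eval {S : Sig} {G : Ctx S} (M : Str.{u} S) (ρ : Val M G) :
    {s : S.Srt} → Term S G s → M.carrier s
  | _, var v => ρ v
  | _, cst c => M.cst c
  | _, app f t => M.fn f (t.eval M ρ)

def QF.Holds {S : Sig} {G : Ctx S} (M : Str.{u} S) (ρ : Val M G) : QF S G → Prop
  | tru => True
  | eq t t' => t.eval M ρ = t'.eval M ρ
  | neg p => ¬ p.Holds M ρ
  | and p q => p.Holds M ρ ∧ q.Holds M ρ
  | or p q => p.Holds M ρ ∨ q.Holds M ρ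

def Formula.Holds {S : Sig} (M : Str.{u} S) : {G : Ctx S} → Val M G → Formula S G → Prop
  | _, ρ, qf p => p.Holds M ρ
  | _, ρ, neg p => ¬ p.Holds M ρ
  | _, ρ, and p q => p.Holds M ρ ∧ q.Holds M ρ
  | _, ρ, or p q => p.Holds M ρ ∨ q.Holds M ρ
  | _, ρ, all D p => ∀ η : Val M D, p.Holds M (ρ.append η)
  | _, ρ, ex D p => ∃ η : Val M D, p.Holds M (ρ.append η)

/-- A theory is a set of sentences. -/
abbrev Theory (S : Sig) := Set (Formula S Ctx.empty)

/-- `M` is a model of `T`. -/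
def Str.Models {S : Sig} (M : Str.{u} S) (T : Theory S) : Prop :=
  ∀ p ∈ T, p.Holds M (Val.empty M)

/-- All sentences of `T` have the form `∀ z, φ(z)` with `φ` quantifier-free, that is, `T` is a DB
theory. -/
def Theory.IsUniversal {S : Sig} (T : Theory S) : Prop :=
  ∀ p ∈ T, ∃ (D : Ctx S) (q : QF S (Ctx.empty.append D)), p = Formula.all D (Formula.qf q)

/-- Satisfiability of a quantifier-free formula in a model of `T`. -/
def Theory.Sat {S : Sig} (T : Theory S) {G : Ctx S} (q : QF S G) : Prop :=
  ∃ (M : Str.{u} S) (ρ : Val M G), M.Models T ∧ q.Holds M ρ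

/-- `T` eliminates quantifiers: every formula is equivalent modulo `T` to a quantifier-free
formula in the same free variables. -/
def Theory.EliminatesQuantifiers {S : Sig} (T : Theory S) : Prop :=
  ∀ (G : Ctx S) (p : Formula S G), ∃ q : QF S G,
    ∀ M : Str.{u} S, M.Models T → ∀ ρ : Val M G, p.Holds M ρ ↔ q.Holds M ρ

/-- `Tstar` is a model completion of the universal theory `T`: a theory in the same signature that
is stronger than `T`, in which every constraint satisfiable in a model of `T` is still satisfiable,
and that eliminates quantifiers. -/
structure IsModelCompletion {S : Sig} (T Tstar : Theory S) : Prop where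
  stronger : ∀ M : Str.{u} S, M.Models Tstar → M.Models T
  conservative : ∀ (G : Ctx S) (q : QF S G), q.IsConstraint →
    Theory.Sat.{u} T q → Theory.Sat.{u} Tstar q
  qe : Theory.EliminatesQuantifiers.{u} Tstar

/-! ### Artifact settings, state formulae and transition formulae -/

/-- An artifact extension of the signature `S` by finitely many artifact sorts `ASort`, together
with an artifact setting over it: finitely many artifact variables `X`, of basic sorts, and
finitely many artifact components `Comp`, which are unary function variables from an artifact sort
to a basic sort. -/
structure ArtifactSetting (S : Sig) where
  ASort : Type
  X : Type
  Comp : Type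
  xsort : X → S.Srt
  src : Comp → ASort
  tgt : Comp → S.Srt
  finASort : Finite ASort
  finX : Finite X
  finComp : Finite Comp

namespace ArtifactSetting

variable {S : Sig} (A : ArtifactSetting S)

/-- The extended signature in which the formulae over the artifact setting are written: basic sorts
and artifact sorts, the symbols of `S`, and the artifact components as function symbols. No symbol
produces an element of an artifact sort, so the terms of artifact sort are exactly the variables
of that sort, and a formula without variables of artifact sort mentions no artifact component. -/
abbrev sig : Sig where
  Srt := S.Srt ⊕ A.ASort
  Fn := S.Fn ⊕ A.Comp
  Cst := S.Cst
  dom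
    | Sum.inl f => Sum.inl (S.dom f)
    | Sum.inr a => Sum.inr (A.src a)
  cod
    | Sum.inl f => Sum.inl (S.cod f)
    | Sum.inr a => Sum.inl (A.tgt a)
  sortOf c := Sum.inl (S.sortOf c)
  finSrt := haveI := S.finSrt; haveI := A.finASort; inferInstance
  finFn := haveI := S.finFn; haveI := A.finComp; inferInstance
  finCst := S.finCst

/-- A basic sort, as a sort of the extended signature. -/
abbrev basic (s : S.Srt) : A.sig.Srt := Sum.inl s

/-- An artifact sort, as a sort of the extended signature. -/
abbrev art (E : A.ASort) : A.sig.Srt := Sum.inr E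

/-- The tuple `x` of the artifact variables. -/
abbrev xCtx : Ctx A.sig := ⟨A.X, fun v => A.basic (A.xsort v), A.finX⟩

/-- The term `a[t]`. -/
def read {G : Ctx A.sig} (a : A.Comp) (t : Term A.sig G (A.art (A.src a))) :
    Term A.sig G (A.basic (A.tgt a)) :=
  Term.app (S := A.sig) (Sum.inr a) t

/-- A structure for the artifact extension of `S`: a structure for `S`, the reduct, and a non-empty
set for every artifact sort. -/
structure ExtStr where
  reduct : Str.{u} S
  entries : A.ASort → Type u
  nonempty : ∀ E, Nonempty (entries E)

variable {A}

/-- Assignments to the artifact variables and to the artifact components. -/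
structure Assign (M : ExtStr.{u} A) where
  x : ∀ v : A.X, M.reduct.carrier (A.xsort v)
  a : ∀ c : A.Comp, M.entries (A.src c) → M.reduct.carrier (A.tgt c)

/-- The structure for the extended signature given by `M` and by the values of the artifact
components. -/
abbrev Assign.str {M : ExtStr.{u} A} (α : Assign M) : Str.{u} A.sig where
  carrier
    | Sum.inl s => M.reduct.carrier s
    | Sum.inr E => M.entries E
  fn
    | Sum.inl f => M.reduct.fn f
    | Sum.inr c => α.a c
  cst c := M.reduct.cst c
  nonempty
    | Sum.inl s => M.reduct.nonempty s
    | Sum.inr E => M.nonempty E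

/-- The values of the artifact variables. -/
abbrev Assign.xVal {M : ExtStr.{u} A} (α : Assign M) : Val α.str A.xCtx := α.x

/-- Truth of a formula `φ(x, a)` under an assignment. -/
def Assign.Sat {M : ExtStr.{u} A} (α : Assign M) (p : Formula A.sig A.xCtx) : Prop :=
  p.Holds α.str α.xVal

variable (A)

/-- The data of a formula
`∃ e₁ … e_k, δ(e₁, …, e_k) ∧ ψ(x) ∧ φ₁(e₁, a) ∧ … ∧ φ_k(e_k, a)`. -/
structure SLBlock where
  k : ℕ
  esort : Fin k → A.ASort
  δ : QF A.sig ⟨Fin k, fun i => A.art (esort i), inferInstance⟩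
  isVarConj : δ.IsVarConj
  ψ : QF A.sig A.xCtx
  φ : ∀ i : Fin k, QF A.sig (Ctx.single (A.art (esort i)))

variable {A}

/-- The tuple `e₁, …, e_k`. -/
abbrev SLBlock.eCtx (B : SLBlock A) : Ctx A.sig :=
  ⟨Fin B.k, fun i => A.art (B.esort i), inferInstance⟩

noncomputable def SLBlock.toFormula (B : SLBlock A) : Formula A.sig A.xCtx :=
  Formula.ex B.eCtx <| Formula.qf <|
    QF.and (QF.subst (G := B.eCtx) (Term.right A.xCtx) B.δ) <|
    QF.and (B.ψ.subst (Term.left B.eCtx)) <|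
    QF.bigAnd fun i : Fin B.k => (B.φ i).subst fun _ => Term.right (D := B.eCtx) A.xCtx i

/-- Strongly local formulae. -/
def IsStronglyLocal (p : Formula A.sig A.xCtx) : Prop :=
  ∃ l : List (SLBlock A), p = Formula.disj (l.map SLBlock.toFormula)

end ArtifactSetting

/-- Case-defined functions, as nested if-then-else expressions over terms with quantifier-free
conditions. -/
inductive CaseTerm (S : Sig) (G : Ctx S) (s : S.Srt) : Type
  | term (t : Term S G s) : CaseTerm S G s
  | ite (κ : QF S G) (t : Term S G s) (rest : CaseTerm S G s) : CaseTerm S G s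

open Classical in
noncomputable def CaseTerm.eval {S : Sig} {G : Ctx S} {s : S.Srt} (M : Str.{u} S) (ρ : Val M G) :
    CaseTerm S G s → M.carrier s
  | term t => t.eval M ρ
  | ite κ t rest => if κ.Holds M ρ then t.eval M ρ else rest.eval M ρ

namespace ArtifactSetting

variable {S : Sig}

/-- Transition formulae
`∃ e, γ(e, x, a) ∧ ⋀ᵢ x'ᵢ = Fᵢ(e, x, a) ∧ ⋀ⱼ a'ⱼ = λ z. Gⱼ(z, e, x, a)`,
where the variables `e` are of basic and artifact sorts, `γ` is quantifier-free and the `Fᵢ`, `Gⱼ`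
are case-defined. -/
structure TransitionFormula (A : ArtifactSetting S) where
  e : Ctx A.sig
  γ : QF A.sig (A.xCtx.append e)
  F : ∀ v : A.X, CaseTerm A.sig (A.xCtx.append e) (A.basic (A.xsort v))
  G : ∀ c : A.Comp, CaseTerm A.sig ((A.xCtx.append e).append (Ctx.single (A.art (A.src c))))
    (A.basic (A.tgt c))

variable {A : ArtifactSetting S}

/-- Truth of `τ(x, a, x', a')`, where `α` gives the values of `x, a` and `α'` those of `x', a'`. -/
def TransitionFormula.Holds (τ : TransitionFormula A) {M : ExtStr.{u} A} (α α' : Assign M) :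
    Prop :=
  ∃ η : Val α.str τ.e,
    τ.γ.Holds α.str (α.xVal.append η) ∧
    (∀ v : A.X, α'.x v = (τ.F v).eval α.str (α.xVal.append η)) ∧
    ∀ (c : A.Comp) (z : M.entries (A.src c)),
      α'.a c z = (τ.G c).eval α.str ((α.xVal.append η).append
        (Val.single (M := α.str) (s := A.art (A.src c)) z))

/-- Truth of the preimage `∃ x' a', τ(x, a, x', a') ∧ φ(x', a')` under an assignment. -/
def Pre (τ : TransitionFormula A) (p : Formula A.sig A.xCtx) {M : ExtStr.{u} A} (α : Assign M) :
    Prop :=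
  ∃ α' : Assign M, τ.Holds α α' ∧ α'.Sat p

/-- The transition formula `τ` is strongly local: the preimage of every strongly local formula is
equivalent, in all structures for the artifact extension whose reduct is a model of `Tstar`, to a
strongly local formula. -/
def TransitionFormula.IsStronglyLocal (τ : TransitionFormula A) (Tstar : Theory S) : Prop :=
  ∀ p : Formula A.sig A.xCtx, ArtifactSetting.IsStronglyLocal p →
    ∃ q : Formula A.sig A.xCtx, ArtifactSetting.IsStronglyLocal q ∧
      ∀ M : ExtStr.{u} A, M.reduct.Models Tstar → ∀ α : Assign M, Pre τ p α ↔ α.Sat q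

/-! ### Insert&set transitions -/

/-- The tuple `y` of fresh data variables, one for every artifact variable in `upd`, of the same
sort. -/
abbrev yCtx (A : ArtifactSetting S) (upd : Set A.X) : Ctx A.sig :=
  ⟨upd, fun v => A.basic (A.xsort v), haveI := A.finX; inferInstance⟩

/-- The data of an insert&set update: the artifact sort `R` of the updated repository relation,
whose artifact components `r` are all those with source `R`; the artifact variables `upd` that are
set (the other ones, such as those that belong to other cases, keep their values); the
precondition `π(x, y)`, in which no variable of artifact sort and hence no artifact component
occurs; and the tuple `x₁` of the artifact variables whose values are inserted. -/
structure InsertSet (A : ArtifactSetting S) where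
  R : A.ASort
  upd : Set A.X
  π : QF A.sig (A.xCtx.append (A.yCtx upd))
  x₁ : ∀ c : A.Comp, A.src c = R → Term A.sig A.xCtx (A.basic (A.tgt c))
  x₁_isVar : ∀ (c : A.Comp) (h : A.src c = R), (x₁ c h).IsVar

namespace InsertSet

variable (I : InsertSet A)

/-- The quantified variables `y, e` of the transition, with `e` of sort `R`. -/
abbrev loc : Ctx A.sig := (A.yCtx I.upd).append (Ctx.single (A.art I.R))

/-- The artifact variables `x`, as terms over `x, y, e`. -/
def xTerm (v : A.X) : Term A.sig (A.xCtx.append I.loc) (A.basic (A.xsort v)) :=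
  Term.left (G := A.xCtx) I.loc v

/-- The variables `y`, as terms over `x, y, e`. -/
def yTerm (v : I.upd) : Term A.sig (A.xCtx.append I.loc) (A.basic (A.xsort v)) :=
  Term.right (D := I.loc) A.xCtx (Sum.inl v)

/-- The variables `x, y`, as terms over `x, y, e`. -/
def xyTerm : ∀ v : (A.xCtx.append (A.yCtx I.upd)).V,
    Term A.sig (A.xCtx.append I.loc) ((A.xCtx.append (A.yCtx I.upd)).sort v)
  | Sum.inl v => I.xTerm v
  | Sum.inr v => I.yTerm v

/-- The variable `e`, as a term over `x, y, e`. -/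
def eTerm : Term A.sig (A.xCtx.append I.loc) (A.art I.R) :=
  Term.right (D := I.loc) A.xCtx (Sum.inr ())

open Classical in
/-- The insert&set transition
`∃ y e, π(x, y) ∧ χ(r[e]) ∧ x' := y ∧ s' := s ∧ r' := λ j. if j = e then x₁ else r[j]`,
where `r` are the artifact components with source `R` and `s` the other ones. In `χ`, whose only
variable `e` is of sort `R`, only the components `r` can occur, and only as `r[e]`. -/
noncomputable def transition (χ : QF A.sig (Ctx.single (A.art I.R))) : TransitionFormula A where
  e := I.loc
  γ := QF.and
    (I.π.subst I.xyTerm)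
    (χ.subst fun _ => I.eTerm)
  F v := CaseTerm.term (if h : v ∈ I.upd then I.yTerm ⟨v, h⟩ else I.xTerm v)
  G c :=
    let j := Term.right (D := Ctx.single (A.art (A.src c))) (A.xCtx.append I.loc) ()
    if h : A.src c = I.R then
      CaseTerm.ite
        (QF.eq j ((I.eTerm.subst (Term.left _)).cast (congrArg A.art h.symm)))
        (((I.x₁ c h).subst I.xTerm).subst (Term.left _))
        (CaseTerm.term (A.read c j))
    else CaseTerm.term (A.read c j)

/-- The condition `r[e] = undef`, that is, the conjunction of `a[e] = undef` over all artifact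
components `a` with source `R`, where `undef s` is the constant of sort `s` for undefined values. -/
noncomputable def undefGuard (undef : S.Srt → S.Cst) (hundef : ∀ s, S.sortOf (undef s) = s) :
    QF A.sig (Ctx.single (A.art I.R)) :=
  haveI := A.finComp
  QF.bigAnd fun c : {c : A.Comp // A.src c = I.R} =>
    QF.eq
      (A.read c.1
        ((Term.var (G := Ctx.single (A.art I.R)) ()).cast (congrArg A.art c.2.symm)))
      ((Term.cst (S := A.sig) (undef (A.tgt c.1))).cast (congrArg A.basic (hundef (A.tgt c.1))))

end InsertSet

end ArtifactSetting

end RAS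

namespace RAS

/-! ### Semantics of casts, substitutions and finite conjunctions -/

namespace Term

variable {S : Sig} {G D : Ctx S}

theorem eval_subst (M : Str.{u} S) (σ : ∀ v : G.V, Term S D (G.sort v)) (ρ : Val M D)
    {s : S.Srt} (t : Term S G s) :
    (t.subst σ).eval M ρ = t.eval M (fun v => (σ v).eval M ρ) := by
  induction t with
  | var v => rfl
  | cst c => rfl
  | app f t ih => exact congrArg (M.fn f) ih

theorem isVar_cast {s s' : S.Srt} (h : s = s') {t : Term S G s} (ht : t.IsVar) :
    (t.cast h).IsVar := by
  subst h
  exact ht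

theorem isVar_subst {σ : ∀ v : G.V, Term S D (G.sort v)} (hσ : ∀ v, (σ v).IsVar) {s : S.Srt}
    {t : Term S G s} (ht : t.IsVar) : (t.subst σ).IsVar := by
  cases t with
  | var v => exact hσ v
  | cst c => exact ht.elim
  | app f t => exact ht.elim

end Term

namespace QF

variable {S : Sig} {G D : Ctx S}

theorem holds_subst (M : Str.{u} S) (σ : ∀ v : G.V, Term S D (G.sort v)) (ρ : Val M D)
    (p : QF S G) : (p.subst σ).Holds M ρ ↔ p.Holds M (fun v => (σ v).eval M ρ) := by
  induction p with
  | tru => exact Iff.rfl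
  | eq t t' =>
    simp only [QF.subst, QF.Holds, Term.eval_subst]
  | neg p ih => exact not_congr ih
  | and p q ihp ihq => exact and_congr ihp ihq
  | or p q ihp ihq => exact or_congr ihp ihq

theorem holds_bigAnd {ι : Type} [Finite ι] (M : Str.{u} S) (ρ : Val M G) (p : ι → QF S G) :
    (bigAnd p).Holds M ρ ↔ ∀ i, (p i).Holds M ρ := by
  have key : ∀ l : List (QF S G), (l.foldr and tru).Holds M ρ ↔ ∀ q ∈ l, q.Holds M ρ := by
    intro l
    induction l with
    | nil => simp [QF.Holds]
    | cons q l ih => simp [QF.Holds, ih]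
  rw [bigAnd, key]
  simp only [List.mem_ofFn, forall_exists_index, forall_apply_eq_imp_iff]
  exact (Finite.equivFin ι).symm.forall_congr_right (q := fun i => (p i).Holds M ρ)

theorem isVarConj_bigAnd {ι : Type} [Finite ι] {p : ι → QF S G} (hp : ∀ i, (p i).IsVarConj) :
    (bigAnd p).IsVarConj := by
  have key : ∀ l : List (QF S G), (∀ q ∈ l, q.IsVarConj) → (l.foldr and tru).IsVarConj := by
    intro l
    induction l with
    | nil => exact fun _ => trivial
    | cons q l ih =>
      exact fun h => ⟨h q List.mem_cons_self, ih fun q' hq' => h q' (List.mem_cons_of_mem _ hq')⟩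
  refine key _ fun q hq => ?_
  obtain ⟨i, rfl⟩ := List.mem_ofFn.1 hq
  exact hp _

theorem isVarConj_subst {σ : ∀ v : G.V, Term S D (G.sort v)} (hσ : ∀ v, (σ v).IsVar) {p : QF S G}
    (hp : p.IsVarConj) : (p.subst σ).IsVarConj := by
  induction p with
  | tru => trivial
  | eq t t' => exact ⟨Term.isVar_subst hσ hp.1, Term.isVar_subst hσ hp.2⟩
  | neg p ih =>
    cases p with
    | eq t t' => exact ⟨Term.isVar_subst hσ hp.1, Term.isVar_subst hσ hp.2⟩
    | _ => exact hp.elim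
  | and p q ihp ihq => exact ⟨ihp hp.1, ihq hp.2⟩
  | or p q _ _ => exact hp.elim

end QF

theorem Formula.holds_disj {S : Sig} {G : Ctx S} (M : Str.{u} S) (ρ : Val M G)
    (l : List (Formula S G)) : (Formula.disj l).Holds M ρ ↔ ∃ p ∈ l, p.Holds M ρ := by
  induction l with
  | nil => simp [Formula.disj, Formula.Holds, QF.Holds]
  | cons p l ih =>
    simp only [List.mem_cons, exists_eq_or_imp, ← ih]
    exact Iff.rfl

namespace ArtifactSetting

variable {S : Sig} {A : ArtifactSetting S}

/-! ### Embedding the basic signature into the extended one -/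

/-- A tuple of variables of basic sorts, in the extended signature. -/
abbrev embCtx (A : ArtifactSetting S) (D : Ctx S) : Ctx A.sig :=
  ⟨D.V, fun v => A.basic (D.sort v), D.fin⟩

/-- A term of the basic signature, as a term of the extended one. -/
def embTerm (A : ArtifactSetting S) {D : Ctx S} :
    {s : S.Srt} → Term S D s → Term A.sig (A.embCtx D) (A.basic s)
  | _, .var v => Term.var (G := A.embCtx D) v
  | _, .cst c => Term.cst (S := A.sig) c
  | _, .app f t => Term.app (S := A.sig) (Sum.inl f) (embTerm A t)

/-- A quantifier-free formula of the basic signature, as a formula of the extended one. -/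
def embQF (A : ArtifactSetting S) {D : Ctx S} : QF S D → QF A.sig (A.embCtx D)
  | .tru => .tru
  | .eq t t' => .eq (A.embTerm t) (A.embTerm t')
  | .neg p => .neg (embQF A p)
  | .and p q => .and (embQF A p) (embQF A q)
  | .or p q => .or (embQF A p) (embQF A q)

theorem eval_embTerm {M : ExtStr.{u} A} (α : Assign M) {D : Ctx S} (ρ : Val M.reduct D)
    {s : S.Srt} (t : Term S D s) :
    (A.embTerm t).eval α.str (ρ : Val α.str (A.embCtx D)) = t.eval M.reduct ρ := by
  induction t with
  | var v => rfl
  | cst c => rfl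
  | app f t ih => exact congrArg (M.reduct.fn f) ih

theorem holds_embQF {M : ExtStr.{u} A} (α : Assign M) {D : Ctx S} (ρ : Val M.reduct D)
    (p : QF S D) :
    (A.embQF p).Holds α.str (ρ : Val α.str (A.embCtx D)) ↔ p.Holds M.reduct ρ := by
  induction p with
  | tru => exact Iff.rfl
  | eq t t' =>
    exact iff_of_eq (congrArg₂ Eq (eval_embTerm α ρ t) (eval_embTerm α ρ t'))
  | neg p ih => exact not_congr ih
  | and p q ihp ihq => exact and_congr ihp ihq
  | or p q ihp ihq => exact or_congr ihp ihq

/-! ### Symbolic evaluation in the basic signature -/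

/-- Symbolic values over the variables `D`: a basic value is given by a term of the basic signature
and an entry of an artifact sort by a row of such terms, one for every component. -/
def SymVal (A : ArtifactSetting S) (D : Ctx S) : A.sig.Srt → Type
  | Sum.inl s => Term S D s
  | Sum.inr E => ∀ c : A.Comp, A.src c = E → Term S D (A.tgt c)

/-- Symbolic evaluation of a term of the extended signature. -/
def symTerm {G : Ctx A.sig} {D : Ctx S} (σ : ∀ v : G.V, A.SymVal D (G.sort v)) :
    {s : A.sig.Srt} → Term A.sig G s → A.SymVal D s
  | _, .var v => σ v
  | _, .cst c => Term.cst (S := S) c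
  | _, .app (Sum.inl f) t => Term.app (S := S) f (symTerm σ t)
  | _, .app (Sum.inr c) t => (symTerm σ t : A.SymVal D (Sum.inr (A.src c))) c rfl

/-- Symbolic version of an equation. Symbolic values are used only over tuples of variables for which
any two terms of the same artifact sort coincide, so equations of artifact sort are true. -/
def symEq {D : Ctx S} : {s : A.sig.Srt} → A.SymVal D s → A.SymVal D s → QF S D
  | Sum.inl _, t, t' => QF.eq t t'
  | Sum.inr _, _, _ => QF.tru

/-- Symbolic evaluation of a quantifier-free formula of the extended signature. -/
def symQF {G : Ctx A.sig} {D : Ctx S} (σ : ∀ v : G.V, A.SymVal D (G.sort v)) :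
    QF A.sig G → QF S D
  | .tru => .tru
  | .eq t t' => symEq (symTerm σ t) (symTerm σ t')
  | .neg p => .neg (symQF σ p)
  | .and p q => .and (symQF σ p) (symQF σ q)
  | .or p q => .or (symQF σ p) (symQF σ q)

/-- The symbolic value `b` represents the value `m`. -/
def Represents {M : ExtStr.{u} A} (α : Assign M) {D : Ctx S} (ρ : Val M.reduct D) :
    {s : A.sig.Srt} → A.SymVal D s → α.str.carrier s → Prop
  | Sum.inl _, b, m => Term.eval M.reduct ρ b = m
  | Sum.inr _, b, m => ∀ (c : A.Comp) (h : A.src c = _),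
      Term.eval M.reduct ρ (b c h) = α.a c (cast (congrArg M.entries h.symm) m)

theorem represents_symTerm {M : ExtStr.{u} A} (α : Assign M) {G : Ctx A.sig} {D : Ctx S}
    (ρ : Val M.reduct D) {σ : ∀ v : G.V, A.SymVal D (G.sort v)} {η : Val α.str G}
    (hσ : ∀ v, Represents α ρ (σ v) (η v)) {s : A.sig.Srt} (t : Term A.sig G s) :
    Represents α ρ (symTerm σ t) (t.eval α.str η) := by
  induction t with
  | var v => exact hσ v
  | cst c => rfl
  | app f t ih =>
    cases f with
    | inl f => exact congrArg (M.reduct.fn f) ih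
    | inr c => exact ih c rfl

/-- Any two terms of the same artifact sort over the variables `G` coincide. -/
def ArtTermsUnique (G : Ctx A.sig) : Prop :=
  ∀ E : A.ASort, ∀ t t' : Term A.sig G (A.art E), t = t'

theorem exists_var_of_art {G : Ctx A.sig} {E : A.ASort} (t : Term A.sig G (A.art E)) :
    ∃ (v : G.V) (h : G.sort v = A.art E), t = (Term.var v).cast h := by
  suffices H : ∀ {s : A.sig.Srt} (t : Term A.sig G s), s = A.art E →
      ∃ (v : G.V) (h : G.sort v = s), t = (Term.var v).cast h from H t rfl
  intro s t hs
  cases t with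
  | var v => exact ⟨v, rfl, rfl⟩
  | cst c => cases hs
  | app f t => cases f <;> cases hs

theorem artTermsUnique_of_basic {G : Ctx A.sig} (hG : ∀ v E, G.sort v ≠ A.art E) :
    ArtTermsUnique G := by
  intro E t _
  obtain ⟨v, h, -⟩ := exists_var_of_art t
  exact (hG v E h).elim

theorem artTermsUnique_single (s : A.sig.Srt) : ArtTermsUnique (Ctx.single s) := by
  intro E t t'
  obtain ⟨v, h, rfl⟩ := exists_var_of_art t
  obtain ⟨v', h', rfl⟩ := exists_var_of_art t'
  rfl

theorem holds_symQF {M : ExtStr.{u} A} (α : Assign M) {G : Ctx A.sig} (hG : ArtTermsUnique G)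
    {D : Ctx S} (ρ : Val M.reduct D) {σ : ∀ v : G.V, A.SymVal D (G.sort v)} {η : Val α.str G}
    (hσ : ∀ v, Represents α ρ (σ v) (η v)) (p : QF A.sig G) :
    (symQF σ p).Holds M.reduct ρ ↔ p.Holds α.str η := by
  induction p with
  | tru => exact Iff.rfl
  | @eq s t t' =>
    cases s with
    | inl s =>
      exact iff_of_eq (congrArg₂ Eq (represents_symTerm α ρ hσ t) (represents_symTerm α ρ hσ t'))
    | inr E => exact iff_of_true trivial (congrArg (Term.eval α.str η) (hG E t t'))
  | neg p ih => exact not_congr ih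
  | and p q ihp ihq => exact and_congr ihp ihq
  | or p q ihp ihq => exact or_congr ihp ihq

theorem eval_cast_art {M : ExtStr.{u} A} (α : Assign M) {G : Ctx A.sig} (η : Val α.str G)
    {E E' : A.ASort} (h : E = E') (t : Term A.sig G (A.art E)) :
    (t.cast (congrArg A.art h)).eval α.str η =
      cast (congrArg M.entries h) (t.eval α.str η : M.entries E) := by
  subst h
  rfl

/-! ### Dependence of truth on the artifact components -/

/-- Two assignments to the components agree on an element of a sort. -/
def AgreeAt {M : ExtStr.{u} A} (α β : Assign M) : (s : A.sig.Srt) → α.str.carrier s → Prop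
  | Sum.inl _, _ => True
  | Sum.inr _, m => ∀ (c : A.Comp) (h : A.src c = _),
      α.a c (cast (congrArg M.entries h.symm) m) = β.a c (cast (congrArg M.entries h.symm) m)

theorem eval_congr_of_agreeAt {M : ExtStr.{u} A} {α β : Assign M} {G : Ctx A.sig}
    {η : Val α.str G} (hη : ∀ v, AgreeAt α β _ (η v)) {s : A.sig.Srt} (t : Term A.sig G s) :
    AgreeAt α β s (t.eval α.str η) ∧ t.eval α.str η = t.eval β.str (η : Val β.str G) := by
  induction t with
  | var v => exact ⟨hη v, rfl⟩
  | cst c => exact ⟨trivial, rfl⟩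
  | app f t ih =>
    cases f with
    | inl f => exact ⟨trivial, congrArg (M.reduct.fn f) ih.2⟩
    | inr c => exact ⟨trivial, (ih.1 c rfl).trans (congrArg (β.a c) ih.2)⟩

theorem holds_congr_of_agreeAt {M : ExtStr.{u} A} {α β : Assign M} {G : Ctx A.sig}
    {η : Val α.str G} (hη : ∀ v, AgreeAt α β _ (η v)) (p : QF A.sig G) :
    p.Holds α.str η ↔ p.Holds β.str (η : Val β.str G) := by
  induction p with
  | tru => exact Iff.rfl
  | eq t t' =>
    exact iff_of_eq (congrArg₂ Eq (eval_congr_of_agreeAt hη t).2 (eval_congr_of_agreeAt hη t').2)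
  | neg p ih => exact not_congr ih
  | and p q ihp ihq => exact and_congr ihp ihq
  | or p q ihp ihq => exact or_congr ihp ihq

theorem eval_congr_of_isVar {M : ExtStr.{u} A} (α β : Assign M) {G : Ctx A.sig} (η : Val α.str G)
    {s : A.sig.Srt} {t : Term A.sig G s} (ht : t.IsVar) :
    t.eval α.str η = t.eval β.str (η : Val β.str G) := by
  cases t with
  | var v => rfl
  | cst c => exact ht.elim
  | app f t => exact ht.elim

theorem holds_congr_of_isVarConj {M : ExtStr.{u} A} (α β : Assign M) {G : Ctx A.sig}
    (η : Val α.str G) {p : QF A.sig G} (hp : p.IsVarConj) :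
    p.Holds α.str η ↔ p.Holds β.str (η : Val β.str G) := by
  have heq : ∀ {s} {t t' : Term A.sig G s}, t.IsVar → t'.IsVar →
      ((QF.eq t t').Holds α.str η ↔ (QF.eq t t').Holds β.str (η : Val β.str G)) := fun h h' =>
    iff_of_eq (congrArg₂ Eq (eval_congr_of_isVar α β η h) (eval_congr_of_isVar α β η h'))
  induction p with
  | tru => exact Iff.rfl
  | eq t t' => exact heq hp.1 hp.2
  | neg p ih =>
    cases p with
    | eq t t' => exact not_congr (heq hp.1 hp.2)
    | _ => exact hp.elim
  | and p q ihp ihq => exact and_congr (ihp hp.1) (ihq hp.2)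
  | or p q _ _ => exact hp.elim

/-! ### Truth of strongly local formulae -/

theorem SLBlock.sat_toFormula {M : ExtStr.{u} A} (α : Assign M) (B : SLBlock A) :
    α.Sat B.toFormula ↔ ∃ η : ∀ i, M.entries (B.esort i),
      B.δ.Holds α.str (η : Val α.str B.eCtx) ∧ B.ψ.Holds α.str α.xVal ∧
      ∀ i, (B.φ i).Holds α.str (Val.single (M := α.str) (s := A.art (B.esort i)) (η i)) := by
  refine exists_congr fun η => ?_
  refine and_congr (QF.holds_subst ..) (and_congr (QF.holds_subst ..) ?_)
  refine (QF.holds_bigAnd ..).trans (forall_congr' fun i => QF.holds_subst ..)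

/-! ### Insert&set transitions -/

namespace InsertSet

variable (I : InsertSet A)

open Classical in
/-- The assignment reached by setting the variables to `y` and inserting at the entry `e`. -/
noncomputable def update {M : ExtStr.{u} A} (α : Assign M)
    (y : ∀ v : I.upd, M.reduct.carrier (A.xsort v)) (e : M.entries I.R) : Assign M where
  x v := if h : v ∈ I.upd then y ⟨v, h⟩ else α.x v
  a c z := if h : A.src c = I.R then
      if z = cast (congrArg M.entries h.symm) e then (I.x₁ c h).eval α.str α.xVal else α.a c z
    else α.a c z

theorem eval_transition_F (χ : QF A.sig (Ctx.single (A.art I.R))) {M : ExtStr.{u} A}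
    (α : Assign M) (y : ∀ v : I.upd, M.reduct.carrier (A.xsort v)) (e : M.entries I.R) (v : A.X) :
    ((I.transition χ).F v).eval α.str (α.xVal.append
      (Val.append (M := α.str) (G := A.yCtx I.upd) y
        (Val.single (M := α.str) (s := A.art I.R) e))) = (I.update α y e).x v := by
  by_cases h : v ∈ I.upd
  · simp only [transition, update, dif_pos h]
    rfl
  · simp only [transition, update, dif_neg h]
    rfl

theorem eval_transition_G (χ : QF A.sig (Ctx.single (A.art I.R))) {M : ExtStr.{u} A}
    (α : Assign M) (y : ∀ v : I.upd, M.reduct.carrier (A.xsort v)) (e : M.entries I.R)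
    (c : A.Comp) (z : M.entries (A.src c)) :
    ((I.transition χ).G c).eval α.str ((α.xVal.append
      (Val.append (M := α.str) (G := A.yCtx I.upd) y
        (Val.single (M := α.str) (s := A.art I.R) e))).append
        (Val.single (M := α.str) (s := A.art (A.src c)) z)) = (I.update α y e).a c z := by
  by_cases h : A.src c = I.R
  · simp only [transition, update, dif_pos h, CaseTerm.eval, QF.Holds]
    refine @if_congr _ _ _ (_) (_) _ _ _ _
      (iff_of_eq (congrArg (z = ·) (eval_cast_art _ _ h.symm _))) ?_ rfl
    exact (Term.eval_subst ..).trans (Term.eval_subst ..)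
  · simp only [transition, update, dif_neg h]
    rfl

theorem transition_holds_iff (χ : QF A.sig (Ctx.single (A.art I.R))) {M : ExtStr.{u} A}
    (α α' : Assign M) :
    (I.transition χ).Holds α α' ↔
      ∃ (y : ∀ v : I.upd, M.reduct.carrier (A.xsort v)) (e : M.entries I.R),
        I.π.Holds α.str (α.xVal.append (y : Val α.str (A.yCtx I.upd))) ∧
        χ.Holds α.str (Val.single (M := α.str) (s := A.art I.R) e) ∧ α' = I.update α y e := by
  have hγ : ∀ (y : ∀ v : I.upd, M.reduct.carrier (A.xsort v)) (e : M.entries I.R),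
      (I.transition χ).γ.Holds α.str (α.xVal.append
        (Val.append (M := α.str) (G := A.yCtx I.upd) y
          (Val.single (M := α.str) (s := A.art I.R) e))) ↔
      I.π.Holds α.str (α.xVal.append (y : Val α.str (A.yCtx I.upd))) ∧
        χ.Holds α.str (Val.single (M := α.str) (s := A.art I.R) e) := by
    intro y e
    refine and_congr ((QF.holds_subst ..).trans (iff_of_eq (congrArg (I.π.Holds α.str) ?_)))
      (QF.holds_subst ..)
    funext v
    cases v <;> rfl
  constructor
  · rintro ⟨η, hg, hF, hG⟩
    have hη : η = Val.append (M := α.str) (G := A.yCtx I.upd) (fun v => η (Sum.inl v))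
        (Val.single (M := α.str) (s := A.art I.R) (η (Sum.inr ()))) := by
      funext v
      cases v <;> rfl
    rw [hη] at hg hF hG
    obtain ⟨hπ, hχ⟩ := (hγ _ _).1 hg
    refine ⟨_, _, hπ, hχ, ?_⟩
    cases α' with
    | mk x a =>
      congr 1
      · exact funext fun v => (hF v).trans (I.eval_transition_F χ α _ _ v)
      · exact funext fun c => funext fun z => (hG c z).trans (I.eval_transition_G χ α _ _ c z)
  · rintro ⟨y, e, hπ, hχ, rfl⟩
    exact ⟨_, (hγ y e).2 ⟨hπ, hχ⟩, fun v => (I.eval_transition_F χ α y e v).symm,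
      fun c z => (I.eval_transition_G χ α y e c z).symm⟩

/-- The artifact variables, as variables of the basic signature. -/
abbrev baseCtx (A : ArtifactSetting S) : Ctx S := ⟨A.X, A.xsort, A.finX⟩

/-- The variables `y`, as variables of the basic signature. -/
abbrev baseSetCtx : Ctx S := ⟨I.upd, fun v => A.xsort v, haveI := A.finX; inferInstance⟩

open Classical in
/-- The values of the artifact variables after the update, as terms over `x, y`. -/
noncomputable def setTerm (v : A.X) : Term S ((baseCtx A).append I.baseSetCtx) (A.xsort v) :=
  if h : v ∈ I.upd then Term.right (D := I.baseSetCtx) (baseCtx A) ⟨v, h⟩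
  else Term.left (G := baseCtx A) I.baseSetCtx v

theorem eval_setTerm {M : ExtStr.{u} A} (α : Assign M)
    (y : ∀ v : I.upd, M.reduct.carrier (A.xsort v)) (e : M.entries I.R) (v : A.X) :
    (I.setTerm v).eval M.reduct (Val.append (G := baseCtx A) (D := I.baseSetCtx) α.x y) =
      (I.update α y e).x v := by
  by_cases h : v ∈ I.upd
  · simp only [setTerm, update, dif_pos h]
    rfl
  · simp only [setTerm, update, dif_neg h]
    rfl

/-- The formula `∃ y, π(x, y) ∧ ψ(x')` of the basic signature, where `x'` are the values of the
artifact variables after the update. -/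
noncomputable def setFormula (ψ : QF A.sig A.xCtx) : Formula S (baseCtx A) :=
  Formula.ex I.baseSetCtx <| Formula.qf <| QF.and
    (symQF (G := A.xCtx.append (A.yCtx I.upd))
      (fun
        | Sum.inl v => Term.left (G := baseCtx A) I.baseSetCtx v
        | Sum.inr v => Term.right (D := I.baseSetCtx) (baseCtx A) v) I.π)
    (symQF (G := A.xCtx) I.setTerm ψ)

theorem artTermsUnique_xCtx : ArtTermsUnique A.xCtx :=
  artTermsUnique_of_basic fun _ _ h => by cases h

theorem holds_setFormula (ψ : QF A.sig A.xCtx) {M : ExtStr.{u} A} (α : Assign M)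
    (e : M.entries I.R) :
    (I.setFormula ψ).Holds M.reduct α.x ↔
      ∃ y : ∀ v : I.upd, M.reduct.carrier (A.xsort v),
        I.π.Holds α.str (α.xVal.append (y : Val α.str (A.yCtx I.upd))) ∧
        ψ.Holds (I.update α y e).str (I.update α y e).xVal := by
  refine exists_congr fun y => and_congr (holds_symQF α ?_ _ ?_ _)
    (holds_symQF (I.update α y e) artTermsUnique_xCtx _ ?_ _)
  · exact artTermsUnique_of_basic fun v _ h => by cases v <;> cases h
  · intro v
    cases v <;> rfl
  · exact I.eval_setTerm α y e

/-- The inserted row, as a symbolic value. -/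
def insertedRow {E : A.ASort} (hE : E = I.R) : A.SymVal (baseCtx A) (A.art E) :=
  fun c h => symTerm (A := A) (G := A.xCtx) (D := baseCtx A) (fun v => Term.var (G := baseCtx A) v)
    (I.x₁ c (h.trans hE))

theorem represents_insertedRow {M : ExtStr.{u} A} (α : Assign M)
    (y : ∀ v : I.upd, M.reduct.carrier (A.xsort v)) (e : M.entries I.R) {E : A.ASort}
    (hE : E = I.R) :
    Represents (s := A.art E) (I.update α y e) (D := baseCtx A) α.x (I.insertedRow hE)
      (cast (congrArg M.entries hE.symm) e) := by
  subst hE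
  intro c h
  have := represents_symTerm α (G := A.xCtx) (D := baseCtx A) α.x
    (σ := fun v => Term.var (G := baseCtx A) v) (η := α.xVal) (fun _ => rfl) (I.x₁ c h)
  refine Eq.trans this ?_
  simp only [update, dif_pos h]
  exact (if_pos rfl).symm

/-- The formula `φ(e, a')` for the inserted entry `e`, as a condition on the artifact variables. -/
def insertedQF {E : A.ASort} (hE : E = I.R) (φ : QF A.sig (Ctx.single (A.art E))) :
    QF A.sig A.xCtx :=
  A.embQF (symQF (D := baseCtx A) (fun _ => I.insertedRow hE) φ)

theorem holds_insertedQF {M : ExtStr.{u} A} (α : Assign M)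
    (y : ∀ v : I.upd, M.reduct.carrier (A.xsort v)) (e : M.entries I.R) {E : A.ASort}
    (hE : E = I.R) (φ : QF A.sig (Ctx.single (A.art E))) :
    (I.insertedQF hE φ).Holds α.str α.xVal ↔
      φ.Holds (I.update α y e).str (Val.single (M := (I.update α y e).str) (s := A.art E)
        (cast (congrArg M.entries hE.symm) e)) :=
  (holds_embQF α (D := baseCtx A) α.x _).trans
    (holds_symQF (I.update α y e) (artTermsUnique_single _) _
      (fun _ => I.represents_insertedRow α y e hE) φ)

theorem holds_update_of_ne {M : ExtStr.{u} A} (α : Assign M)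
    (y : ∀ v : I.upd, M.reduct.carrier (A.xsort v)) (e : M.entries I.R) {E : A.ASort}
    (m : M.entries E) (hm : ∀ hE : E = I.R, m ≠ cast (congrArg M.entries hE.symm) e)
    (φ : QF A.sig (Ctx.single (A.art E))) :
    φ.Holds α.str (Val.single (M := α.str) (s := A.art E) m) ↔
      φ.Holds (I.update α y e).str
        (Val.single (M := (I.update α y e).str) (s := A.art E) m) := by
  refine holds_congr_of_agreeAt (fun _ => ?_) φ
  intro c h
  subst h
  change α.a c m = (I.update α y e).a c m
  by_cases h : A.src c = I.R
  · simp only [update, dif_pos h]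
    exact (if_neg (hm h)).symm
  · simp only [update, dif_neg h]

/-! ### The preimage of a strongly local formula -/

/-- The indices of the quantified entries of sort `R`. -/
abbrev Cand (B : SLBlock A) : Type := {i : Fin B.k // B.esort i = I.R}

/-- The sorts of the entries `e, e₁, …, e_k`. -/
abbrev preSort (B : SLBlock A) : Fin (B.k + 1) → A.ASort := Fin.cons I.R B.esort

/-- The entries `e, e₁, …, e_k`. -/
abbrev preCtx (B : SLBlock A) : Ctx A.sig :=
  ⟨Fin (B.k + 1), fun i => A.art (I.preSort B i), inferInstance⟩

/-- The equation between a quantified entry of sort `R` and the inserted entry `e`. -/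
def entryEq (B : SLBlock A) (j : I.Cand B) : QF A.sig (I.preCtx B) :=
  QF.eq (s := A.art (B.esort j.1)) (Term.var (G := I.preCtx B) j.1.succ)
    ((Term.var (G := I.preCtx B) 0).cast (congrArg A.art j.2.symm))

open Classical in
/-- The disjunct of the preimage in which the quantified entries that coincide with the inserted
entry are those in `P`, given a quantifier-free equivalent `θ` of `∃ y, π(x, y) ∧ ψ(x')`. -/
noncomputable def preBlock (χ : QF A.sig (Ctx.single (A.art I.R))) (B : SLBlock A)
    (θ : QF S (baseCtx A)) (P : Set (I.Cand B)) : SLBlock A where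
  k := B.k + 1
  esort := I.preSort B
  δ := QF.and
    (B.δ.subst (D := I.preCtx B) fun i => Term.var (G := I.preCtx B) (Fin.succ i))
    (QF.bigAnd fun j : I.Cand B =>
      if j ∈ P then I.entryEq B j else QF.neg (I.entryEq B j))
  isVarConj := by
    refine ⟨QF.isVarConj_subst (fun i => ?_) B.isVarConj, QF.isVarConj_bigAnd fun j => ?_⟩
    · exact trivial
    split_ifs
    · exact ⟨trivial, Term.isVar_cast _ trivial⟩
    · exact ⟨trivial, Term.isVar_cast _ trivial⟩
  ψ := QF.and (A.embQF θ) (QF.bigAnd fun j : P => I.insertedQF j.1.2 (B.φ j.1.1))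
  φ := Fin.cases χ fun i => if ∃ h : B.esort i = I.R, ⟨i, h⟩ ∈ P then QF.tru else B.φ i

theorem holds_entryEq (B : SLBlock A) (j : I.Cand B) {M : ExtStr.{u} A} (α : Assign M)
    (η : ∀ i, M.entries (I.preSort B i)) :
    (I.entryEq B j).Holds α.str (η : Val α.str (I.preCtx B)) ↔
      (η j.1.succ : M.entries (B.esort j.1)) =
        cast (congrArg M.entries j.2.symm) (η 0 : M.entries I.R) :=
  iff_of_eq (congrArg _ (eval_cast_art α _ j.2.symm (Term.var (G := I.preCtx B) 0)))

theorem sat_preBlock (χ : QF A.sig (Ctx.single (A.art I.R))) (B : SLBlock A)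
    (θ : QF S (baseCtx A)) (P : Set (I.Cand B)) {M : ExtStr.{u} A} (α : Assign M) :
    α.Sat (I.preBlock χ B θ P).toFormula ↔
      ∃ (e : M.entries I.R) (η : ∀ i, M.entries (B.esort i)),
        B.δ.Holds α.str (η : Val α.str B.eCtx) ∧
        (∀ j : I.Cand B, j ∈ P ↔ η j.1 = cast (congrArg M.entries j.2.symm) e) ∧
        θ.Holds M.reduct α.x ∧
        (∀ j ∈ P, (I.insertedQF j.2 (B.φ j.1)).Holds α.str α.xVal) ∧
        χ.Holds α.str (Val.single (M := α.str) (s := A.art I.R) e) ∧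
        ∀ i, (¬ ∃ h : B.esort i = I.R, ⟨i, h⟩ ∈ P) →
          (B.φ i).Holds α.str (Val.single (M := α.str) (s := A.art (B.esort i)) (η i)) := by
  have hsplit : ∀ η : ∀ i, M.entries (I.preSort B i),
      ((I.preBlock χ B θ P).δ.Holds α.str (η : Val α.str (I.preCtx B)) ∧
        (I.preBlock χ B θ P).ψ.Holds α.str α.xVal ∧
        ∀ i, ((I.preBlock χ B θ P).φ i).Holds α.str
          (Val.single (M := α.str) (s := A.art (I.preSort B i)) (η i))) ↔
      B.δ.Holds α.str (fun i => η (Fin.succ i) : Val α.str B.eCtx) ∧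
        (∀ j : I.Cand B, j ∈ P ↔ (η j.1.succ : M.entries (B.esort j.1)) =
          cast (congrArg M.entries j.2.symm) (η 0 : M.entries I.R)) ∧
        θ.Holds M.reduct α.x ∧
        (∀ j ∈ P, (I.insertedQF j.2 (B.φ j.1)).Holds α.str α.xVal) ∧
        χ.Holds α.str (Val.single (M := α.str) (s := A.art I.R) (η 0)) ∧
        ∀ i, (¬ ∃ h : B.esort i = I.R, ⟨i, h⟩ ∈ P) →
          (B.φ i).Holds α.str
            (Val.single (M := α.str) (s := A.art (B.esort i)) (η (Fin.succ i))) := by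
    intro η
    have hδ : (I.preBlock χ B θ P).δ.Holds α.str (η : Val α.str (I.preCtx B)) ↔
        B.δ.Holds α.str (fun i => η (Fin.succ i) : Val α.str B.eCtx) ∧
        (∀ j : I.Cand B, j ∈ P ↔ (η j.1.succ : M.entries (B.esort j.1)) =
          cast (congrArg M.entries j.2.symm) (η 0 : M.entries I.R)) := by
      refine and_congr (QF.holds_subst ..)
        ((QF.holds_bigAnd ..).trans (forall_congr' fun j => ?_))
      rw [← I.holds_entryEq B j α η]
      by_cases hj : j ∈ P
      · rw [if_pos hj, iff_true_left hj]
        exact Iff.rfl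
      · rw [if_neg hj, iff_false_left hj]
        exact Iff.rfl
    have hψ : (I.preBlock χ B θ P).ψ.Holds α.str α.xVal ↔
        θ.Holds M.reduct α.x ∧
        (∀ j ∈ P, (I.insertedQF j.2 (B.φ j.1)).Holds α.str α.xVal) := by
      refine and_congr (holds_embQF α (D := baseCtx A) α.x θ)
        ((QF.holds_bigAnd ..).trans Subtype.forall)
    have hφ : (∀ i, ((I.preBlock χ B θ P).φ i).Holds α.str
          (Val.single (M := α.str) (s := A.art (I.preSort B i)) (η i))) ↔
        χ.Holds α.str (Val.single (M := α.str) (s := A.art I.R) (η 0)) ∧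
        ∀ i, (¬ ∃ h : B.esort i = I.R, ⟨i, h⟩ ∈ P) →
          (B.φ i).Holds α.str
            (Val.single (M := α.str) (s := A.art (B.esort i)) (η (Fin.succ i))) := by
      refine Fin.forall_fin_succ.trans (and_congr Iff.rfl (forall_congr' fun i => ?_))
      by_cases hi : ∃ h : B.esort i = I.R, ⟨i, h⟩ ∈ P
      · have h : (I.preBlock χ B θ P).φ i.succ = QF.tru := if_pos hi
        rw [h]
        exact iff_of_true trivial fun h => (h hi).elim
      · have h : (I.preBlock χ B θ P).φ i.succ = B.φ i := if_neg hi
        rw [h]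
        exact ⟨fun h _ => h, fun h => h hi⟩
    rw [hδ, hψ, hφ]
    tauto
  rw [SLBlock.sat_toFormula]
  constructor
  · rintro ⟨η, h⟩
    exact ⟨_, _, (hsplit η).1 h⟩
  · rintro ⟨e, η, h⟩
    exact ⟨_, (hsplit (Fin.cases (motive := fun i => M.entries (I.preSort B i)) e η)).2 h⟩

theorem pre_toFormula_iff (χ : QF A.sig (Ctx.single (A.art I.R))) (B : SLBlock A)
    (θ : QF S (baseCtx A)) {M : ExtStr.{u} A} (α : Assign M)
    (hθ : (I.setFormula B.ψ).Holds M.reduct α.x ↔ θ.Holds M.reduct α.x) :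
    Pre (I.transition χ) B.toFormula α ↔
      ∃ P : Set (I.Cand B), α.Sat (I.preBlock χ B θ P).toFormula := by
  constructor
  · rintro ⟨α', hτ, hB⟩
    obtain ⟨y, e, hπ, hχ, rfl⟩ := (I.transition_holds_iff χ α α').1 hτ
    obtain ⟨η, hδ, hψ, hφ⟩ := (SLBlock.sat_toFormula _ B).1 hB
    refine ⟨{j | η j.1 = cast (congrArg M.entries j.2.symm) e}, (I.sat_preBlock ..).2
      ⟨e, η, (holds_congr_of_isVarConj _ α _ B.isVarConj).1 hδ, fun _ => Iff.rfl,
        hθ.1 ((I.holds_setFormula B.ψ α e).2 ⟨y, hπ, hψ⟩), fun j hj => ?_, hχ, fun i hi => ?_⟩⟩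
    · rw [I.holds_insertedQF α y e, ← hj]
      exact hφ j.1
    · exact (I.holds_update_of_ne α y e (η i) (fun hE h => hi ⟨hE, h⟩) _).2 (hφ i)
  · rintro ⟨P, hP⟩
    obtain ⟨e, η, hδ, hjP, hθ', hins, hχ, hφ⟩ := (I.sat_preBlock ..).1 hP
    obtain ⟨y, hπ, hψ⟩ := (I.holds_setFormula B.ψ α e).1 (hθ.2 hθ')
    refine ⟨I.update α y e, (I.transition_holds_iff χ α _).2 ⟨y, e, hπ, hχ, rfl⟩,
      (SLBlock.sat_toFormula _ B).2
        ⟨η, (holds_congr_of_isVarConj α _ _ B.isVarConj).1 hδ, hψ, fun i => ?_⟩⟩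
    by_cases hi : ∃ h : B.esort i = I.R, ⟨i, h⟩ ∈ P
    · obtain ⟨hE, hi⟩ := hi
      have := (I.holds_insertedQF α y e hE (B.φ i)).1 (hins _ hi)
      rwa [← (hjP ⟨i, hE⟩).1 hi] at this
    · exact (I.holds_update_of_ne α y e (η i)
        (fun hE h => hi ⟨hE, (hjP ⟨i, hE⟩).2 h⟩) _).1 (hφ i hi)

theorem transition_isStronglyLocal {Tstar : Theory S}
    (hqe : Theory.EliminatesQuantifiers.{u} Tstar) (χ : QF A.sig (Ctx.single (A.art I.R))) :
    TransitionFormula.IsStronglyLocal.{u} (I.transition χ) Tstar := by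
  rintro _ ⟨l, rfl⟩
  choose θ hθ using fun B : SLBlock A => hqe _ (I.setFormula B.ψ)
  have hfin : ∀ B : SLBlock A, (Set.univ : Set (Set (I.Cand B))).Finite := fun B => Set.toFinite _
  refine ⟨_, ⟨l.flatMap fun B => (hfin B).toFinset.toList.map (I.preBlock χ B (θ B)), rfl⟩,
    fun M hM α => ?_⟩
  have hpre : Pre (I.transition χ) (Formula.disj (l.map SLBlock.toFormula)) α ↔
      ∃ B ∈ l, Pre (I.transition χ) B.toFormula α := by
    constructor
    · rintro ⟨α', hτ, h⟩
      obtain ⟨_, hp, h⟩ := (Formula.holds_disj ..).1 h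
      obtain ⟨B, hB, rfl⟩ := List.mem_map.1 hp
      exact ⟨B, hB, α', hτ, h⟩
    · rintro ⟨B, hB, α', hτ, h⟩
      exact ⟨α', hτ, (Formula.holds_disj ..).2 ⟨_, List.mem_map_of_mem hB, h⟩⟩
  rw [hpre]
  refine Iff.trans ?_ (Formula.holds_disj ..).symm
  constructor
  · rintro ⟨B, hB, h⟩
    obtain ⟨P, hP⟩ := (I.pre_toFormula_iff χ B (θ B) α (hθ B M.reduct hM α.x)).1 h
    refine ⟨_, List.mem_map_of_mem (List.mem_flatMap.2 ⟨B, hB, List.mem_map_of_mem ?_⟩), hP⟩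
    simp
  · rintro ⟨_, hp, h⟩
    obtain ⟨_, hB', rfl⟩ := List.mem_map.1 hp
    obtain ⟨B, hB, hB'⟩ := List.mem_flatMap.1 hB'
    obtain ⟨P, -, rfl⟩ := List.mem_map.1 hB'
    exact ⟨B, hB, (I.pre_toFormula_iff χ B (θ B) α (hθ B M.reduct hM α.x)).2 ⟨P, h⟩⟩

end InsertSet

end ArtifactSetting

end RAS

theorem insertSet_transition_strongly_local (S : RAS.Sig) (T Tstar : RAS.Theory S)
    (hT : T.IsUniversal) (hTstar : RAS.IsModelCompletion.{u} T Tstar)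
    (A : RAS.ArtifactSetting S) (I : A.InsertSet) :
    (∀ (undef : S.Srt → S.Cst) (hundef : ∀ s, S.sortOf (undef s) = s),
      RAS.ArtifactSetting.TransitionFormula.IsStronglyLocal.{u}
        (I.transition (I.undefGuard undef hundef)) Tstar) ∧
    ∀ χ : RAS.QF A.sig (RAS.Ctx.single (A.art I.R)),
      RAS.ArtifactSetting.TransitionFormula.IsStronglyLocal.{u} (I.transition χ) Tstar := by
  exact ⟨fun _ _ => I.transition_isStronglyLocal hTstar.qe _,
    fun χ => I.transition_isStronglyLocal hTstar.qe χ⟩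
end
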